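/- arXiv:2408.14903 — 4 statements merged into one kernel-verified Lean document; each statement's English description precedes it below -/
import Mathlib

section
/- Assume (A1), (A2), let φ: X → ℝ be bounded measurable, let g_s(x) = Σ_{k=0}^∞ (P_s^k φ̄)(x), and assume (A4) holds with constant σ_φ² ∈ [0,∞). Then M_n/√n converges in distribution, as n → ∞, to the Gaussian distribution N(0, σ_φ²). -/
open MeasureTheory Filter Finset ProbabilityTheory
open scoped ENNReal NNReal Topology

/-- Total variation distance between two measures: `sup_A |μ(A) - ν(A)|`. -/
noncomputable def tvDist {X : Type*} [MeasurableSpace X] (μ ν : Measure X) : ℝ :=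
  ⨆ A : {A : Set X // MeasurableSet A}, |(μ A.1).toReal - (ν A.1).toReal|

/-- `iterK P s k x` is the `k`-step transition probability `P_s^k(x, ·)`. -/
noncomputable def iterK {S X : Type*} [MeasurableSpace X]
    (P : S → X → Measure X) (s : S) : ℕ → X → Measure X
  | 0 => fun x => Measure.dirac x
  | n + 1 => fun x => (P s x).bind (iterK P s n)

/-- Supremum norm `‖f‖_∞ = sup_x |f x|`. -/
noncomputable def supNorm {X : Type*} (f : X → ℝ) : ℝ := ⨆ x, |f x|

/-- Oscillation `osc(f) = sup_x f x - inf_x f x`. -/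
noncomputable def osc {X : Type*} (f : X → ℝ) : ℝ := (⨆ x, f x) - (⨅ x, f x)

/-- The solution of the Poisson equation: `g_s x = Σ_{k=0}^∞ (P_s^k φ̄)(x)`
where `φ̄ = φ - π(φ)`. -/
noncomputable def gfun {S X : Type*} [MeasurableSpace X]
    (P : S → X → Measure X) (π : Measure X) (φ : X → ℝ) (s : S) (x : X) : ℝ :=
  ∑' k : ℕ, ∫ y, (φ y - ∫ z, φ z ∂π) ∂(iterK P s k x)

/-- `Pg P π φ s x = (P_s g_s)(x)`. -/
noncomputable def Pg {S X : Type*} [MeasurableSpace X]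
    (P : S → X → Measure X) (π : Measure X) (φ : X → ℝ) (s : S) (x : X) : ℝ :=
  ∫ y, gfun P π φ s y ∂(P s x)

section Part1
variable {S X : Type*} [MeasurableSpace S] [MeasurableSpace X]

/-- Integrals of bounded functions are controlled by the total variation distance. -/
lemma aux_tv_integral (μ ν : Measure X) [IsProbabilityMeasure μ] [IsProbabilityMeasure ν]
    (f : X → ℝ) (hf : Measurable f) (B : ℝ) (hB : ∀ x, |f x| ≤ B) :
    |∫ x, f x ∂μ - ∫ x, f x ∂ν| ≤ 2 * B * tvDist μ ν := by
  have hbdd : BddAbove (Set.range fun A : {A : Set X // MeasurableSet A} =>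
      |(μ A.1).toReal - (ν A.1).toReal|) := by
    refine ⟨1, ?_⟩
    rintro _ ⟨A, rfl⟩
    have h1 : μ.real A.1 ≤ 1 := measureReal_le_one
    have h2 : ν.real A.1 ≤ 1 := measureReal_le_one
    have h3 : 0 ≤ μ.real A.1 := measureReal_nonneg
    have h4 : 0 ≤ ν.real A.1 := measureReal_nonneg
    simp only [Measure.real] at *
    rw [abs_le]; constructor <;> linarith
  have htv : ∀ A : Set X, MeasurableSet A → |μ.real A - ν.real A| ≤ tvDist μ ν :=
    fun A hA => le_ciSup hbdd ⟨A, hA⟩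
  have hX : Nonempty X := by
    by_contra h
    rw [not_nonempty_iff] at h
    have := measure_univ (μ := μ)
    rw [Set.univ_eq_empty_iff.2 h] at this
    simp at this
  have hB0 : 0 ≤ B := (abs_nonneg _).trans (hB (Classical.choice hX))
  have key : ∀ η : Measure X, IsProbabilityMeasure η →
      ∫ x, f x ∂η = (∫ t in Set.Ioc 0 (2 * B), η.real {a | t ≤ f a + B}) - B := by
    intro η hη
    have hi : Integrable f η := Integrable.of_bound hf.aestronglyMeasurable B
      (Eventually.of_forall hB)
    rw [← Integrable.integral_eq_integral_Ioc_meas_le (f := fun a => f a + B)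
      (hi.add (integrable_const B))
      (Eventually.of_forall fun x => by have := abs_le.1 (hB x); simp only [Pi.zero_apply]; linarith)
      (Eventually.of_forall fun x => by have := abs_le.1 (hB x); simp only []; linarith)]
    rw [integral_add hi (integrable_const B)]
    simp
  have hint : ∀ η : Measure X, IsProbabilityMeasure η →
      IntegrableOn (fun t => η.real {a | t ≤ f a + B}) (Set.Ioc 0 (2 * B)) := by
    intro η hη
    have hanti : Antitone (fun t : ℝ => η.real {a | t ≤ f a + B}) := by
      intro s t hst
      exact measureReal_mono (fun a (ha : t ≤ f a + B) => hst.trans ha)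
    refine Integrable.of_bound hanti.measurable.aestronglyMeasurable 1
      (Eventually.of_forall fun t => ?_)
    rw [Real.norm_eq_abs, abs_of_nonneg measureReal_nonneg]
    exact measureReal_le_one
  rw [key μ inferInstance, key ν inferInstance, sub_sub_sub_cancel_right,
    ← integral_sub (hint μ inferInstance) (hint ν inferInstance)]
  have := norm_setIntegral_le_of_norm_le_const (μ := volume) (s := Set.Ioc 0 (2 * B))
    (C := tvDist μ ν) (f := fun t => μ.real {a | t ≤ f a + B} - ν.real {a | t ≤ f a + B})
    (by rw [Real.volume_Ioc]; exact ENNReal.ofReal_lt_top) (fun t _ => htv _ (measurableSet_le measurable_const (hf.add_const B)))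
  rw [Real.norm_eq_abs, Real.volume_real_Ioc_of_le (by linarith)] at this
  linarith

/-- The kernel built from the family `P`. -/
noncomputable def auxKer (P : S → X → Measure X)
    (hPmeas : ∀ A : Set X, MeasurableSet A → Measurable fun p : S × X => P p.1 p.2 A) :
    Kernel (S × X) X :=
  ⟨fun p => P p.1 p.2, Measure.measurable_of_measurable_coe _ hPmeas⟩

lemma auxKer_apply (P : S → X → Measure X)
    (hPmeas : ∀ A : Set X, MeasurableSet A → Measurable fun p : S × X => P p.1 p.2 A)
    (p : S × X) : auxKer P hPmeas p = P p.1 p.2 := rfl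

lemma aux_markov (P : S → X → Measure X)
    (hPprob : ∀ s x, IsProbabilityMeasure (P s x))
    (hPmeas : ∀ A : Set X, MeasurableSet A → Measurable fun p : S × X => P p.1 p.2 A) :
    IsMarkovKernel (auxKer P hPmeas) := ⟨fun p => hPprob p.1 p.2⟩

lemma aux_iterK (P : S → X → Measure X)
    (hPprob : ∀ s x, IsProbabilityMeasure (P s x))
    (hPmeas : ∀ A : Set X, MeasurableSet A → Measurable fun p : S × X => P p.1 p.2 A) (k : ℕ) :
    (Measurable fun p : S × X => iterK P p.1 k p.2) ∧
      ∀ s x, IsProbabilityMeasure (iterK P s k x) := by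
  induction k with
  | zero =>
    refine ⟨?_, fun s x => ?_⟩
    · simp only [iterK]
      exact Measure.measurable_dirac.comp measurable_snd
    · simp only [iterK]; infer_instance
  | succ n ih =>
    obtain ⟨h1, h2⟩ := ih
    have := aux_markov P hPprob hPmeas
    have h3 : ∀ s, Measurable (iterK P s n) := fun s => h1.comp measurable_prodMk_left
    refine ⟨?_, fun s x => ?_⟩
    · refine Measure.measurable_of_measurable_coe _ fun A hA => ?_
      simp only [iterK]
      simp_rw [Measure.bind_apply hA (h3 _).aemeasurable]
      have : Measurable fun q : (S × X) × X => iterK P q.1.1 n q.2 A :=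
        (Measure.measurable_coe hA).comp (h1.comp
          ((measurable_fst.comp measurable_fst).prodMk measurable_snd))
      exact this.lintegral_kernel_prod_right' (κ := auxKer P hPmeas)
    · constructor
      simp only [iterK]
      have := hPprob s x
      rw [Measure.bind_apply .univ (h3 _).aemeasurable]
      have : ∀ y, iterK P s n y Set.univ = 1 := fun y => (h2 s y).measure_univ
      simp [this]

/-- `g` is jointly measurable and bounded. -/
lemma aux_gfun (P : S → X → Measure X) (π : Measure X) [IsProbabilityMeasure π]
    (hPprob : ∀ s x, IsProbabilityMeasure (P s x))
    (hPmeas : ∀ A : Set X, MeasurableSet A → Measurable fun p : S × X => P p.1 p.2 A)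
    (C ρ : ℝ) (hρ : ρ ∈ Set.Ico (0 : ℝ) 1)
    (hA2 : ∀ s x k, tvDist (iterK P s k x) π ≤ C * ρ ^ k)
    (φ : X → ℝ) (hφm : Measurable φ) (hφb : ∃ B, ∀ x, |φ x| ≤ B) :
    (Measurable fun p : S × X => gfun P π φ p.1 p.2) ∧
      ∃ K, 0 ≤ K ∧ ∀ s x, |gfun P π φ s x| ≤ K := by
  obtain ⟨B, hB⟩ := hφb
  have hX : Nonempty X := by
    by_contra h
    rw [not_nonempty_iff] at h
    have := measure_univ (μ := π)
    rw [Set.univ_eq_empty_iff.2 h] at this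
    simp at this
  have hB0 : 0 ≤ B := (abs_nonneg _).trans (hB (Classical.choice hX))
  have hbd : ∀ s x k, |∫ y, (φ y - ∫ z, φ z ∂π) ∂(iterK P s k x)| ≤ 2 * B * C * ρ ^ k := by
    intro s x k
    have := (aux_iterK P hPprob hPmeas k).2 s x
    rw [integral_sub (Integrable.of_bound hφm.aestronglyMeasurable B (Eventually.of_forall hB))
      (integrable_const _)]
    simp only [integral_const, probReal_univ, one_smul]
    refine (aux_tv_integral _ _ φ hφm B hB).trans ?_
    calc _ ≤ 2 * B * (C * ρ ^ k) := by gcongr; exact hA2 s x k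
      _ = _ := by ring
  have hgeo : Summable fun k : ℕ => 2 * B * C * ρ ^ k :=
    (summable_geometric_of_lt_one hρ.1 hρ.2).mul_left _
  have hsum : ∀ s x, Summable fun k => ∫ y, (φ y - ∫ z, φ z ∂π) ∂(iterK P s k x) :=
    fun s x => Summable.of_norm_bounded hgeo (hbd s x)
  refine ⟨?_, |∑' k : ℕ, 2 * B * C * ρ ^ k|, abs_nonneg _, fun s x => ?_⟩
  · refine measurable_of_tendsto_metrizable (f := fun n (p : S × X) =>
      ∑ k ∈ range n, ∫ y, (φ y - ∫ z, φ z ∂π) ∂(iterK P p.1 k p.2)) (fun n => ?_) ?_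
    · refine Finset.measurable_fun_sum _ fun k _ => ?_
      let κ : Kernel (S × X) X := ⟨_, (aux_iterK P hPprob hPmeas k).1⟩
      exact (StronglyMeasurable.integral_kernel (κ := κ)
        (f := fun y => φ y - ∫ z, φ z ∂π) (by fun_prop)).measurable
    · rw [tendsto_pi_nhds]
      exact fun p => (hsum p.1 p.2).hasSum.tendsto_sum_nat
  · have h := tsum_of_norm_bounded (f := fun k => ∫ y, (φ y - ∫ z, φ z ∂π) ∂(iterK P s k x))
      hgeo.hasSum (hbd s x)
    exact h.trans (le_abs_self _)

end Part1

section Part2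

lemma aux_exp_neg {x : ℝ} (hx : 0 ≤ x) : |Real.exp (-x) - 1 + x| ≤ x ^ 2 := by
  rcases le_total x 1 with h | h
  · have := Real.abs_exp_sub_one_sub_id_le (x := -x) (by rw [abs_neg, abs_of_nonneg hx]; exact h)
    simpa using this
  · have h1 := Real.add_one_le_exp (-x)
    have h2 : Real.exp (-x) ≤ 1 := Real.exp_le_one_iff.2 (by linarith)
    rw [abs_le]; constructor <;> nlinarith

lemma aux_exp_I (x : ℝ) :
    ‖Complex.exp (x * Complex.I) - (1 + x * Complex.I - x ^ 2 / 2)‖ ≤ |x| ^ 3 * Real.exp |x| := by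
  have h := Complex.norm_exp_sub_sum_le_norm_mul_exp (x * Complex.I) 3
  simp only [norm_mul, Complex.norm_I, mul_one, Complex.norm_real, Real.norm_eq_abs] at h
  convert h using 3
  simp [Finset.sum_range_succ, mul_pow, Nat.factorial]
  ring

variable {X : Type*} [MeasurableSpace X]

lemma aux_var (ν : Measure X) [IsProbabilityMeasure ν] (g : X → ℝ) (hg : Measurable g)
    (K : ℝ) (hK : ∀ x, |g x| ≤ K) :
    0 ≤ ∫ y, g y ^ 2 ∂ν - (∫ y, g y ∂ν) ^ 2 ∧
      ∫ y, g y ^ 2 ∂ν - (∫ y, g y ∂ν) ^ 2 ≤ K ^ 2 ∧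
      ∫ y, (g y - ∫ y, g y ∂ν) ^ 2 ∂ν = ∫ y, g y ^ 2 ∂ν - (∫ y, g y ∂ν) ^ 2 := by
  have hi : Integrable g ν := Integrable.of_bound hg.aestronglyMeasurable K
    (Eventually.of_forall hK)
  have hsq : ∀ x, g x ^ 2 ≤ K ^ 2 := fun x => by
    rw [← sq_abs]; exact pow_le_pow_left₀ (abs_nonneg _) (hK x) 2
  have hi2 : Integrable (fun y => g y ^ 2) ν :=
    Integrable.of_bound (hg.pow_const 2).aestronglyMeasurable (K ^ 2)
      (Eventually.of_forall fun x => by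
        rw [Real.norm_eq_abs, abs_of_nonneg (sq_nonneg _)]; exact hsq x)
  have e : ∫ y, (g y - ∫ y, g y ∂ν) ^ 2 ∂ν = ∫ y, g y ^ 2 ∂ν - (∫ y, g y ∂ν) ^ 2 := by
    set m := ∫ y, g y ∂ν with hm
    have : ∀ y, (g y - m) ^ 2 = g y ^ 2 - (2 * m) * g y + m ^ 2 := fun y => by ring
    simp_rw [this]
    have hi3 : Integrable (fun y => g y ^ 2 - (2 * m) * g y) ν := hi2.sub (hi.const_mul _)
    rw [integral_add hi3 (integrable_const _),
      integral_sub hi2 (hi.const_mul _), integral_const_mul, ← hm]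
    simp
    ring
  refine ⟨?_, ?_, e⟩
  · rw [← e]; exact integral_nonneg fun y => sq_nonneg _
  · have : ∫ y, g y ^ 2 ∂ν ≤ ∫ y, K ^ 2 ∂ν := integral_mono hi2 (integrable_const _) hsq
    simp at this
    nlinarith [sq_nonneg (∫ y, g y ∂ν)]

/-- One-step characteristic function estimate. -/
lemma aux_step (ν : Measure X) [IsProbabilityMeasure ν] (g : X → ℝ) (hg : Measurable g)
    (K : ℝ) (hK : ∀ x, |g x| ≤ K) (u : ℝ) :
    ‖∫ y, (Complex.exp ((u * (g y - ∫ y, g y ∂ν) : ℝ) * Complex.I)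
        - Complex.exp ((-(u ^ 2 / 2 * (∫ y, g y ^ 2 ∂ν - (∫ y, g y ∂ν) ^ 2)) : ℝ))) ∂ν‖
      ≤ (|u| * (2 * K)) ^ 3 * Real.exp (|u| * (2 * K)) + (u ^ 2 / 2 * K ^ 2) ^ 2 := by
  obtain ⟨hV0, hVK, hVe⟩ := aux_var ν g hg K hK
  set m := ∫ y, g y ∂ν with hm
  set V := ∫ y, g y ^ 2 ∂ν - m ^ 2 with hV
  have hi : Integrable g ν := Integrable.of_bound hg.aestronglyMeasurable K
    (Eventually.of_forall hK)
  have hmK : |m| ≤ K := by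
    have := norm_integral_le_of_norm_le_const (μ := ν) (f := g) (C := K) (Eventually.of_forall hK)
    simpa using this
  have hD : ∀ y, |u * (g y - m)| ≤ |u| * (2 * K) := fun y => by
    rw [abs_mul]
    gcongr
    calc |g y - m| ≤ |g y| + |m| := abs_sub _ _
      _ ≤ 2 * K := by linarith [hK y]
  -- the Taylor polynomial
  let T : X → ℂ := fun y => ((u * (g y - m) : ℝ) : ℂ) * Complex.I
    - (((u ^ 2 / 2 * ((g y - m) ^ 2 - V)) : ℝ) : ℂ)
  have hi1 : Integrable (fun y => u * (g y - m)) ν := (hi.sub (integrable_const _)).const_mul _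
  have hi2 : Integrable (fun y => (g y - m) ^ 2) ν := by
    refine Integrable.of_bound (by fun_prop) ((2 * K) ^ 2) (Eventually.of_forall fun y => ?_)
    rw [Real.norm_eq_abs, abs_pow]
    gcongr
    calc |g y - m| ≤ |g y| + |m| := abs_sub _ _
      _ ≤ 2 * K := by linarith [hK y]
  have hi3 : Integrable (fun y => u ^ 2 / 2 * ((g y - m) ^ 2 - V)) ν :=
    (hi2.sub (integrable_const _)).const_mul _
  have hT : Integrable T ν := (hi1.ofReal.mul_const _).sub hi3.ofReal
  have hT0 : ∫ y, T y ∂ν = 0 := by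
    have h1 : ∫ y, u * (g y - m) ∂ν = 0 := by
      rw [integral_const_mul, integral_sub hi (integrable_const _)]
      simp [← hm]
    have h2 : ∫ y, u ^ 2 / 2 * ((g y - m) ^ 2 - V) ∂ν = 0 := by
      rw [integral_const_mul, integral_sub hi2 (integrable_const _), hVe]
      simp
    simp only [T]
    rw [integral_sub (hi1.ofReal.mul_const _) hi3.ofReal, integral_mul_const,
      integral_complex_ofReal, integral_complex_ofReal, h1, h2]
    simp
  have hi4 : Integrable (fun y => Complex.exp ((u * (g y - m) : ℝ) * Complex.I)
        - Complex.exp ((-(u ^ 2 / 2 * V) : ℝ))) ν := by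
    refine Integrable.sub (Integrable.of_bound (by fun_prop) 1 (Eventually.of_forall fun y => ?_))
      (integrable_const _)
    rw [Complex.norm_exp_ofReal_mul_I]
  rw [← sub_zero (∫ y, _ ∂ν), ← hT0, ← integral_sub hi4 hT]
  refine (norm_integral_le_of_norm_le_const (C := (|u| * (2 * K)) ^ 3 * Real.exp (|u| * (2 * K))
    + (u ^ 2 / 2 * K ^ 2) ^ 2) (Eventually.of_forall fun y => ?_)).trans (by simp)
  have e : Complex.exp ((u * (g y - m) : ℝ) * Complex.I)
        - Complex.exp ((-(u ^ 2 / 2 * V) : ℝ)) - T y =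
      (Complex.exp ((u * (g y - m) : ℝ) * Complex.I) - (1 + (u * (g y - m) : ℝ) * Complex.I
        - ((u * (g y - m) : ℝ) : ℂ) ^ 2 / 2))
      - ((Real.exp (-(u ^ 2 / 2 * V)) - 1 + u ^ 2 / 2 * V : ℝ) : ℂ) := by
    simp only [T]
    push_cast
    ring
  rw [e]
  refine (norm_sub_le _ _).trans (add_le_add ((aux_exp_I _).trans ?_) ?_)
  · have h0 : 0 ≤ |u| * (2 * K) := (abs_nonneg _).trans (hD y)
    gcongr
    · exact hD y
    · exact hD y
  · rw [Complex.norm_real, Real.norm_eq_abs]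
    refine (aux_exp_neg (by positivity)).trans ?_
    gcongr

/-- Disintegration from the Markov property. -/
lemma aux_disint {Ω α : Type*} [MeasurableSpace α] {m mΩ : MeasurableSpace Ω} (hm : m ≤ mΩ)
    (μ : Measure Ω) [IsProbabilityMeasure μ] (T : Ω → α) (hT : Measurable[m] T)
    (Xn : Ω → X) (hXn : Measurable Xn) (κ : Kernel α X) [IsMarkovKernel κ]
    (hmk : ∀ A : Set X, MeasurableSet A →
      μ[fun ω => A.indicator (fun _ => (1 : ℝ)) (Xn ω) | m]
        =ᵐ[μ] fun ω => (κ (T ω) A).toReal)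
    (H : α × X → ℂ) (hH : Measurable H) (hHi : Integrable (fun ω => H (T ω, Xn ω)) μ) :
    ∫ ω, H (T ω, Xn ω) ∂μ = ∫ ω, ∫ y, H (T ω, y) ∂(κ (T ω)) ∂μ := by
  have hT' : Measurable T := hT.mono hm le_rfl
  have hTX : Measurable fun ω => (T ω, Xn ω) := hT'.prodMk hXn
  have hP : IsProbabilityMeasure (μ.map T) := Measure.isProbabilityMeasure_map hT'.aemeasurable
  have hP' : IsProbabilityMeasure (μ.map fun ω => (T ω, Xn ω)) :=
    Measure.isProbabilityMeasure_map hTX.aemeasurable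
  have key : μ.map (fun ω => (T ω, Xn ω)) = (μ.map T) ⊗ₘ κ := by
    refine Measure.ext_prod fun {s t} hs ht => ?_
    rw [Measure.compProd_apply_prod hs ht, Measure.map_apply hTX (hs.prod ht),
      setLIntegral_map hs (κ.measurable_coe ht) hT']
    have hs' : MeasurableSet[m] (T ⁻¹' s) := hT hs
    have hi : Integrable (fun ω => t.indicator (fun _ => (1 : ℝ)) (Xn ω)) μ := by
      refine Integrable.of_bound
        (((measurable_const.indicator ht).comp hXn).aestronglyMeasurable) 1
        (Eventually.of_forall fun ω => ?_)
      by_cases h : Xn ω ∈ t <;> simp [h]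
    have h1 := setIntegral_condExp hm hi hs'
    rw [setIntegral_congr_ae (hm _ hs') ((hmk t ht).mono fun ω h _ => h)] at h1
    have h2 : ∫ ω in T ⁻¹' s, t.indicator (fun _ => (1 : ℝ)) (Xn ω) ∂μ
        = μ.real ((fun ω => (T ω, Xn ω)) ⁻¹' s ×ˢ t) := by
      have : (fun ω => t.indicator (fun _ => (1 : ℝ)) (Xn ω))
          = (Xn ⁻¹' t).indicator (fun _ => (1 : ℝ)) := by
        ext ω; simp only [Set.indicator]; rfl
      rw [this, setIntegral_indicator (hXn ht)]
      simp
      congr 1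
    have h3 : Measurable fun ω => κ (T ω) t := (κ.measurable_coe ht).comp hT'
    rw [h2, integral_toReal h3.aemeasurable
      (Eventually.of_forall fun ω => measure_lt_top _ _), Measure.real] at h1
    refine ((ENNReal.toReal_eq_toReal_iff' ?_ (measure_ne_top _ _)).1 h1).symm
    refine ne_top_of_le_ne_top (b := ∫⁻ ω in T ⁻¹' s, 1 ∂μ) (by simp)
      (lintegral_mono fun ω => prob_le_one)
  have hHi' : Integrable H (μ.map fun ω => (T ω, Xn ω)) :=
    (integrable_map_measure hH.aestronglyMeasurable hTX.aemeasurable).2 hHi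
  rw [← integral_map (φ := fun ω => (T ω, Xn ω)) hTX.aemeasurable hH.aestronglyMeasurable]
  rw [key] at hHi' ⊢
  rw [Measure.integral_compProd hHi', integral_map hT'.aemeasurable]
  exact (hH.stronglyMeasurable.integral_kernel_prod_right' (κ := κ)).aestronglyMeasurable

end Part2

section Part3

/-- Conditional variance functional. -/
noncomputable def auxV {E X : Type*} [MeasurableSpace E] [MeasurableSpace X] (κ : Kernel E X)
    (G : E × X → ℝ) (e : E) : ℝ :=
  ∫ y, G (e, y) ^ 2 ∂(κ e) - (∫ y, G (e, y) ∂(κ e)) ^ 2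

/-- Martingale increment functional. -/
noncomputable def auxD {E X : Type*} [MeasurableSpace E] [MeasurableSpace X] (κ : Kernel E X)
    (G : E × X → ℝ) (q : E × X) : ℝ :=
  G q - ∫ y, G (q.1, y) ∂(κ q.1)

variable {E X : Type*} [MeasurableSpace E] [MeasurableSpace X] (κ : Kernel E X) [IsMarkovKernel κ]
  (G : E × X → ℝ)

lemma auxV_meas (hG : Measurable G) : Measurable (auxV κ G) := by
  unfold auxV
  refine Measurable.sub ?_ (Measurable.pow_const ?_ 2)
  · exact ((hG.pow_const 2).stronglyMeasurable.integral_kernel_prod_right' (κ := κ)).measurable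
  · exact (hG.stronglyMeasurable.integral_kernel_prod_right' (κ := κ)).measurable

lemma auxD_meas (hG : Measurable G) : Measurable (auxD κ G) := by
  unfold auxD
  refine hG.sub ?_
  exact (hG.stronglyMeasurable.integral_kernel_prod_right' (κ := κ)).measurable.comp measurable_fst

variable {Ω : Type*} [mΩ : MeasurableSpace Ω] (μ : Measure Ω) [IsProbabilityMeasure μ]
    (F : Filtration ℕ mΩ) (Z : ℕ → Ω → E) (Xn : ℕ → Ω → X)

/-- Quantitative estimate for the exponential martingale. -/
lemma aux_main (K : ℝ) (hK : ∀ q, |G q| ≤ K) (hG : Measurable G)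
    (hZ : ∀ k, Measurable[F k] (Z k)) (hXn : ∀ k, Measurable[F (k + 1)] (Xn k))
    (hmk : ∀ (k : ℕ) (A : Set X), MeasurableSet A →
      μ[fun ω => A.indicator (fun _ => (1 : ℝ)) (Xn k ω) | F k]
        =ᵐ[μ] fun ω => (κ (Z k ω) A).toReal) (u : ℝ) (n k : ℕ) (hk : k ≤ n) :
    ‖∫ ω, Complex.exp ((u * ∑ j ∈ range k, auxD κ G (Z j ω, Xn j ω) : ℝ) * Complex.I)
      * Complex.exp ((u ^ 2 / 2 * ∑ j ∈ range k, auxV κ G (Z j ω) : ℝ)) ∂μ - 1‖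
     ≤ k * (Real.exp (u ^ 2 / 2 * (n * K ^ 2)) *
      ((|u| * (2 * K)) ^ 3 * Real.exp (|u| * (2 * K)) + (u ^ 2 / 2 * K ^ 2) ^ 2)) := by
  have hZ' : ∀ k, Measurable (Z k) := fun k => (hZ k).mono (F.le k) le_rfl
  have hXnm : ∀ k, Measurable (Xn k) := fun k => (hXn k).mono (F.le _) le_rfl
  have hVm := auxV_meas κ G hG
  have hDm := auxD_meas κ G hG
  have hV : ∀ e, 0 ≤ auxV κ G e ∧ auxV κ G e ≤ K ^ 2 := fun e => by
    have := aux_var (κ e) (fun y => G (e, y)) (hG.comp measurable_prodMk_left) K (fun y => hK _)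
    exact ⟨this.1, this.2.1⟩
  have hW : ∀ k ω, k ≤ n → Real.exp (u ^ 2 / 2 * ∑ j ∈ range k, auxV κ G (Z j ω))
      ≤ Real.exp (u ^ 2 / 2 * (n * K ^ 2)) := fun k ω hk => by
    gcongr
    calc ∑ j ∈ range k, auxV κ G (Z j ω) ≤ ∑ j ∈ range k, K ^ 2 :=
          Finset.sum_le_sum fun j _ => (hV _).2
      _ = k * K ^ 2 := by simp
      _ ≤ n * K ^ 2 := by gcongr
  induction k with
  | zero => simp
  | succ k ih =>
    have ih := ih (by omega)
    set δ := (|u| * (2 * K)) ^ 3 * Real.exp (|u| * (2 * K)) + (u ^ 2 / 2 * K ^ 2) ^ 2 with hδ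
    let U : Ω → ℂ := fun ω =>
      Complex.exp ((u * ∑ j ∈ range k, auxD κ G (Z j ω, Xn j ω) : ℝ) * Complex.I)
    let Y : Ω → ℂ := fun ω => U ω *
      Complex.exp ((u ^ 2 / 2 * ∑ j ∈ range (k + 1), auxV κ G (Z j ω) : ℝ))
    let H : (ℂ × E) × X → ℂ := fun q => q.1.1 *
      (Complex.exp ((u * auxD κ G (q.1.2, q.2) : ℝ) * Complex.I) -
        Complex.exp ((-(u ^ 2 / 2 * auxV κ G q.1.2) : ℝ)))
    have hU : Measurable[F k] U := by
      have h : Measurable[F k] fun ω => ∑ j ∈ range k, auxD κ G (Z j ω, Xn j ω) := by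
        refine Finset.measurable_fun_sum _ fun j hj => ?_
        have hj : j < k := Finset.mem_range.1 hj
        exact hDm.comp (((hZ j).mono (F.mono hj.le) le_rfl).prodMk
          ((hXn j).mono (F.mono hj) le_rfl))
      fun_prop
    have hY : Measurable[F k] Y := by
      have h : Measurable[F k] fun ω => ∑ j ∈ range (k + 1), auxV κ G (Z j ω) := by
        refine Finset.measurable_fun_sum _ fun j hj => ?_
        have hj : j < k + 1 := Finset.mem_range.1 hj
        exact hVm.comp ((hZ j).mono (F.mono (by omega)) le_rfl)
      fun_prop
    have hH : Measurable H := by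
      have h1 : Measurable fun q : (ℂ × E) × X => auxD κ G (q.1.2, q.2) :=
        hDm.comp ((measurable_snd.comp measurable_fst).prodMk measurable_snd)
      have h2 : Measurable fun q : (ℂ × E) × X => auxV κ G q.1.2 :=
        hVm.comp (measurable_snd.comp measurable_fst)
      fun_prop
    have hYb : ∀ ω, ‖Y ω‖ ≤ Real.exp (u ^ 2 / 2 * (n * K ^ 2)) := fun ω => by
      simp only [Y, U]
      rw [norm_mul, Complex.norm_exp_ofReal_mul_I, one_mul, Complex.norm_exp_ofReal]
      exact hW _ _ hk
    have hT : Measurable[F k] fun ω => (Y ω, Z k ω) := hY.prodMk (hZ k)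
    have hT' : Measurable fun ω => (Y ω, Z k ω) := hT.mono (F.le k) le_rfl
    have hHb : ∀ ω, ‖H ((Y ω, Z k ω), Xn k ω)‖ ≤ Real.exp (u ^ 2 / 2 * (n * K ^ 2)) * 2 := by
      intro ω
      simp only [H]
      rw [norm_mul]
      gcongr
      · exact hYb ω
      · refine (norm_sub_le _ _).trans ?_
        rw [Complex.norm_exp_ofReal_mul_I, Complex.norm_exp_ofReal]
        have := (hV (Z k ω)).1
        have : Real.exp (-(u ^ 2 / 2 * auxV κ G (Z k ω))) ≤ 1 :=
          Real.exp_le_one_iff.2 (by have : 0 ≤ u ^ 2 / 2 * auxV κ G (Z k ω) := by positivity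
                                    linarith)
        linarith
    have hHi : Integrable (fun ω => H ((Y ω, Z k ω), Xn k ω)) μ :=
      Integrable.of_bound (hH.comp (hT'.prodMk (hXnm k))).aestronglyMeasurable _
        (Eventually.of_forall hHb)
    have hdis := aux_disint (F.le k) μ (fun ω => (Y ω, Z k ω)) hT (Xn k) (hXnm k)
      (κ.comap Prod.snd measurable_snd) (hmk k) H hH hHi
    have hstep : ‖∫ ω, H ((Y ω, Z k ω), Xn k ω) ∂μ‖ ≤ Real.exp (u ^ 2 / 2 * (n * K ^ 2)) * δ := by
      rw [hdis]
      refine (norm_integral_le_of_norm_le_const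
        (C := Real.exp (u ^ 2 / 2 * (n * K ^ 2)) * δ) (Eventually.of_forall fun ω => ?_)).trans
          (by simp)
      simp only [H, Kernel.comap_apply]
      rw [integral_const_mul, norm_mul]
      gcongr
      · exact hYb ω
      · exact aux_step (κ (Z k ω)) (fun y => G (Z k ω, y)) (hG.comp measurable_prodMk_left) K
          (fun y => hK _) u
    have hi0 : Integrable (fun ω =>
        Complex.exp ((u * ∑ j ∈ range k, auxD κ G (Z j ω, Xn j ω) : ℝ) * Complex.I)
        * Complex.exp ((u ^ 2 / 2 * ∑ j ∈ range k, auxV κ G (Z j ω) : ℝ))) μ := by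
      refine Integrable.of_bound (C := Real.exp (u ^ 2 / 2 * (n * K ^ 2))) ?_
        (Eventually.of_forall fun ω => ?_)
      · have h1 : Measurable fun ω => ∑ j ∈ range k, auxD κ G (Z j ω, Xn j ω) :=
          Finset.measurable_fun_sum _ fun j _ => hDm.comp ((hZ' j).prodMk (hXnm j))
        have h2 : Measurable fun ω => ∑ j ∈ range k, auxV κ G (Z j ω) :=
          Finset.measurable_fun_sum _ fun j _ => hVm.comp (hZ' j)
        exact Measurable.aestronglyMeasurable (by fun_prop)
      · rw [norm_mul, Complex.norm_exp_ofReal_mul_I, one_mul, Complex.norm_exp_ofReal]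
        exact hW _ _ (by omega)
    have hsplit : ∀ ω,
        Complex.exp ((u * ∑ j ∈ range (k + 1), auxD κ G (Z j ω, Xn j ω) : ℝ) * Complex.I)
        * Complex.exp ((u ^ 2 / 2 * ∑ j ∈ range (k + 1), auxV κ G (Z j ω) : ℝ)) =
        Complex.exp ((u * ∑ j ∈ range k, auxD κ G (Z j ω, Xn j ω) : ℝ) * Complex.I)
        * Complex.exp ((u ^ 2 / 2 * ∑ j ∈ range k, auxV κ G (Z j ω) : ℝ))
        + H ((Y ω, Z k ω), Xn k ω) := by
      intro ω
      simp only [H, Y, U]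
      rw [mul_sub, mul_assoc _ _ (Complex.exp ((-(u ^ 2 / 2 * auxV κ G (Z k ω)) : ℝ) : ℂ)),
        ← Complex.exp_add _ ((-(u ^ 2 / 2 * auxV κ G (Z k ω)) : ℝ) : ℂ)]
      have e1 : (((u ^ 2 / 2 * ∑ j ∈ range (k + 1), auxV κ G (Z j ω) : ℝ) : ℂ)
          + ((-(u ^ 2 / 2 * auxV κ G (Z k ω)) : ℝ) : ℂ))
          = ((u ^ 2 / 2 * ∑ j ∈ range k, auxV κ G (Z j ω) : ℝ) : ℂ) := by
        rw [Finset.sum_range_succ]; push_cast; ring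
      have e2 : (((u * ∑ j ∈ range (k + 1), auxD κ G (Z j ω, Xn j ω) : ℝ) : ℂ) * Complex.I)
          = ((u * ∑ j ∈ range k, auxD κ G (Z j ω, Xn j ω) : ℝ) : ℂ) * Complex.I
            + ((u * auxD κ G (Z k ω, Xn k ω) : ℝ) : ℂ) * Complex.I := by
        rw [Finset.sum_range_succ]; push_cast; ring
      rw [e1, e2, Complex.exp_add]
      ring
    simp_rw [hsplit]
    rw [integral_add hi0 hHi, add_sub_right_comm]
    refine (norm_add_le _ _).trans ((add_le_add ih hstep).trans (le_of_eq ?_))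
    push_cast
    ring

end Part3

section Part4

variable {E X : Type*} [MeasurableSpace E] [MeasurableSpace X] (κ : Kernel E X) [IsMarkovKernel κ]
  (G : E × X → ℝ) {Ω : Type*} [mΩ : MeasurableSpace Ω] (μ : Measure Ω) [IsProbabilityMeasure μ]
    (F : Filtration ℕ mΩ) (Z : ℕ → Ω → E) (Xn : ℕ → Ω → X)

lemma aux_bound_tendsto (K t : ℝ) :
    Tendsto (fun n : ℕ => n * (Real.exp ((t / √n) ^ 2 / 2 * (n * K ^ 2)) *
      ((|t / √n| * (2 * K)) ^ 3 * Real.exp (|t / √n| * (2 * K))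
        + ((t / √n) ^ 2 / 2 * K ^ 2) ^ 2))) atTop (𝓝 0) := by
  have hs : Tendsto (fun n : ℕ => (√(n : ℝ))⁻¹) atTop (𝓝 0) :=
    tendsto_inv_atTop_zero.comp (Real.tendsto_sqrt_atTop.comp tendsto_natCast_atTop_atTop)
  have hlim : Tendsto (fun n : ℕ => Real.exp (t ^ 2 / 2 * K ^ 2) *
      ((|t| * (2 * K)) ^ 3 * (√(n : ℝ))⁻¹ * Real.exp (|t| * (√(n : ℝ))⁻¹ * (2 * K))
        + (t ^ 2 / 2 * K ^ 2) ^ 2 * ((√(n : ℝ))⁻¹) ^ 2)) atTop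
      (𝓝 (Real.exp (t ^ 2 / 2 * K ^ 2) *
      ((|t| * (2 * K)) ^ 3 * 0 * Real.exp (|t| * 0 * (2 * K))
        + (t ^ 2 / 2 * K ^ 2) ^ 2 * 0 ^ 2))) := by
    refine Tendsto.const_mul _ (Tendsto.add (Tendsto.mul (hs.const_mul _) ?_)
      ((hs.pow 2).const_mul _))
    exact (Real.continuous_exp.tendsto _).comp ((hs.const_mul _).mul_const _)
  simp only [mul_zero, zero_mul, ne_eq, OfNat.ofNat_ne_zero, not_false_eq_true, zero_pow,
    add_zero] at hlim
  refine hlim.congr' ?_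
  filter_upwards [eventually_gt_atTop 0] with n hn
  have hn' : (0 : ℝ) < n := by exact_mod_cast hn
  have hr : 0 < √(n : ℝ) := Real.sqrt_pos.2 hn'
  have hrr : (n : ℝ) = √(n : ℝ) ^ 2 := (Real.sq_sqrt hn'.le).symm
  rw [abs_div, abs_of_pos hr]
  generalize √(n : ℝ) = r at *
  rw [hrr]
  have e1 : (t / r) ^ 2 / 2 * (r ^ 2 * K ^ 2) = t ^ 2 / 2 * K ^ 2 := by field_simp
  rw [e1, div_eq_mul_inv |t| r]
  field_simp

lemma aux_charFun (K : ℝ) (hK : ∀ q, |G q| ≤ K) (hG : Measurable G)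
    (hZ : ∀ k, Measurable[F k] (Z k)) (hXn : ∀ k, Measurable[F (k + 1)] (Xn k))
    (hmk : ∀ (k : ℕ) (A : Set X), MeasurableSet A →
      μ[fun ω => A.indicator (fun _ => (1 : ℝ)) (Xn k ω) | F k]
        =ᵐ[μ] fun ω => (κ (Z k ω) A).toReal) (v : ℝ≥0)
    (hA4 : TendstoInMeasure μ (fun (n : ℕ) ω => (∑ k ∈ range n, auxV κ G (Z k ω)) / n)
      atTop (fun _ => (v : ℝ))) (t : ℝ) :
    Tendsto (fun n : ℕ => ∫ ω, Complex.exp (((t / √n) * ∑ j ∈ range n,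
      auxD κ G (Z j ω, Xn j ω) : ℝ) * Complex.I) ∂μ) atTop
      (𝓝 (Complex.exp ((-(t ^ 2 / 2 * v) : ℝ)))) := by
  have hZ' : ∀ k, Measurable (Z k) := fun k => (hZ k).mono (F.le k) le_rfl
  have hXnm : ∀ k, Measurable (Xn k) := fun k => (hXn k).mono (F.le _) le_rfl
  have hVm := auxV_meas κ G hG
  have hDm := auxD_meas κ G hG
  have hV : ∀ e, 0 ≤ auxV κ G e ∧ auxV κ G e ≤ K ^ 2 := fun e => by
    have := aux_var (κ e) (fun y => G (e, y)) (hG.comp measurable_prodMk_left) K (fun y => hK _)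
    exact ⟨this.1, this.2.1⟩
  let A : ℕ → Ω → ℝ := fun n ω => (∑ k ∈ range n, auxV κ G (Z k ω)) / n
  have hAm : ∀ n, Measurable (A n) := fun n =>
    (Finset.measurable_fun_sum _ fun j _ => hVm.comp (hZ' j)).div_const _
  have hAK : ∀ n ω, A n ω ≤ K ^ 2 := fun n ω => by
    refine div_le_of_le_mul₀ (by positivity) (by positivity) ?_
    calc ∑ j ∈ range n, auxV κ G (Z j ω) ≤ ∑ j ∈ range n, K ^ 2 :=
          Finset.sum_le_sum fun j _ => (hV _).2
      _ = K ^ 2 * n := by simp [mul_comm]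
  let U : ℕ → Ω → ℂ := fun n ω => Complex.exp (((t / √n) * ∑ j ∈ range n,
      auxD κ G (Z j ω, Xn j ω) : ℝ) * Complex.I)
  have hUm : ∀ n, Measurable (U n) := fun n => by
    have h1 : Measurable fun ω => ∑ j ∈ range n, auxD κ G (Z j ω, Xn j ω) :=
      Finset.measurable_fun_sum _ fun j _ => hDm.comp ((hZ' j).prodMk (hXnm j))
    fun_prop
  have hUn : ∀ n ω, ‖U n ω‖ = 1 := fun n ω => Complex.norm_exp_ofReal_mul_I _
  let W : ℕ → Ω → ℂ := fun n ω => Complex.exp ((t ^ 2 / 2 * A n ω : ℝ))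
  have hWm : ∀ n, Measurable (W n) := fun n => by
    have := hAm n
    fun_prop
  have hWb : ∀ n ω, ‖W n ω‖ ≤ Real.exp (t ^ 2 / 2 * K ^ 2) := fun n ω => by
    simp only [W]
    rw [Complex.norm_exp_ofReal]
    gcongr
    exact hAK n ω
  let w : ℂ := Complex.exp ((t ^ 2 / 2 * v : ℝ))
  have hw0 : w ≠ 0 := Complex.exp_ne_zero _
  have hi1 : ∀ n, Integrable (fun ω => U n ω * W n ω) μ := fun n =>
    Integrable.of_bound ((hUm n).mul (hWm n)).aestronglyMeasurable
      (Real.exp (t ^ 2 / 2 * K ^ 2)) (Eventually.of_forall fun ω => by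
        rw [norm_mul, hUn, one_mul]; exact hWb n ω)
  have hiU : ∀ n, Integrable (U n) μ := fun n =>
    Integrable.of_bound (hUm n).aestronglyMeasurable 1
      (Eventually.of_forall fun ω => (hUn n ω).le)
  -- first limit
  have h1 : Tendsto (fun n => ∫ ω, U n ω * W n ω ∂μ) atTop (𝓝 1) := by
    rw [tendsto_iff_norm_sub_tendsto_zero]
    refine squeeze_zero' (Eventually.of_forall fun n => norm_nonneg _) ?_ (aux_bound_tendsto K t)
    filter_upwards [eventually_gt_atTop 0] with n hn
    have hn' : (0 : ℝ) < n := by exact_mod_cast hn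
    have h := aux_main κ G μ F Z Xn K hK hG hZ hXn hmk (t / √n) n n le_rfl
    have e : ∀ ω, (t / √n) ^ 2 / 2 * ∑ j ∈ range n, auxV κ G (Z j ω) = t ^ 2 / 2 * A n ω := by
      intro ω
      simp only [A]
      rw [div_pow, Real.sq_sqrt hn'.le]
      ring
    simp_rw [e] at h
    exact h
  -- second limit
  have h2 : Tendsto (fun n => ∫ ω, U n ω * (W n ω - w) ∂μ) atTop (𝓝 0) := by
    refine tendsto_of_subseq_tendsto fun ns hns => ?_
    obtain ⟨ms, hms, hae⟩ := (hA4.comp hns).exists_seq_tendsto_ae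
    refine ⟨ms, ?_⟩
    rw [← integral_zero Ω ℂ (μ := μ)]
    refine tendsto_integral_of_dominated_convergence
      (fun _ => Real.exp (t ^ 2 / 2 * K ^ 2) + ‖w‖)
      (fun n => ((hUm _).mul ((hWm _).sub_const _)).aestronglyMeasurable) (integrable_const _)
      (fun n => Eventually.of_forall fun ω => ?_) ?_
    · rw [norm_mul, hUn, one_mul]
      exact (norm_sub_le _ _).trans (by gcongr; exact hWb _ _)
    · filter_upwards [hae] with ω hω
      rw [tendsto_zero_iff_norm_tendsto_zero]
      simp_rw [norm_mul, hUn, one_mul]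
      rw [← tendsto_iff_norm_sub_tendsto_zero]
      have hc : Continuous fun a : ℝ => Complex.exp ((t ^ 2 / 2 * a : ℝ)) := by fun_prop
      exact (hc.tendsto (v : ℝ)).comp hω
  have h3 := (h1.sub h2).div_const w
  have e1 : ∀ n, (∫ ω, U n ω * W n ω ∂μ - ∫ ω, U n ω * (W n ω - w) ∂μ) / w
      = ∫ ω, U n ω ∂μ := fun n => by
    simp_rw [mul_sub]
    rw [integral_sub (hi1 n) ((hiU n).mul_const w), integral_mul_const, sub_sub_cancel,
      mul_div_cancel_right₀ _ hw0]
  have e2 : (1 - 0) / w = Complex.exp ((-(t ^ 2 / 2 * v) : ℝ)) := by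
    rw [Complex.ofReal_neg, Complex.exp_neg, sub_zero, one_div]
  simp_rw [e1] at h3
  rw [e2] at h3
  exact h3

lemma aux_clt (K : ℝ) (hK : ∀ q, |G q| ≤ K) (hG : Measurable G)
    (hZ : ∀ k, Measurable[F k] (Z k)) (hXn : ∀ k, Measurable[F (k + 1)] (Xn k))
    (hmk : ∀ (k : ℕ) (A : Set X), MeasurableSet A →
      μ[fun ω => A.indicator (fun _ => (1 : ℝ)) (Xn k ω) | F k]
        =ᵐ[μ] fun ω => (κ (Z k ω) A).toReal) (v : ℝ≥0)
    (hA4 : TendstoInMeasure μ (fun (n : ℕ) ω => (∑ k ∈ range n, auxV κ G (Z k ω)) / n)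
      atTop (fun _ => (v : ℝ))) (f : BoundedContinuousFunction ℝ ℝ) :
    Tendsto (fun n : ℕ => ∫ ω, f ((∑ j ∈ range n, auxD κ G (Z j ω, Xn j ω)) / √n) ∂μ) atTop
      (𝓝 (∫ x, f x ∂(gaussianReal 0 v))) := by
  have hZ' : ∀ k, Measurable (Z k) := fun k => (hZ k).mono (F.le k) le_rfl
  have hXnm : ∀ k, Measurable (Xn k) := fun k => (hXn k).mono (F.le _) le_rfl
  have hDm := auxD_meas κ G hG
  have hM : ∀ n : ℕ, Measurable fun ω => (∑ j ∈ range n, auxD κ G (Z j ω, Xn j ω)) / √n :=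
    fun n => (Finset.measurable_fun_sum _ fun j _ =>
      hDm.comp ((hZ' j).prodMk (hXnm j))).div_const _
  let L : ℕ → ProbabilityMeasure ℝ := fun n =>
    ⟨μ.map fun ω => (∑ j ∈ range n, auxD κ G (Z j ω, Xn j ω)) / √n,
      Measure.isProbabilityMeasure_map (hM n).aemeasurable⟩
  let N : ProbabilityMeasure ℝ := ⟨gaussianReal 0 v, inferInstance⟩
  have hLN : Tendsto L atTop (𝓝 N) := by
    refine ProbabilityMeasure.tendsto_iff_tendsto_charFun.2 fun t => ?_
    have h := aux_charFun κ G μ F Z Xn K hK hG hZ hXn hmk v hA4 t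
    have e2 : charFun (N : Measure ℝ) t = Complex.exp ((-(t ^ 2 / 2 * v) : ℝ)) := by
      simp only [N, ProbabilityMeasure.coe_mk]
      rw [charFun_gaussianReal]
      congr 1
      push_cast
      ring
    rw [e2]
    refine h.congr fun n => ?_
    simp only [L, ProbabilityMeasure.coe_mk]
    rw [charFun_apply_real, integral_map (hM n).aemeasurable (by fun_prop)]
    congr 1 with ω
    congr 1
    push_cast
    ring
  have h := ProbabilityMeasure.tendsto_iff_forall_integral_tendsto.1 hLN f
  refine h.congr fun n => ?_
  simp only [L, ProbabilityMeasure.coe_mk]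
  rw [integral_map (hM n).aemeasurable f.continuous.aestronglyMeasurable]

end Part4

/-- Under (A1), (A2) and (A4) with constant `σ_φ² = v`,
the martingale term satisfies the CLT: `M_n/√n → N(0, σ_φ²)` in distribution
(tested against bounded continuous functions). -/
theorem stmt4 {S X : Type*} [MeasurableSpace S] [MeasurableSpace X]
    (P : S → X → Measure X) (π : Measure X) [IsProbabilityMeasure π]
    (hPprob : ∀ s x, IsProbabilityMeasure (P s x))
    (hPmeas : ∀ A : Set X, MeasurableSet A → Measurable fun p : S × X => P p.1 p.2 A)
    (hinv : ∀ s, π.bind (P s) = π)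
    (C ρ : ℝ) (hρ : ρ ∈ Set.Ico (0 : ℝ) 1)
    (hA2 : ∀ s x k, tvDist (iterK P s k x) π ≤ C * ρ ^ k)
    {Ω : Type*} [mΩ : MeasurableSpace Ω] (μ : Measure Ω) [IsProbabilityMeasure μ]
    (F : Filtration ℕ mΩ) (Sp : ℕ → Ω → S) (Xp : ℕ → Ω → X)
    (hadapted : ∀ k, Measurable[F k] fun ω => (Sp k ω, Xp k ω))
    (hmarkov : ∀ (k : ℕ) (A : Set X), MeasurableSet A →
      μ[fun ω => A.indicator (fun _ => (1 : ℝ)) (Xp (k + 1) ω) | F k]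
        =ᵐ[μ] fun ω => (P (Sp k ω) (Xp k ω) A).toReal)
    (φ : X → ℝ) (hφm : Measurable φ) (hφb : ∃ B, ∀ x, |φ x| ≤ B)
    (v : ℝ≥0)
    (hA4 : TendstoInMeasure μ (fun n ω => (∑ k ∈ Finset.Icc 1 n,
        ((∫ y, gfun P π φ (Sp (k - 1) ω) y ^ 2 ∂(P (Sp (k - 1) ω) (Xp (k - 1) ω)))
          - Pg P π φ (Sp (k - 1) ω) (Xp (k - 1) ω) ^ 2)) / n)
      atTop (fun _ => (v : ℝ))) :
    ∀ f : BoundedContinuousFunction ℝ ℝ,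
      Tendsto (fun n : ℕ => ∫ ω, f ((∑ k ∈ Finset.Icc 1 n,
          (gfun P π φ (Sp (k - 1) ω) (Xp k ω) - Pg P π φ (Sp (k - 1) ω) (Xp (k - 1) ω)))
            / Real.sqrt n) ∂μ)
        atTop (𝓝 (∫ x, f x ∂(gaussianReal 0 v))) := by

  intro f
  obtain ⟨hgm, K, hK0, hgK⟩ := aux_gfun P π hPprob hPmeas C ρ hρ hA2 φ hφm hφb
  have hMk := aux_markov P hPprob hPmeas
  let κ := auxKer P hPmeas
  let G : (S × X) × X → ℝ := fun q => gfun P π φ q.1.1 q.2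
  have hG : Measurable G :=
    hgm.comp ((measurable_fst.comp measurable_fst).prodMk measurable_snd)
  have hIcc : ∀ (n : ℕ) (h : ℕ → ℝ), ∑ k ∈ Finset.Icc 1 n, h k = ∑ k ∈ range n, h (k + 1) := by
    intro n h
    induction n with
    | zero => simp
    | succ n ih => rw [Finset.sum_Icc_succ_top (by omega), ih, Finset.sum_range_succ]
  have h := aux_clt κ G μ F (fun k ω => (Sp k ω, Xp k ω)) (fun k => Xp (k + 1)) K
    (fun q => hgK _ _) hG hadapted (fun k => measurable_snd.comp (hadapted (k + 1))) hmarkov v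
    (by
      simp_rw [hIcc] at hA4
      exact hA4) f
  simp_rw [hIcc]
  exact h
end

section
/- Assume (A1) and (A2), let φ: X → ℝ be bounded measurable, and suppose the adaptation is weakly 1-waning. Then the weak law of large numbers holds: (1/n) Σ_{k=1}^n φ(X_k) → π(φ) in probability as n → ∞. -/
open MeasureTheory Filter Finset ProbabilityTheory
open scoped ENNReal NNReal Topology

lemma tvDist_integral_le {X : Type*} [MeasurableSpace X] (μ ν : Measure X)
    [IsProbabilityMeasure μ] [IsProbabilityMeasure ν] (f : X → ℝ) (hf : Measurable f)
    (B d : ℝ) (hB0 : 0 ≤ B) (hB : ∀ x, |f x| ≤ B) (hd : tvDist μ ν ≤ d) :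
    |∫ x, f x ∂μ - ∫ x, f x ∂ν| ≤ 2 * B * d := by
  have hset : ∀ A, MeasurableSet A → |μ.real A - ν.real A| ≤ d := by
    intro A hA
    refine le_trans ?_ hd
    refine le_ciSup (f := fun A : {A : Set X // MeasurableSet A} =>
      |(μ A.1).toReal - (ν A.1).toReal|) ⟨1, ?_⟩ ⟨A, hA⟩
    rintro _ ⟨A, rfl⟩
    have h1 : μ.real A.1 ≤ 1 := measureReal_le_one
    have h2 : ν.real A.1 ≤ 1 := measureReal_le_one
    have h3 : 0 ≤ μ.real A.1 := measureReal_nonneg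
    have h4 : 0 ≤ ν.real A.1 := measureReal_nonneg
    simp only [measureReal_def] at *
    rw [abs_le]; constructor <;> linarith
  have key : ∀ (m : Measure X) [IsProbabilityMeasure m],
      ∫ x, f x ∂m = (∫ t in Set.Ioc 0 (2 * B), m.real {a | t ≤ f a + B}) - B := by
    intro m _
    have hi : Integrable f m := Integrable.of_bound hf.aestronglyMeasurable B (ae_of_all _ hB)
    have := Integrable.integral_eq_integral_Ioc_meas_le (μ := m) (f := fun x => f x + B)
      (M := 2 * B) (hi.add (integrable_const _))
      (ae_of_all _ fun x => by have := abs_le.1 (hB x); simp; linarith)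
      (ae_of_all _ fun x => by have := abs_le.1 (hB x); simp; linarith)
    rw [← this, integral_add hi (integrable_const _)]
    simp
  have hint : ∀ (m : Measure X) [IsProbabilityMeasure m],
      IntegrableOn (fun t => m.real {a | t ≤ f a + B}) (Set.Ioc 0 (2 * B)) := by
    intro m _
    have hanti : Antitone (fun t => m.real {a | t ≤ f a + B}) := by
      intro s t hst
      exact measureReal_mono (fun a ha => le_trans hst ha)
    refine Integrable.of_bound hanti.measurable.aestronglyMeasurable 1 (ae_of_all _ fun t => ?_)
    rw [Real.norm_eq_abs, abs_of_nonneg measureReal_nonneg]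
    exact measureReal_le_one
  rw [key μ, key ν, sub_sub_sub_cancel_right, ← integral_sub (hint μ) (hint ν)]
  have := norm_setIntegral_le_of_norm_le_const (μ := volume) (s := Set.Ioc 0 (2 * B)) (C := d)
    (f := fun t => μ.real {a | t ≤ f a + B} - ν.real {a | t ≤ f a + B}) measure_Ioc_lt_top
    (fun t _ => hset _ (measurableSet_le measurable_const (hf.add_const B)))
  rw [Real.norm_eq_abs] at this
  refine this.trans (le_of_eq ?_)
  rw [Real.volume_real_Ioc_of_le (by linarith)]
  ring

/-- iterated operator -/
noncomputable def hfun {S X : Type*} [MeasurableSpace X]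
    (P : S → X → Measure X) (f : X → ℝ) : ℕ → S → X → ℝ
  | 0 => fun _ x => f x
  | n + 1 => fun s x => ∫ y, hfun P f n s y ∂(P s x)

section aux
set_option linter.unusedSectionVars false
variable {S X : Type*} [MeasurableSpace S] [MeasurableSpace X]
    (P : S → X → Measure X)

/-- joint kernel -/
noncomputable def jker (hPmeas : ∀ A : Set X, MeasurableSet A →
      Measurable fun p : S × X => P p.1 p.2 A) : Kernel (S × X) X where
  toFun := fun p => P p.1 p.2
  measurable' := Measure.measurable_of_measurable_coe _ hPmeas

lemma jker_markov (hPprob : ∀ s x, IsProbabilityMeasure (P s x))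
    (hPmeas : ∀ A : Set X, MeasurableSet A → Measurable fun p : S × X => P p.1 p.2 A) :
    IsMarkovKernel (jker P hPmeas) := ⟨fun p => hPprob p.1 p.2⟩

lemma op_meas (hPprob : ∀ s x, IsProbabilityMeasure (P s x))
    (hPmeas : ∀ A : Set X, MeasurableSet A → Measurable fun p : S × X => P p.1 p.2 A)
    (g : S → X → ℝ) (hg : Measurable fun p : S × X => g p.1 p.2) :
    Measurable fun p : S × X => ∫ y, g p.1 y ∂(P p.1 p.2) := by
  have := jker_markov P hPprob hPmeas
  have h := StronglyMeasurable.integral_kernel_prod_right' (κ := jker P hPmeas)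
    (f := fun q : (S × X) × X => g q.1.1 q.2)
    (hg.comp (by fun_prop : Measurable fun q : (S × X) × X => (q.1.1, q.2))).stronglyMeasurable
  exact h.measurable

lemma op_bound (hPprob : ∀ s x, IsProbabilityMeasure (P s x))
    (g : X → ℝ) (B : ℝ) (hB : ∀ x, |g x| ≤ B) (s : S) (x : X) :
    |∫ y, g y ∂(P s x)| ≤ B := by
  have := norm_integral_le_of_norm_le_const (μ := P s x) (f := g) (C := B) (ae_of_all _ hB)
  simpa using this

lemma hfun_meas (hPprob : ∀ s x, IsProbabilityMeasure (P s x))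
    (hPmeas : ∀ A : Set X, MeasurableSet A → Measurable fun p : S × X => P p.1 p.2 A)
    (f : X → ℝ) (hf : Measurable f) (n : ℕ) :
    Measurable fun p : S × X => hfun P f n p.1 p.2 := by
  induction n with
  | zero => exact hf.comp measurable_snd
  | succ n ih => exact op_meas P hPprob hPmeas _ ih

lemma hfun_bound (hPprob : ∀ s x, IsProbabilityMeasure (P s x))
    (f : X → ℝ) (B : ℝ) (hB : ∀ x, |f x| ≤ B) (n : ℕ) (s : S) (x : X) :
    |hfun P f n s x| ≤ B := by
  induction n generalizing x with
  | zero => exact hB x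
  | succ n ih => exact op_bound P hPprob _ B ih s x

lemma iterK_meas (hPmeas : ∀ A : Set X, MeasurableSet A → Measurable fun p : S × X => P p.1 p.2 A)
    (s : S) (n : ℕ) : Measurable (iterK P s n) := by
  induction n with
  | zero => exact Measure.measurable_dirac
  | succ n ih =>
    have h : Measurable (P s) := Measure.measurable_of_measurable_coe _ fun A hA =>
      (hPmeas A hA).comp measurable_prodMk_left
    exact (Measure.measurable_bind' ih).comp h

lemma iterK_prob (hPprob : ∀ s x, IsProbabilityMeasure (P s x))
    (hPmeas : ∀ A : Set X, MeasurableSet A → Measurable fun p : S × X => P p.1 p.2 A)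
    (s : S) (n : ℕ) (x : X) : IsProbabilityMeasure (iterK P s n x) := by
  induction n generalizing x with
  | zero => exact Measure.dirac.isProbabilityMeasure
  | succ n ih => exact isProbabilityMeasure_bind (iterK_meas P hPmeas s n).aemeasurable (ae_of_all _ ih)

lemma hfun_eq (hPprob : ∀ s x, IsProbabilityMeasure (P s x))
    (hPmeas : ∀ A : Set X, MeasurableSet A → Measurable fun p : S × X => P p.1 p.2 A)
    (f : X → ℝ) (hf : Measurable f) (B : ℝ) (hB : ∀ x, |f x| ≤ B) (n : ℕ) (s : S) (x : X) :
    hfun P f n s x = ∫ y, f y ∂(iterK P s n x) := by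
  induction n generalizing x with
  | zero => simp [hfun, iterK, integral_dirac' _ _ hf.stronglyMeasurable]
  | succ n ih =>
    let κ : Kernel X X := ⟨iterK P s n, iterK_meas P hPmeas s n⟩
    have hp := iterK_prob P hPprob hPmeas s
    have := hp (n+1) x
    let κ0 : Kernel X X := ⟨P s, Measure.measurable_of_measurable_coe _ fun A hA =>
      (hPmeas A hA).comp measurable_prodMk_left⟩
    have hi : Integrable f ((κ ∘ₖ κ0) x) :=
      Integrable.of_bound (μ := iterK P s (n+1) x) hf.aestronglyMeasurable B (ae_of_all _ hB)
    have h2 := Kernel.integral_comp hi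
    simp only [hfun, iterK, ih]
    exact h2.symm

lemma hfun_diff (hPprob : ∀ s x, IsProbabilityMeasure (P s x))
    (hPmeas : ∀ A : Set X, MeasurableSet A → Measurable fun p : S × X => P p.1 p.2 A)
    (f : X → ℝ) (hf : Measurable f) (B : ℝ) (hB0 : 0 ≤ B) (hB : ∀ x, |f x| ≤ B)
    (s t : S) (d : ℝ) (hd : ∀ x, tvDist (P s x) (P t x) ≤ d) (n : ℕ) (x : X) :
    |hfun P f n s x - hfun P f n t x| ≤ n * (2 * B * d) := by
  induction n generalizing x with
  | zero => simp [hfun]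
  | succ n ih =>
    have hm : ∀ s, Measurable (hfun P f n s) := fun s =>
      (hfun_meas P hPprob hPmeas f hf n).comp measurable_prodMk_left
    have hi : ∀ s' s, Integrable (hfun P f n s) (P s' x) := fun s' s =>
      Integrable.of_bound (hm s).aestronglyMeasurable B
        (ae_of_all _ (hfun_bound P hPprob f B hB n s))
    have h1 := tvDist_integral_le (P s x) (P t x) (hfun P f n t) (hm t) B d hB0
      (hfun_bound P hPprob f B hB n t) (hd x)
    have h2 := op_bound P hPprob (fun y => hfun P f n s y - hfun P f n t y) _ ih s x
    rw [integral_sub (hi s s) (hi s t)] at h2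
    simp only [hfun]
    have h3 := abs_sub_le (∫ y, hfun P f n s y ∂(P s x)) (∫ y, hfun P f n t y ∂(P s x))
      (∫ y, hfun P f n t y ∂(P t x))
    push_cast
    linarith

lemma markov_orth (hPprob : ∀ s x, IsProbabilityMeasure (P s x))
    (hPmeas : ∀ A : Set X, MeasurableSet A → Measurable fun p : S × X => P p.1 p.2 A)
    {Ω : Type*} (m : MeasurableSpace Ω) [mΩ : MeasurableSpace Ω] (μ : Measure Ω)
    [IsProbabilityMeasure μ] (hm : m ≤ mΩ) (s : Ω → S) (x : Ω → X) (x' : Ω → X)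
    (hsx : Measurable[m] fun ω => (s ω, x ω)) (hx' : Measurable x')
    (hmarkov : ∀ (A : Set X), MeasurableSet A →
      μ[fun ω => A.indicator (fun _ => (1 : ℝ)) (x' ω) | m]
        =ᵐ[μ] fun ω => (P (s ω) (x ω) A).toReal)
    (Z : Ω → ℝ) (hZ : Measurable[m] Z) (M : ℝ) (hZM : ∀ ω, |Z ω| ≤ M)
    (g : S → X → ℝ) (hg : Measurable fun p : S × X => g p.1 p.2) (B : ℝ)
    (hB : ∀ s x, |g s x| ≤ B) :
    ∫ ω, Z ω * (g (s ω) (x' ω) - ∫ y, g (s ω) y ∂(P (s ω) (x ω))) ∂μ = 0 := by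
  have := jker_markov P hPprob hPmeas
  have hsx' : Measurable fun ω => (s ω, x ω) := hsx.mono hm le_rfl
  have hs' : Measurable s := measurable_fst.comp hsx'
  have hZ' : Measurable Z := hZ.mono hm le_rfl
  let Y : Ω → ℝ × (S × X) := fun ω => (Z ω, (s ω, x ω))
  have hYm : Measurable[m] Y := hZ.prodMk hsx
  have hY : Measurable Y := hYm.mono hm le_rfl
  have hpr : IsProbabilityMeasure (μ.map Y) := Measure.isProbabilityMeasure_map hY.aemeasurable
  let κ : Kernel (ℝ × (S × X)) X := (jker P hPmeas).comap Prod.snd measurable_snd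
  have hpr2 : IsProbabilityMeasure (μ.map fun ω => (Y ω, x' ω)) :=
    Measure.isProbabilityMeasure_map (hY.prodMk hx').aemeasurable
  have hlaw : μ.map (fun ω => (Y ω, x' ω)) = (μ.map Y) ⊗ₘ κ := by
    refine Measure.ext_prod ?_
    intro U A hU hA
    rw [Measure.map_apply (hY.prodMk hx') (hU.prod hA), Measure.compProd_apply_prod hU hA,
      setLIntegral_map hU (κ.measurable_coe hA) hY]
    have hk : ∀ ω, κ (Y ω) A = P (s ω) (x ω) A := fun ω => rfl
    simp only [hk]
    have hi : Integrable (fun ω => A.indicator (fun _ => (1 : ℝ)) (x' ω)) μ := by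
      refine Integrable.of_bound ((measurable_const.indicator hA).comp hx').aestronglyMeasurable 1
        (ae_of_all _ fun ω => ?_)
      by_cases h : x' ω ∈ A <;> simp [h]
    have h1 := setIntegral_condExp (μ := μ) hm hi (hYm hU)
    rw [setIntegral_congr_ae (hm _ (hYm hU)) ((hmarkov A hA).mono fun ω h _ => h)] at h1
    have h2 : ∫ ω in Y ⁻¹' U, A.indicator (fun _ => (1 : ℝ)) (x' ω) ∂μ
        = μ.real ((fun ω => (Y ω, x' ω)) ⁻¹' U ×ˢ A) := by
      have : (fun ω => A.indicator (fun _ => (1 : ℝ)) (x' ω))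
          = (x' ⁻¹' A).indicator (fun _ => (1 : ℝ)) := by
        rfl
      rw [this, setIntegral_indicator (hx' hA)]
      simp
      rfl
    have hmeasP : Measurable fun ω => P (s ω) (x ω) A := (hPmeas A hA).comp hsx'
    rw [integral_toReal hmeasP.aemeasurable (ae_of_all _ fun ω => measure_lt_top _ _), h2,
      measureReal_def, ENNReal.toReal_eq_toReal_iff' _ (measure_ne_top _ _)] at h1
    · exact h1.symm
    · refine ne_top_of_le_ne_top (b := μ (Y ⁻¹' U)) (measure_ne_top _ _) ?_
      calc _ ≤ ∫⁻ ω in Y ⁻¹' U, 1 ∂μ := lintegral_mono fun ω => prob_le_one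
        _ = _ := by simp
  have hfm : Measurable fun q : (ℝ × (S × X)) × X => q.1.1 * g q.1.2.1 q.2 :=
    (by fun_prop : Measurable fun q : (ℝ × (S × X)) × X => q.1.1).mul
      (hg.comp (by fun_prop : Measurable fun q : (ℝ × (S × X)) × X => (q.1.2.1, q.2)))
  have hbd : ∀ ω y, ‖Z ω * g (s ω) y‖ ≤ M * B := by
    intro ω y
    rw [norm_mul]
    exact mul_le_mul (hZM ω) (hB _ _) (norm_nonneg _) ((abs_nonneg _).trans (hZM ω))
  have hg1 : Measurable fun ω => g (s ω) (x' ω) := hg.comp (hs'.prodMk hx')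
  have hi1 : Integrable (fun ω => Z ω * g (s ω) (x' ω)) μ :=
    Integrable.of_bound (hZ'.mul hg1).aestronglyMeasurable (M * B) (ae_of_all _ fun ω => hbd ω _)
  have hop : Measurable fun ω => ∫ y, g (s ω) y ∂(P (s ω) (x ω)) :=
    (op_meas P hPprob hPmeas g hg).comp hsx'
  have hi2 : Integrable (fun ω => Z ω * ∫ y, g (s ω) y ∂(P (s ω) (x ω))) μ := by
    refine Integrable.of_bound (hZ'.mul hop).aestronglyMeasurable (M * B) (ae_of_all _ fun ω => ?_)
    rw [norm_mul]
    exact mul_le_mul (hZM ω) (op_bound P hPprob _ B (hB _) _ _) (norm_nonneg _)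
      ((abs_nonneg _).trans (hZM ω))
  simp only [mul_sub]
  rw [integral_sub hi1 hi2, sub_eq_zero]
  have hYx : Measurable fun ω => (Y ω, x' ω) := hY.prodMk hx'
  have e1 := integral_map (μ := μ) hYx.aemeasurable
    (f := fun q : (ℝ × (S × X)) × X => q.1.1 * g q.1.2.1 q.2) hfm.aestronglyMeasurable
  have hint : Integrable (fun q : (ℝ × (S × X)) × X => q.1.1 * g q.1.2.1 q.2)
      (μ.map fun ω => (Y ω, x' ω)) :=
    (integrable_map_measure hfm.aestronglyMeasurable hYx.aemeasurable).2 hi1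
  rw [hlaw] at e1 hint
  rw [Measure.integral_compProd hint] at e1
  have hfm2 := (hfm.stronglyMeasurable.integral_kernel_prod_right' (κ := κ))
  rw [integral_map hY.aemeasurable hfm2.aestronglyMeasurable] at e1
  refine Eq.trans e1.symm ?_
  refine integral_congr_ae (ae_of_all _ fun ω => ?_)
  exact integral_const_mul _ _

end aux

lemma mart_bound {S X : Type*} [MeasurableSpace S] [MeasurableSpace X]
    (P : S → X → Measure X)
    (hPprob : ∀ s x, IsProbabilityMeasure (P s x))
    (hPmeas : ∀ A : Set X, MeasurableSet A → Measurable fun p : S × X => P p.1 p.2 A)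
    {Ω : Type*} [mΩ : MeasurableSpace Ω] (μ : Measure Ω) [IsProbabilityMeasure μ]
    (F : Filtration ℕ mΩ) (Sp : ℕ → Ω → S) (Xp : ℕ → Ω → X)
    (hadapted : ∀ k, Measurable[F k] fun ω => (Sp k ω, Xp k ω))
    (hmarkov : ∀ (k : ℕ) (A : Set X), MeasurableSet A →
      μ[fun ω => A.indicator (fun _ => (1 : ℝ)) (Xp (k + 1) ω) | F k]
        =ᵐ[μ] fun ω => (P (Sp k ω) (Xp k ω) A).toReal)
    (g : S → X → ℝ) (hg : Measurable fun p : S × X => g p.1 p.2) (B : ℝ)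
    (hB : ∀ s x, |g s x| ≤ B) (Δ : ℕ → Ω → ℝ)
    (hΔ : ∀ k ω, Δ k ω = g (Sp k ω) (Xp (k + 1) ω)
      - ∫ y, g (Sp k ω) y ∂(P (Sp k ω) (Xp k ω))) (n : ℕ) :
    Integrable (fun ω => (∑ k ∈ range n, Δ k ω) ^ 2) μ ∧
    ∫ ω, (∑ k ∈ range n, Δ k ω) ^ 2 ∂μ ≤ n * (2 * B) ^ 2 := by
  have hX : ∀ k, Measurable[F k] (Xp k) := fun k => measurable_snd.comp (hadapted k)
  have hS : ∀ k, Measurable[F k] (Sp k) := fun k => measurable_fst.comp (hadapted k)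
  have hΔb : ∀ k ω, |Δ k ω| ≤ 2 * B := by
    intro k ω
    rw [hΔ]
    have h1 := hB (Sp k ω) (Xp (k + 1) ω)
    have h2 := op_bound P hPprob _ B (hB (Sp k ω)) (Sp k ω) (Xp k ω)
    rw [abs_le] at *
    constructor <;> linarith
  have hΔm : ∀ k, Measurable[F (k + 1)] (Δ k) := by
    intro k
    rw [show Δ k = _ from funext (hΔ k)]
    have hS' : Measurable[F (k + 1)] (Sp k) := (hS k).mono (F.mono (Nat.le_succ k)) le_rfl
    have ha' : Measurable[F (k + 1)] fun ω => (Sp k ω, Xp k ω) :=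
      (hadapted k).mono (F.mono (Nat.le_succ k)) le_rfl
    exact (hg.comp (hS'.prodMk (hX (k + 1)))).sub ((op_meas P hPprob hPmeas g hg).comp ha')
  have hMm : ∀ n, Measurable[F n] fun ω => ∑ k ∈ range n, Δ k ω := by
    intro n
    refine Finset.measurable_fun_sum _ fun k hk => ?_
    exact (hΔm k).mono (F.mono (Finset.mem_range.1 hk)) le_rfl
  have hMb : ∀ n ω, |∑ k ∈ range n, Δ k ω| ≤ n * (2 * B) := by
    intro n ω
    refine (abs_sum_le_sum_abs _ _).trans ?_
    refine (sum_le_sum fun k _ => hΔb k ω).trans (le_of_eq ?_)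
    simp
  have hMm' : ∀ n, Measurable fun ω => ∑ k ∈ range n, Δ k ω := fun n =>
    (hMm n).mono (F.le n) le_rfl
  have hΔm' : ∀ n, Measurable (Δ n) := fun n => (hΔm n).mono (F.le _) le_rfl
  have hsq : ∀ n, Integrable (fun ω => (∑ k ∈ range n, Δ k ω) ^ 2) μ := by
    intro n
    refine Integrable.of_bound ((hMm' n).pow_const 2).aestronglyMeasurable ((n * (2 * B)) ^ 2)
      (ae_of_all _ fun ω => ?_)
    rw [norm_pow]
    exact pow_le_pow_left₀ (norm_nonneg _) (hMb n ω) 2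
  refine ⟨hsq n, ?_⟩
  induction n with
  | zero => simp
  | succ n ih =>
    have horth := markov_orth P hPprob hPmeas (F n) μ (F.le n) (Sp n) (Xp n) (Xp (n + 1))
      (hadapted n) ((hX (n + 1)).mono (F.le _) le_rfl) (hmarkov n) _ (hMm n) _ (hMb n) g hg B hB
    simp only [← hΔ] at horth
    have hi2 : Integrable (fun ω => (∑ k ∈ range n, Δ k ω) * Δ n ω) μ := by
      refine Integrable.of_bound ((hMm' n).mul (hΔm' n)).aestronglyMeasurable
        ((n * (2 * B)) * (2 * B)) (ae_of_all _ fun ω => ?_)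
      rw [norm_mul]
      exact mul_le_mul (hMb n ω) (hΔb n ω) (norm_nonneg _) ((abs_nonneg _).trans (hMb n ω))
    have hb3 : ∀ ω, ‖(Δ n ω) ^ 2‖ ≤ (2 * B) ^ 2 := fun ω => by
      rw [norm_pow]
      exact pow_le_pow_left₀ (norm_nonneg _) (hΔb n ω) 2
    have hi3 : Integrable (fun ω => (Δ n ω) ^ 2) μ :=
      Integrable.of_bound ((hΔm' n).pow_const 2).aestronglyMeasurable _ (ae_of_all _ hb3)
    have he : ∀ ω, (∑ k ∈ range (n + 1), Δ k ω) ^ 2 = (∑ k ∈ range n, Δ k ω) ^ 2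
        + 2 * ((∑ k ∈ range n, Δ k ω) * Δ n ω) + (Δ n ω) ^ 2 := by
      intro ω; rw [sum_range_succ]; ring
    have h3 := (le_abs_self _).trans (norm_integral_le_of_norm_le_const (μ := μ) (ae_of_all _ hb3))
    simp only [probReal_univ, mul_one] at h3
    simp only [he]
    have hi4 : Integrable (fun ω => (∑ k ∈ range n, Δ k ω) ^ 2
        + 2 * ((∑ k ∈ range n, Δ k ω) * Δ n ω)) μ := (hsq n).add (hi2.const_mul 2)
    rw [integral_add hi4 hi3, integral_add (hsq n) (hi2.const_mul 2),
      integral_const_mul, horth]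
    push_cast
    linarith

/-- Under (A1), (A2) and weakly 1-waning adaptation (A5),
the weak law of large numbers holds: `(1/n) Σ_{k=1}^n φ(X_k) → π(φ)` in
probability. -/
theorem stmt7 {S X : Type*} [MeasurableSpace S] [MeasurableSpace X]
    (P : S → X → Measure X) (π : Measure X) [IsProbabilityMeasure π]
    (hPprob : ∀ s x, IsProbabilityMeasure (P s x))
    (hPmeas : ∀ A : Set X, MeasurableSet A → Measurable fun p : S × X => P p.1 p.2 A)
    (hinv : ∀ s, π.bind (P s) = π)
    (C ρ : ℝ) (hρ : ρ ∈ Set.Ico (0 : ℝ) 1)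
    (hA2 : ∀ s x k, tvDist (iterK P s k x) π ≤ C * ρ ^ k)
    {Ω : Type*} [mΩ : MeasurableSpace Ω] (μ : Measure Ω) [IsProbabilityMeasure μ]
    (F : Filtration ℕ mΩ) (Sp : ℕ → Ω → S) (Xp : ℕ → Ω → X)
    (hadapted : ∀ k, Measurable[F k] fun ω => (Sp k ω, Xp k ω))
    (hmarkov : ∀ (k : ℕ) (A : Set X), MeasurableSet A →
      μ[fun ω => A.indicator (fun _ => (1 : ℝ)) (Xp (k + 1) ω) | F k]
        =ᵐ[μ] fun ω => (P (Sp k ω) (Xp k ω) A).toReal)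
    (φ : X → ℝ) (hφm : Measurable φ) (hφb : ∃ B, ∀ x, |φ x| ≤ B)
    (D : ℕ → Ω → ℝ) (hD01 : ∀ k ω, D k ω ∈ Set.Icc (0 : ℝ) 1)
    (hDbound : ∀ k, 1 ≤ k → ∀ ω x,
      tvDist (P (Sp k ω) x) (P (Sp (k - 1) ω) x) ≤ D k ω)
    (hwaning : TendstoInMeasure μ (fun n ω => (∑ k ∈ Finset.Icc 1 n, D k ω) / n)
      atTop (fun _ => 0)) :
    TendstoInMeasure μ (fun n ω => (∑ k ∈ Finset.Icc 1 n, φ (Xp k ω)) / n)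
      atTop (fun _ => ∫ x, φ x ∂π) := by
  obtain ⟨B, hB⟩ := hφb
  have hXne : Nonempty X := nonempty_of_isProbabilityMeasure π
  have hB0 : 0 ≤ B := (abs_nonneg _).trans (hB hXne.some)
  set c := ∫ x, φ x ∂π with hc
  have hcB : |c| ≤ B := by
    have := norm_integral_le_of_norm_le_const (μ := π) (f := φ) (C := B) (ae_of_all _ hB)
    simpa using this
  let f : X → ℝ := fun x => φ x - c
  have hfm : Measurable f := hφm.sub_const c
  let G := 2 * B
  have hG0 : 0 ≤ G := by positivity
  have hfG : ∀ x, |f x| ≤ G := fun x => by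
    have := hB x
    simp only [f, G]
    rw [abs_le] at *
    constructor <;> linarith
  have hfi : ∀ (m : Measure X) [IsProbabilityMeasure m], Integrable φ m := fun m _ =>
    Integrable.of_bound hφm.aestronglyMeasurable B (ae_of_all _ hB)
  have hπf : ∫ x, f x ∂π = 0 := by
    simp only [f]
    rw [integral_sub (hfi π) (integrable_const _)]
    simp [hc]
  rw [tendstoInMeasure_iff_norm] at hwaning ⊢
  intro ε hε
  -- choose the truncation level
  obtain ⟨N, hN⟩ : ∃ N : ℕ, 2 * G * (C * ρ ^ N) < ε / 4 := by
    have h1 : Tendsto (fun N : ℕ => 2 * G * (C * ρ ^ N)) atTop (𝓝 (2 * G * (C * 0))) :=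
      ((tendsto_pow_atTop_nhds_zero_of_lt_one hρ.1 hρ.2).const_mul C).const_mul (2 * G)
    rw [mul_zero, mul_zero] at h1
    exact (h1.eventually (gt_mem_nhds (by positivity))).exists
  have hhN : ∀ s x, |hfun P f N s x| < ε / 4 := by
    intro s x
    have := iterK_prob P hPprob hPmeas s N x
    have h1 := tvDist_integral_le (iterK P s N x) π f hfm G _ hG0 hfG (hA2 s x N)
    rw [hπf, sub_zero, ← hfun_eq P hPprob hPmeas f hfm G hfG] at h1
    exact h1.trans_lt hN
  let g : S → X → ℝ := fun s x => ∑ k ∈ range N, hfun P f k s x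
  have hgm : Measurable fun p : S × X => g p.1 p.2 :=
    Finset.measurable_fun_sum _ fun k _ => hfun_meas P hPprob hPmeas f hfm k
  have hgb : ∀ s x, |g s x| ≤ N * G := by
    intro s x
    refine (abs_sum_le_sum_abs _ _).trans ?_
    refine (sum_le_sum fun k _ => hfun_bound P hPprob f G hfG k s x).trans (le_of_eq ?_)
    simp
  have hpois : ∀ s x, f x = g s x - (∫ y, g s y ∂(P s x)) + hfun P f N s x := by
    intro s x
    have h1 : ∫ y, g s y ∂(P s x) = ∑ k ∈ range N, hfun P f (k + 1) s x := by
      simp only [g]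
      rw [integral_finset_sum]
      · rfl
      · intro k _
        exact Integrable.of_bound ((hfun_meas P hPprob hPmeas f hfm k).comp
          measurable_prodMk_left).aestronglyMeasurable G
          (ae_of_all _ (hfun_bound P hPprob f G hfG k s))
    have h2 := Finset.sum_range_succ (fun k => hfun P f k s x) N
    have h3 := Finset.sum_range_succ' (fun k => hfun P f k s x) N
    have h4 : hfun P f 0 s x = f x := rfl
    rw [h1]
    simp only [g]
    linarith
  let K : ℝ := N * (N * (2 * G))
  have hK0 : 0 ≤ K := by positivity
  have hgd : ∀ k ω x, |g (Sp (k + 1) ω) x - g (Sp k ω) x| ≤ K * D (k + 1) ω := by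
    intro k ω x
    have hD0 := (hD01 (k + 1) ω).1
    have hd := hDbound (k + 1) (by omega) ω
    simp only [Nat.add_sub_cancel] at hd
    simp only [g]
    rw [← sum_sub_distrib]
    refine (abs_sum_le_sum_abs _ _).trans ?_
    have : ∀ j ∈ range N, |hfun P f j (Sp (k + 1) ω) x - hfun P f j (Sp k ω) x|
        ≤ N * (2 * G * D (k + 1) ω) := by
      intro j hj
      refine (hfun_diff P hPprob hPmeas f hfm G hG0 hfG _ _ _ hd j x).trans ?_
      have : (j : ℝ) ≤ N := by exact_mod_cast (Finset.mem_range.1 hj).le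
      gcongr
    refine (sum_le_sum this).trans (le_of_eq ?_)
    simp [K]; ring
  let Δ : ℕ → Ω → ℝ := fun k ω => g (Sp k ω) (Xp (k + 1) ω)
      - ∫ y, g (Sp k ω) y ∂(P (Sp k ω) (Xp k ω))
  have hmart := mart_bound P hPprob hPmeas μ F Sp Xp hadapted hmarkov g hgm (N * G) hgb Δ
    (fun _ _ => rfl)
  have hsumD : ∀ n ω, ∑ k ∈ Finset.Icc 1 n, D k ω = ∑ k ∈ range n, D (k + 1) ω := by
    intro n ω
    rw [Finset.range_eq_Ico, Finset.sum_Ico_add' (fun k => D k ω) 0 n 1]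
    rfl
  have hsumX : ∀ n ω, ∑ k ∈ Finset.Icc 1 n, φ (Xp k ω) = ∑ k ∈ range n, φ (Xp (k + 1) ω) := by
    intro n ω
    rw [Finset.range_eq_Ico, Finset.sum_Ico_add' (fun k => φ (Xp k ω)) 0 n 1]
    rfl
  -- pathwise decomposition
  have hdec : ∀ (n : ℕ) ω, ∑ k ∈ Finset.Icc 1 n, φ (Xp k ω) - n * c
      = ∑ k ∈ range n, Δ k ω
        + (g (Sp 0 ω) (Xp 0 ω) - g (Sp n ω) (Xp n ω) + f (Xp n ω) - f (Xp 0 ω))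
        + ∑ k ∈ range n, (g (Sp (k + 1) ω) (Xp (k + 1) ω) - g (Sp k ω) (Xp (k + 1) ω))
        + ∑ k ∈ range n, hfun P f N (Sp k ω) (Xp k ω) := by
    intro n ω
    rw [hsumX]
    induction n with
    | zero => simp
    | succ n ih =>
      simp only [sum_range_succ]
      have h1 := hpois (Sp n ω) (Xp n ω)
      have h2 : f (Xp (n + 1) ω) = φ (Xp (n + 1) ω) - c := rfl
      have h3 : Δ n ω = g (Sp n ω) (Xp (n + 1) ω)
        - ∫ y, g (Sp n ω) y ∂(P (Sp n ω) (Xp n ω)) := rfl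
      push_cast
      linarith
  let R : ℝ := 2 * (N * G) + 2 * G
  have hbound : ∀ (n : ℕ) ω, |∑ k ∈ Finset.Icc 1 n, φ (Xp k ω) - n * c|
      ≤ |∑ k ∈ range n, Δ k ω| + R + K * ∑ k ∈ Finset.Icc 1 n, D k ω + n * (ε / 4) := by
    intro n ω
    have h1 : |g (Sp 0 ω) (Xp 0 ω) - g (Sp n ω) (Xp n ω) + f (Xp n ω) - f (Xp 0 ω)| ≤ R := by
      have a1 := abs_le.1 (hgb (Sp 0 ω) (Xp 0 ω))
      have a2 := abs_le.1 (hgb (Sp n ω) (Xp n ω))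
      have a3 := abs_le.1 (hfG (Xp n ω))
      have a4 := abs_le.1 (hfG (Xp 0 ω))
      simp only [R]
      rw [abs_le]
      constructor <;> linarith
    have h2 : |∑ k ∈ range n, (g (Sp (k + 1) ω) (Xp (k + 1) ω) - g (Sp k ω) (Xp (k + 1) ω))|
        ≤ K * ∑ k ∈ Finset.Icc 1 n, D k ω := by
      rw [hsumD, mul_sum]
      exact (abs_sum_le_sum_abs _ _).trans (sum_le_sum fun k _ => hgd k ω _)
    have h3 : |∑ k ∈ range n, hfun P f N (Sp k ω) (Xp k ω)| ≤ n * (ε / 4) := by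
      refine (abs_sum_le_sum_abs _ _).trans ?_
      refine (sum_le_sum fun k _ => (hhN (Sp k ω) (Xp k ω)).le).trans (le_of_eq ?_)
      simp
    rw [hdec]
    refine (abs_add_le _ _).trans (add_le_add ?_ h3)
    refine (abs_add_le _ _).trans (add_le_add ?_ h2)
    exact (abs_add_le _ _).trans (add_le_add le_rfl h1)
  have hε8 : 0 < ε / 8 := by positivity
  have hM0 : Tendsto (fun n : ℕ => μ {ω | n * (ε / 4) ≤ |∑ k ∈ range n, Δ k ω|}) atTop (𝓝 0) := by
    have hlim : Tendsto (fun n : ℕ => ENNReal.ofReal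
        (((2 * (N * G)) ^ 2 / (ε / 4) ^ 2) / (n : ℝ))) atTop (𝓝 0) := by
      rw [← ENNReal.ofReal_zero]
      exact ENNReal.tendsto_ofReal (tendsto_const_div_atTop_nhds_zero_nat _)
    refine tendsto_of_tendsto_of_tendsto_of_le_of_le' tendsto_const_nhds hlim
      (Eventually.of_forall fun _ => zero_le) ?_
    filter_upwards [eventually_ge_atTop 1] with n hn
    have hn0 : (0 : ℝ) < n := by exact_mod_cast hn
    have hn4 : (0 : ℝ) < n * (ε / 4) := by positivity
    have hmk := (mul_meas_ge_le_integral_of_nonneg (ae_of_all _ fun ω => sq_nonneg _)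
      (hmart n).1 ((n * (ε / 4)) ^ 2)).trans (hmart n).2
    have hset : {ω | n * (ε / 4) ≤ |∑ k ∈ range n, Δ k ω|}
        = {ω | (n * (ε / 4)) ^ 2 ≤ (∑ k ∈ range n, Δ k ω) ^ 2} := by
      ext ω
      simp only [Set.mem_setOf_eq]
      rw [sq_le_sq, abs_of_pos hn4]
    rw [hset, ← ofReal_measureReal]
    refine ENNReal.ofReal_le_ofReal ?_
    rw [div_div, le_div_iff₀ (by positivity)]
    have h5 : (n : ℝ) * ((ε / 4) ^ 2 * n *
        μ.real {ω | (n * (ε / 4)) ^ 2 ≤ (∑ k ∈ range n, Δ k ω) ^ 2})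
        ≤ n * (2 * (N * G)) ^ 2 := by
      refine le_trans (le_of_eq ?_) hmk
      ring
    have := le_of_mul_le_mul_left h5 hn0
    linarith
  have hD0 := hwaning (ε / 8 / (K + 1)) (by positivity)
  have hsum := hM0.add hD0
  rw [add_zero] at hsum
  refine tendsto_of_tendsto_of_tendsto_of_le_of_le' tendsto_const_nhds hsum
    (Eventually.of_forall fun _ => zero_le) ?_
  have hR : ∀ᶠ n : ℕ in atTop, R / (n : ℝ) < ε / 4 :=
    (tendsto_const_div_atTop_nhds_zero_nat R).eventually (gt_mem_nhds (by positivity))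
  filter_upwards [eventually_ge_atTop 1, hR] with n hn hRn
  refine le_trans (measure_mono ?_) (measure_union_le _ _)
  intro ω hω
  by_contra hcon
  simp only [Set.mem_union, Set.mem_setOf_eq, not_or, not_le, sub_zero] at hcon hω
  obtain ⟨hc1, hc2⟩ := hcon
  have hn0 : (0 : ℝ) < n := by exact_mod_cast hn
  have hc3 := (le_abs_self _).trans_lt hc2
  rw [div_lt_iff₀ hn0] at hRn hc3
  have hc4 : K * ∑ k ∈ Finset.Icc 1 n, D k ω ≤ n * (ε / 8) := by
    have hS0 : 0 ≤ ∑ k ∈ Finset.Icc 1 n, D k ω := sum_nonneg fun k _ => (hD01 k ω).1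
    have h6 : (K + 1) * ∑ k ∈ Finset.Icc 1 n, D k ω ≤ (K + 1) * (ε / 8 / (K + 1) * n) := by
      gcongr
    have h7 : (K + 1) * (ε / 8 / (K + 1) * n) = n * (ε / 8) := by field_simp
    linarith
  have hb := hbound n ω
  have he : |∑ k ∈ Finset.Icc 1 n, φ (Xp k ω) - n * c| =
      n * ‖(∑ k ∈ Finset.Icc 1 n, φ (Xp k ω)) / n - c‖ := by
    rw [Real.norm_eq_abs, ← abs_of_pos hn0, ← abs_mul, abs_of_pos hn0]
    congr 1
    field_simp
  rw [he] at hb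
  have h8 : n * ε ≤ n * ‖(∑ k ∈ Finset.Icc 1 n, φ (Xp k ω)) / n - c‖ := by gcongr
  have : 0 < n * ε := by positivity
  linarith
end

section
/- Assume (A1) and (A2), let φ: X → ℝ be bounded measurable, and suppose the adaptation is strongly 1-waning. Then the strong law of large numbers holds: (1/n) Σ_{k=1}^n φ(X_k) → π(φ) almost surely as n → ∞. -/
open MeasureTheory Filter Finset ProbabilityTheory
open scoped ENNReal NNReal Topology

section helpers

lemma h8_abs_le_tv {X : Type*} [MeasurableSpace X] (μ ν : Measure X)
    [IsProbabilityMeasure μ] [IsProbabilityMeasure ν] (A : Set X) (hA : MeasurableSet A) :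
    |μ.real A - ν.real A| ≤ tvDist μ ν := by
  have : BddAbove (Set.range fun A : {A : Set X // MeasurableSet A} =>
      |(μ A.1).toReal - (ν A.1).toReal|) := by
    refine ⟨1, ?_⟩
    rintro _ ⟨B, rfl⟩
    have h1 : μ.real B.1 ≤ 1 := measureReal_le_one
    have h2 : ν.real B.1 ≤ 1 := measureReal_le_one
    have h3 : 0 ≤ μ.real B.1 := measureReal_nonneg
    have h4 : 0 ≤ ν.real B.1 := measureReal_nonneg
    change |μ.real B.1 - ν.real B.1| ≤ 1
    rw [abs_le]; constructor <;> linarith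
  exact le_ciSup this ⟨A, hA⟩

lemma h8_integrable {X : Type*} [MeasurableSpace X] (μ : Measure X)
    [IsProbabilityMeasure μ] (f : X → ℝ) (hf : Measurable f) (B : ℝ) (hB : ∀ x, |f x| ≤ B) :
    Integrable f μ :=
  Integrable.of_bound hf.aestronglyMeasurable B (Eventually.of_forall hB)

lemma h8_abs_integral_le {X : Type*} [MeasurableSpace X] (μ : Measure X)
    [IsProbabilityMeasure μ] (f : X → ℝ) (B : ℝ) (hB : ∀ x, |f x| ≤ B) :
    |∫ x, f x ∂μ| ≤ B := by
  have := norm_integral_le_of_norm_le_const (μ := μ) (f := f) (C := B) (Eventually.of_forall hB)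
  simpa using this

lemma h8_tv_integral {X : Type*} [MeasurableSpace X] (μ ν : Measure X)
    [IsProbabilityMeasure μ] [IsProbabilityMeasure ν] (f : X → ℝ) (hf : Measurable f)
    (B : ℝ) (hB : ∀ x, |f x| ≤ B) :
    |∫ x, f x ∂μ - ∫ x, f x ∂ν| ≤ 2 * B * tvDist μ ν := by
  have hne : Nonempty X := by
    by_contra h
    rw [not_nonempty_iff] at h
    have : μ = 0 := Measure.eq_zero_of_isEmpty μ
    exact IsProbabilityMeasure.ne_zero μ this
  have hB0 : 0 ≤ B := (abs_nonneg _).trans (hB hne.some)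
  have key : ∀ (m : Measure X) [IsProbabilityMeasure m],
      ∫ x, f x ∂m = (∫ t in Set.Ioc 0 (2 * B), m.real {a : X | t ≤ f a + B}) - B := by
    intro m _
    have hi := h8_integrable m f hf B hB
    have h1 : Integrable (fun x => f x + B) m := hi.add (integrable_const B)
    rw [← h1.integral_eq_integral_Ioc_meas_le, integral_add hi (integrable_const B)]
    · simp
    · exact Eventually.of_forall fun x => by
        have := abs_le.1 (hB x); simp only [Pi.zero_apply]; linarith
    · exact Eventually.of_forall fun x => by
        have := abs_le.1 (hB x); simp only; linarith
  have hint : ∀ (m : Measure X) [IsProbabilityMeasure m],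
      IntegrableOn (fun t => m.real {a : X | t ≤ f a + B}) (Set.Ioc 0 (2 * B)) := by
    intro m _
    have hanti : Antitone (fun t => m.real {a : X | t ≤ f a + B}) := by
      intro s t hst
      exact measureReal_mono (fun a (ha : t ≤ f a + B) => hst.trans ha)
    refine Integrable.of_bound hanti.measurable.aestronglyMeasurable 1 (Eventually.of_forall ?_)
    intro t
    simp only [Real.norm_eq_abs]
    rw [abs_of_nonneg measureReal_nonneg]
    exact measureReal_le_one
  rw [key μ, key ν, sub_sub_sub_cancel_right, ← integral_sub (hint μ) (hint ν)]
  have := norm_setIntegral_le_of_norm_le_const (μ := volume) (s := Set.Ioc 0 (2 * B))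
    (f := fun t => μ.real {a : X | t ≤ f a + B} - ν.real {a : X | t ≤ f a + B})
    (C := tvDist μ ν) (by rw [Real.volume_Ioc]; exact ENNReal.ofReal_lt_top) (fun t _ => h8_abs_le_tv μ ν _
      (measurableSet_le measurable_const (hf.add_const B)))
  rw [Real.norm_eq_abs] at this
  refine this.trans (le_of_eq ?_)
  rw [Real.volume_real_Ioc_of_le (by linarith)]
  ring

lemma h8_law {Ω E X : Type*} (m : MeasurableSpace Ω) [mΩ : MeasurableSpace Ω] [MeasurableSpace E] [MeasurableSpace X]
    (μ : Measure Ω) [IsProbabilityMeasure μ] (hm : m ≤ mΩ)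
    (W : Ω → E) (hW : Measurable[m] W) (Y : Ω → X) (hY : Measurable Y)
    (κ : Kernel E X) [IsMarkovKernel κ]
    (h : ∀ A : Set X, MeasurableSet A →
      μ[fun ω => A.indicator (fun _ => (1 : ℝ)) (Y ω) | m] =ᵐ[μ] fun ω => (κ (W ω) A).toReal) :
    μ.map (fun ω => (W ω, Y ω)) = (μ.map W) ⊗ₘ κ := by
  have hW' : Measurable W := hW.mono hm le_rfl
  have : IsProbabilityMeasure (μ.map W) := Measure.isProbabilityMeasure_map hW'.aemeasurable
  have : IsProbabilityMeasure (μ.map (fun ω => (W ω, Y ω))) :=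
    Measure.isProbabilityMeasure_map (hW'.prodMk hY).aemeasurable
  refine Measure.ext_prod ?_
  intro A B hA hB
  rw [Measure.compProd_apply_prod hA hB, Measure.map_apply (hW'.prodMk hY) (hA.prod hB),
    setLIntegral_map hA (κ.measurable_coe hB) hW']
  have hs : MeasurableSet[m] (W ⁻¹' A) := hW hA
  have hs' : MeasurableSet (W ⁻¹' A) := hW' hA
  have hfi : Integrable (fun ω => B.indicator (fun _ => (1 : ℝ)) (Y ω)) μ :=
    h8_integrable μ _ ((measurable_const.indicator hB).comp hY) 1 (fun ω => by
      by_cases hb : Y ω ∈ B <;> simp [hb])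
  have e1 := setIntegral_condExp hm hfi hs
  rw [setIntegral_congr_ae (g := fun ω => (κ (W ω) B).toReal) hs'
    ((h B hB).mono fun ω hω _ => hω)] at e1
  rw [integral_toReal (f := fun ω => κ (W ω) B) ((κ.measurable_coe hB).comp hW').aemeasurable
    (Eventually.of_forall fun ω => measure_lt_top _ _)] at e1
  have e2 : ∫ ω in W ⁻¹' A, B.indicator (fun _ => (1 : ℝ)) (Y ω) ∂μ
      = (μ (W ⁻¹' A ∩ Y ⁻¹' B)).toReal := by
    have : (fun ω => B.indicator (fun _ => (1 : ℝ)) (Y ω))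
      = (Y ⁻¹' B).indicator (fun _ => (1 : ℝ)) := by
      ext ω; rfl
    rw [this, setIntegral_indicator (hY hB)]
    simp [Measure.real]
  rw [e2] at e1
  have hfin : ∫⁻ ω in W ⁻¹' A, κ (W ω) B ∂μ ≠ ⊤ := by
    refine ne_of_lt (lt_of_le_of_lt (lintegral_mono (g := fun _ => 1) fun ω => prob_le_one) ?_)
    simp
  have := (ENNReal.toReal_eq_toReal_iff' hfin (measure_ne_top _ _)).1 e1
  rw [this]; rfl

lemma h8_law_integral {Ω E X : Type*} (m : MeasurableSpace Ω) [mΩ : MeasurableSpace Ω] [MeasurableSpace E]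
    [MeasurableSpace X]
    (μ : Measure Ω) [IsProbabilityMeasure μ] (hm : m ≤ mΩ)
    (W : Ω → E) (hW : Measurable[m] W) (Y : Ω → X) (hY : Measurable Y)
    (κ : Kernel E X) [IsMarkovKernel κ]
    (h : ∀ A : Set X, MeasurableSet A →
      μ[fun ω => A.indicator (fun _ => (1 : ℝ)) (Y ω) | m] =ᵐ[μ] fun ω => (κ (W ω) A).toReal)
    (f : E × X → ℝ) (hf : Measurable f) 
    (hfi : Integrable (fun ω => f (W ω, Y ω)) μ) :
    ∫ ω, f (W ω, Y ω) ∂μ = ∫ ω, ∫ y, f (W ω, y) ∂(κ (W ω)) ∂μ := by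
  have hW' : Measurable W := hW.mono hm le_rfl
  have hl := h8_law m μ hm W hW Y hY κ h
  have : IsProbabilityMeasure (μ.map W) := Measure.isProbabilityMeasure_map hW'.aemeasurable
  rw [← integral_map (f := f) (hW'.prodMk hY).aemeasurable hf.aestronglyMeasurable, hl,
    Measure.integral_compProd, integral_map hW'.aemeasurable]
  · exact (hf.stronglyMeasurable.integral_kernel_prod_right' (κ := κ)).aestronglyMeasurable
  · rw [← hl, integrable_map_measure hf.aestronglyMeasurable (hW'.prodMk hY).aemeasurable]
    exact hfi

lemma h8_slln {Ω : Type*} [mΩ : MeasurableSpace Ω] (μ : Measure Ω) [IsProbabilityMeasure μ]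
    (d : ℕ → Ω → ℝ) (hd : ∀ k, Measurable (d k)) (K : ℝ) (hK : ∀ k ω, |d k ω| ≤ K)
    (horth : ∀ n, ∫ ω, (∑ i ∈ range n, d i ω) * d n ω ∂μ = 0) :
    ∀ᵐ ω ∂μ, Tendsto (fun n : ℕ => (∑ i ∈ range n, d i ω) / n) atTop (𝓝 0) := by
  have hSm : ∀ n, Measurable fun ω => ∑ i ∈ range n, d i ω := fun n =>
    Finset.measurable_fun_sum _ fun i _ => hd i
  have hSb : ∀ n ω, |∑ i ∈ range n, d i ω| ≤ n * K := by
    intro n ω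
    refine (Finset.abs_sum_le_sum_abs _ _).trans ?_
    refine (Finset.sum_le_sum fun i _ => hK i ω).trans ?_
    simp
  have hne : Nonempty Ω := nonempty_of_isProbabilityMeasure μ
  have hK0 : 0 ≤ K := (abs_nonneg _).trans (hK 0 hne.some)
  have hS2i : ∀ n, Integrable (fun ω => (∑ i ∈ range n, d i ω) ^ 2) μ := fun n =>
    h8_integrable μ _ ((hSm n).pow_const 2) ((n * K) ^ 2) fun ω => by
      rw [abs_pow]; exact pow_le_pow_left₀ (abs_nonneg _) (hSb n ω) 2
  have hV : ∀ n : ℕ, ∫ ω, (∑ i ∈ range n, d i ω) ^ 2 ∂μ ≤ n * K ^ 2 := by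
    intro n
    induction n with
    | zero => simp
    | succ n ih =>
      have hci : Integrable (fun ω => (∑ i ∈ range n, d i ω) * d n ω) μ :=
        h8_integrable μ _ ((hSm n).mul (hd n)) ((n * K) * K) fun ω => by
          rw [abs_mul]
          exact mul_le_mul (hSb n ω) (hK n ω) (abs_nonneg _) (by positivity)
      have hd2b : ∀ ω, |d n ω ^ 2| ≤ K ^ 2 := fun ω => by
        rw [abs_pow]; exact pow_le_pow_left₀ (abs_nonneg _) (hK n ω) 2
      have hdi : Integrable (fun ω => d n ω ^ 2) μ :=
        h8_integrable μ _ ((hd n).pow_const 2) (K ^ 2) hd2b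
      have e : ∀ ω, (∑ i ∈ range (n + 1), d i ω) ^ 2
          = (∑ i ∈ range n, d i ω) ^ 2 + (2 * ((∑ i ∈ range n, d i ω) * d n ω) + d n ω ^ 2) := by
        intro ω; rw [Finset.sum_range_succ]; ring
      simp_rw [e]
      rw [integral_add (hS2i n) (show Integrable (fun ω => 2 * ((∑ i ∈ range n, d i ω) * d n ω) + d n ω ^ 2) μ from (hci.const_mul 2).add hdi), integral_add (hci.const_mul 2) hdi,
        integral_const_mul, horth n]
      have := (abs_le.1 (h8_abs_integral_le μ _ _ hd2b)).2
      push_cast; linarith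
  -- square subsequence
  let Z : ℕ → Ω → ℝ := fun n ω => ((∑ i ∈ range ((n + 1) ^ 2), d i ω) / ((n + 1 : ℝ) ^ 2)) ^ 2
  have hZm : ∀ n, Measurable (Z n) := fun n => ((hSm _).div_const _).pow_const 2
  have hZb : ∀ n, ∫⁻ ω, ENNReal.ofReal (Z n ω) ∂μ ≤ ENNReal.ofReal (K ^ 2 * (1 / (n + 1 : ℝ) ^ 2)) := by
    intro n
    have e : ∀ ω, Z n ω = (∑ i ∈ range ((n + 1) ^ 2), d i ω) ^ 2 * (((n + 1 : ℝ) ^ 2) ^ 2)⁻¹ := by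
      intro ω; simp only [Z, div_pow]; rfl
    have hi : Integrable (Z n) μ := by
      rw [show Z n = _ from funext e]; exact (hS2i _).mul_const _
    rw [← ofReal_integral_eq_lintegral_ofReal hi (Eventually.of_forall fun ω => sq_nonneg _)]
    refine ENNReal.ofReal_le_ofReal ?_
    simp_rw [e]
    rw [integral_mul_const]
    have := hV ((n + 1) ^ 2)
    push_cast at this
    have hp : (0 : ℝ) < (n + 1 : ℝ) := by positivity
    calc _ ≤ ((n + 1 : ℝ) ^ 2 * K ^ 2) * (((n + 1 : ℝ) ^ 2) ^ 2)⁻¹ := by gcongr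
      _ = _ := by field_simp
  have hsum : Summable fun n : ℕ => K ^ 2 * (1 / (n + 1 : ℝ) ^ 2) := by
    have := (summable_nat_add_iff 1).2 (Real.summable_one_div_nat_pow.2 (one_lt_two))
    push_cast at this
    exact this.mul_left _
  have hfin : ∫⁻ ω, ∑' n, ENNReal.ofReal (Z n ω) ∂μ ≠ ⊤ := by
    rw [lintegral_tsum fun n => (hZm n).ennreal_ofReal.aemeasurable]
    exact ne_top_of_le_ne_top hsum.tsum_ofReal_ne_top (ENNReal.tsum_le_tsum hZb)
  have hae := ae_lt_top (Measurable.tsum fun n => (hZm n).ennreal_ofReal) hfin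
  filter_upwards [hae] with ω hω
  have h1 := ENNReal.tendsto_atTop_zero_of_tsum_ne_top hω.ne
  have h2 : Tendsto (fun n => Z n ω) atTop (𝓝 0) := by
    have := (ENNReal.tendsto_toReal ENNReal.zero_ne_top).comp h1
    simpa [Function.comp_def, ENNReal.toReal_ofReal (sq_nonneg _), Z] using this
  have h3 : Tendsto (fun n : ℕ => (∑ i ∈ range ((n + 1) ^ 2), d i ω) / ((n + 1 : ℝ) ^ 2))
      atTop (𝓝 0) := by
    have := h2.sqrt
    simp only [Z, Real.sqrt_sq_eq_abs, Real.sqrt_zero] at this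
    exact (tendsto_zero_iff_abs_tendsto_zero _).2 this
  have h4 : Tendsto (fun n : ℕ => (∑ i ∈ range n, (d i ω + K)) / (n : ℝ)) atTop (𝓝 K) := by
    refine tendsto_div_of_monotone_of_exists_subseq_tendsto_div 
      (fun n => ∑ i ∈ range n, (d i ω + K)) K ?_ ?_
    · refine monotone_nat_of_le_succ fun n => ?_
      rw [Finset.sum_range_succ]
      have := (abs_le.1 (hK n ω)).1
      linarith
    · intro a ha
      refine ⟨fun n => (n + 1) ^ 2, ?_, ?_, ?_⟩
      · have t : Tendsto (fun n : ℕ => (1 + 1 / ((n : ℝ) + 1)) ^ 2) atTop (𝓝 ((1 + 0) ^ 2)) :=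
          (tendsto_const_nhds.add tendsto_one_div_add_atTop_nhds_zero_nat).pow 2
        have := t.eventually_le_const (u := a) (by simpa using ha)
        filter_upwards [this] with n hn
        push_cast
        have hp : (0 : ℝ) < (n + 1 : ℝ) := by positivity
        calc ((n : ℝ) + 1 + 1) ^ 2 = (1 + 1 / ((n : ℝ) + 1)) ^ 2 * (n + 1) ^ 2 := by field_simp
          _ ≤ _ := by gcongr
      · exact tendsto_atTop_mono (fun n => by simp only [id]; nlinarith [Nat.zero_le n]) tendsto_id
      · have := h3.add_const K
        rw [zero_add] at this
        refine this.congr fun n => ?_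
        rw [Finset.sum_add_distrib]
        have hp : (0 : ℝ) < (n + 1 : ℝ) := by positivity
        simp only [sum_const, card_range, nsmul_eq_mul]
        push_cast
        field_simp
  have h5 := h4.sub_const K
  rw [sub_self] at h5
  refine h5.congr' ?_
  filter_upwards [eventually_gt_atTop 0] with n hn
  have : (0 : ℝ) < n := by exact_mod_cast hn
  rw [Finset.sum_add_distrib]
  simp only [sum_const, card_range, nsmul_eq_mul]
  field_simp
  ring

/-- Iterated action of the kernels on a function. -/
noncomputable def h8Q {S X : Type*} [MeasurableSpace X]
    (P : S → X → Measure X) (f : X → ℝ) : ℕ → S × X → ℝ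
  | 0 => fun p => f p.2
  | n + 1 => fun p => ∫ y, h8Q P f n (p.1, y) ∂(P p.1 p.2)

lemma h8_iterK {S X : Type*} [MeasurableSpace X] (P : S → X → Measure X)
    (hPprob : ∀ s x, IsProbabilityMeasure (P s x)) (hP : ∀ s, Measurable (P s)) (s : S) (n : ℕ) :
    Measurable (iterK P s n) ∧ ∀ x, IsProbabilityMeasure (iterK P s n x) := by
  induction n with
  | zero => exact ⟨Measure.measurable_dirac, fun x => Measure.dirac.isProbabilityMeasure⟩
  | succ n ih =>
    refine ⟨(Measure.measurable_bind' ih.1).comp (hP s), fun x => ⟨?_⟩⟩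
    change ((P s x).bind (iterK P s n)) Set.univ = 1
    rw [Measure.bind_apply MeasurableSet.univ ih.1.aemeasurable]
    have := ih.2
    simp

lemma h8_Q_bound {S X : Type*} [MeasurableSpace X] (P : S → X → Measure X)
    (hPprob : ∀ s x, IsProbabilityMeasure (P s x)) (f : X → ℝ) (B : ℝ) (hB : ∀ x, |f x| ≤ B)
    (n : ℕ) (p : S × X) : |h8Q P f n p| ≤ B := by
  induction n generalizing p with
  | zero => exact hB _
  | succ n ih => exact h8_abs_integral_le (P p.1 p.2) _ B fun y => ih _

lemma h8_Q_meas {S X : Type*} [MeasurableSpace S] [MeasurableSpace X] (P : S → X → Measure X)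
    (hPprob : ∀ s x, IsProbabilityMeasure (P s x))
    (hPmeas : ∀ A : Set X, MeasurableSet A → Measurable fun p : S × X => P p.1 p.2 A)
    (f : X → ℝ) (hf : Measurable f) (n : ℕ) : Measurable (h8Q P f n) := by
  induction n with
  | zero => exact hf.comp measurable_snd
  | succ n ih =>
    let κ : Kernel (S × X) X := ⟨fun p => P p.1 p.2, Measure.measurable_of_measurable_coe _ hPmeas⟩
    have : IsMarkovKernel κ := ⟨fun p => hPprob p.1 p.2⟩
    have h : Measurable fun q : (S × X) × X => h8Q P f n (q.1.1, q.2) :=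
      ih.comp (measurable_fst.fst.prodMk measurable_snd)
    exact (h.stronglyMeasurable.integral_kernel_prod_right' (κ := κ)).measurable

lemma h8_Q_iterK {S X : Type*} [MeasurableSpace X] (P : S → X → Measure X)
    (hPprob : ∀ s x, IsProbabilityMeasure (P s x)) (hP : ∀ s, Measurable (P s))
    (f : X → ℝ) (hf : Measurable f) (B : ℝ) (hB : ∀ x, |f x| ≤ B) (s : S) (n : ℕ) (x : X) :
    h8Q P f n (s, x) = ∫ y, f y ∂(iterK P s n x) := by
  induction n generalizing x with
  | zero => 
    change f x = ∫ y, f y ∂(Measure.dirac x)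
    rw [integral_dirac' _ _ hf.stronglyMeasurable]
  | succ n ih =>
    let κ : Kernel X X := ⟨P s, hP s⟩
    let η : Kernel X X := ⟨iterK P s n, (h8_iterK P hPprob hP s n).1⟩
    have e : iterK P s (n + 1) x = (η ∘ₖ κ) x := by
      rw [Kernel.comp_apply]; rfl
    have := (h8_iterK P hPprob hP s (n + 1)).2 x
    have hi := h8_integrable (iterK P s (n + 1) x) f hf B hB
    rw [e] at hi ⊢
    rw [Kernel.integral_comp hi]
    change ∫ y, h8Q P f n (s, y) ∂(P s x) = ∫ y, ∫ z, f z ∂(iterK P s n y) ∂(P s x)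
    simp_rw [ih]

lemma h8_Q_diff {S X : Type*} [MeasurableSpace S] [MeasurableSpace X] (P : S → X → Measure X)
    (hPprob : ∀ s x, IsProbabilityMeasure (P s x))
    (hPmeas : ∀ A : Set X, MeasurableSet A → Measurable fun p : S × X => P p.1 p.2 A)
    (f : X → ℝ) (hf : Measurable f) (B : ℝ) (hB0 : 0 ≤ B) (hB : ∀ x, |f x| ≤ B)
    (s t : S) (δ : ℝ) (hδ : ∀ x, tvDist (P s x) (P t x) ≤ δ) (n : ℕ) (x : X) :
    |h8Q P f n (s, x) - h8Q P f n (t, x)| ≤ n * (2 * B * δ) := by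
  induction n generalizing x with
  | zero => simp [h8Q]
  | succ n ih =>
    have hm : ∀ u, Measurable fun y => h8Q P f n (u, y) := fun u =>
      (h8_Q_meas P hPprob hPmeas f hf n).comp measurable_prodMk_left
    have hb : ∀ u y, |h8Q P f n (u, y)| ≤ B := fun u y => h8_Q_bound P hPprob f B hB n _
    have hi : ∀ u v, Integrable (fun y => h8Q P f n (u, y)) (P v x) := fun u v =>
      h8_integrable _ _ (hm u) B (hb u)
    change |∫ y, h8Q P f n (s, y) ∂(P s x) - ∫ y, h8Q P f n (t, y) ∂(P t x)| ≤ _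
    have h1 : |∫ y, h8Q P f n (s, y) ∂(P s x) - ∫ y, h8Q P f n (s, y) ∂(P t x)| ≤ 2 * B * δ :=
      (h8_tv_integral (P s x) (P t x) _ (hm s) B (hb s)).trans
        (mul_le_mul_of_nonneg_left (hδ x) (by positivity))
    have h2 : |∫ y, h8Q P f n (s, y) ∂(P t x) - ∫ y, h8Q P f n (t, y) ∂(P t x)|
        ≤ n * (2 * B * δ) := by
      rw [← integral_sub (hi s t) (hi t t)]
      exact h8_abs_integral_le _ _ _ ih
    refine (abs_sub_le _ (∫ y, h8Q P f n (s, y) ∂(P t x)) _).trans ?_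
    push_cast; linarith

lemma h8_mart {S X : Type*} [MeasurableSpace S] [MeasurableSpace X]
    (P : S → X → Measure X)
    (hPprob : ∀ s x, IsProbabilityMeasure (P s x))
    (hPmeas : ∀ A : Set X, MeasurableSet A → Measurable fun p : S × X => P p.1 p.2 A)
    {Ω : Type*} [mΩ : MeasurableSpace Ω] (μ : Measure Ω) [IsProbabilityMeasure μ]
    (F : Filtration ℕ mΩ) (Sp : ℕ → Ω → S) (Xp : ℕ → Ω → X)
    (hadapted : ∀ k, Measurable[F k] fun ω => (Sp k ω, Xp k ω))
    (hmarkov : ∀ (k : ℕ) (A : Set X), MeasurableSet A →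
      μ[fun ω => A.indicator (fun _ => (1 : ℝ)) (Xp (k + 1) ω) | F k]
        =ᵐ[μ] fun ω => (P (Sp k ω) (Xp k ω) A).toReal)
    (f : X → ℝ) (hf : Measurable f) (B : ℝ) (hB : ∀ x, |f x| ≤ B) (j : ℕ) :
    ∀ᵐ ω ∂μ, Tendsto (fun n : ℕ => (∑ k ∈ range n,
      (h8Q P f j (Sp k ω, Xp (k + 1) ω) - h8Q P f (j + 1) (Sp k ω, Xp k ω))) / n)
      atTop (𝓝 0) := by
  have hQm := fun j => h8_Q_meas P hPprob hPmeas f hf j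
  have hQb := fun j p => h8_Q_bound P hPprob f B hB j p
  have had : ∀ k i, i ≤ k → Measurable[F k] fun ω => (Sp i ω, Xp i ω) :=
    fun k i hi => (hadapted i).mono (F.mono hi) le_rfl
  have hSF : ∀ k i, i ≤ k → Measurable[F k] (Sp i) := fun k i hi => measurable_fst.comp (had k i hi)
  have hXF : ∀ k i, i ≤ k → Measurable[F k] (Xp i) := fun k i hi => measurable_snd.comp (had k i hi)
  set d : ℕ → Ω → ℝ := fun k ω =>
    h8Q P f j (Sp k ω, Xp (k + 1) ω) - h8Q P f (j + 1) (Sp k ω, Xp k ω) with hd_def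
  have hdF : ∀ k i, i < k → Measurable[F k] (d i) := by
    intro k i hi
    have a1 : Measurable[F k] fun ω => h8Q P f j (Sp i ω, Xp (i + 1) ω) :=
      (hQm j).comp ((hSF k i hi.le).prodMk (hXF k (i + 1) hi))
    have a2 : Measurable[F k] fun ω => h8Q P f (j + 1) (Sp i ω, Xp i ω) :=
      (hQm (j + 1)).comp (had k i hi.le)
    exact a1.sub a2
  have hd : ∀ i, Measurable (d i) := fun i =>
    (hdF (i + 1) i (Nat.lt_succ_self i)).mono (F.le _) le_rfl
  have hdb : ∀ k ω, |d k ω| ≤ 2 * B := by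
    intro k ω
    refine (abs_sub _ _).trans ?_
    have := hQb j (Sp k ω, Xp (k + 1) ω)
    have := hQb (j + 1) (Sp k ω, Xp k ω)
    linarith
  refine h8_slln μ d hd (2 * B) hdb fun n => ?_
  let W : Ω → ℝ × (S × X) := fun ω => (∑ i ∈ range n, d i ω, (Sp n ω, Xp n ω))
  have hWF : Measurable[F n] W := by
    have a1 : Measurable[F n] fun ω => ∑ i ∈ range n, d i ω :=
      Finset.measurable_fun_sum _ fun i hi => hdF n i (Finset.mem_range.1 hi)
    exact a1.prodMk (hadapted n)
  let κ : Kernel (ℝ × (S × X)) X := ⟨fun p => P p.2.1 p.2.2,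
    (Measure.measurable_of_measurable_coe (fun p : S × X => P p.1 p.2) hPmeas).comp measurable_snd⟩
  have : IsMarkovKernel κ := ⟨fun p => hPprob p.2.1 p.2.2⟩
  have hSb : ∀ ω, |∑ i ∈ range n, d i ω| ≤ n * (2 * B) := by
    intro ω
    refine (Finset.abs_sum_le_sum_abs _ _).trans ?_
    refine (Finset.sum_le_sum fun i _ => hdb i ω).trans ?_
    simp
  have hSm : Measurable fun ω => ∑ i ∈ range n, d i ω :=
    Finset.measurable_fun_sum _ fun i _ => hd i
  have key := h8_law_integral (F n) μ (F.le n) W hWF (Xp (n + 1))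
    ((hXF (n + 1) (n + 1) le_rfl).mono (F.le _) le_rfl) κ (hmarkov n)
    (fun q => q.1.1 * (h8Q P f j (q.1.2.1, q.2) - h8Q P f (j + 1) q.1.2))
    (measurable_fst.fst.mul (((hQm j).comp (measurable_fst.snd.fst.prodMk measurable_snd)).sub
      ((hQm (j + 1)).comp measurable_fst.snd)))
    (h8_integrable μ _ (hSm.mul (hd n)) (n * (2 * B) * (2 * B)) fun ω => by
      rw [abs_mul]
      exact mul_le_mul (hSb ω) (hdb n ω) (abs_nonneg _) ((abs_nonneg _).trans (hSb ω)))
  refine key.trans ?_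
  have : ∀ ω, ∫ y, (W ω).1 * (h8Q P f j ((W ω).2.1, y) - h8Q P f (j + 1) (W ω).2) ∂(κ (W ω)) = 0 := by
    intro ω
    have hi : Integrable (fun y => h8Q P f j ((W ω).2.1, y)) (κ (W ω)) :=
      h8_integrable _ _ ((hQm j).comp measurable_prodMk_left) B fun y => hQb j _
    rw [integral_const_mul, integral_sub hi (integrable_const _)]
    have e : ∫ y, h8Q P f j ((W ω).2.1, y) ∂(κ (W ω)) = h8Q P f (j + 1) (W ω).2 := rfl
    rw [e]
    simp
  simp [this]

lemma h8_det (u : ℕ → ℕ → ℝ) (b : ℕ → ℝ) (hb : Tendsto b atTop (𝓝 0))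
    (hu : ∀ j, Tendsto (fun n => u j n - u (j + 1) n) atTop (𝓝 0))
    (hub : ∀ j, ∀ᶠ n in atTop, |u j n| ≤ b j) : Tendsto (u 0) atTop (𝓝 0) := by
  have h : ∀ j, Tendsto (fun n => u 0 n - u j n) atTop (𝓝 0) := by
    intro j
    induction j with
    | zero => simp
    | succ j ih => 
      have := ih.add (hu j)
      simpa using this
  rw [Metric.tendsto_nhds]
  intro ε hε
  obtain ⟨j, hj⟩ := (hb.eventually_lt_const (half_pos hε)).exists
  have h1 := (Metric.tendsto_nhds.1 (h j)) (ε / 2) (half_pos hε)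
  filter_upwards [h1, hub j] with n h1 h2
  rw [Real.dist_eq, sub_zero] at h1 ⊢
  have : u 0 n = (u 0 n - u j n) + u j n := by ring
  rw [this]
  refine (abs_add_le _ _).trans_lt ?_
  linarith

end helpers

/-- Under (A1), (A2) and strongly 1-waning adaptation (A5),
the strong law of large numbers holds: `(1/n) Σ_{k=1}^n φ(X_k) → π(φ)`
almost surely. -/
theorem stmt8 {S X : Type*} [MeasurableSpace S] [MeasurableSpace X]
    (P : S → X → Measure X) (π : Measure X) [IsProbabilityMeasure π]
    (hPprob : ∀ s x, IsProbabilityMeasure (P s x))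
    (hPmeas : ∀ A : Set X, MeasurableSet A → Measurable fun p : S × X => P p.1 p.2 A)
    (hinv : ∀ s, π.bind (P s) = π)
    (C ρ : ℝ) (hρ : ρ ∈ Set.Ico (0 : ℝ) 1)
    (hA2 : ∀ s x k, tvDist (iterK P s k x) π ≤ C * ρ ^ k)
    {Ω : Type*} [mΩ : MeasurableSpace Ω] (μ : Measure Ω) [IsProbabilityMeasure μ]
    (F : Filtration ℕ mΩ) (Sp : ℕ → Ω → S) (Xp : ℕ → Ω → X)
    (hadapted : ∀ k, Measurable[F k] fun ω => (Sp k ω, Xp k ω))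
    (hmarkov : ∀ (k : ℕ) (A : Set X), MeasurableSet A →
      μ[fun ω => A.indicator (fun _ => (1 : ℝ)) (Xp (k + 1) ω) | F k]
        =ᵐ[μ] fun ω => (P (Sp k ω) (Xp k ω) A).toReal)
    (φ : X → ℝ) (hφm : Measurable φ) (hφb : ∃ B, ∀ x, |φ x| ≤ B)
    (D : ℕ → Ω → ℝ) (hD01 : ∀ k ω, D k ω ∈ Set.Icc (0 : ℝ) 1)
    (hDbound : ∀ k, 1 ≤ k → ∀ ω x,
      tvDist (P (Sp k ω) x) (P (Sp (k - 1) ω) x) ≤ D k ω)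
    (hwaning : ∀ᵐ ω ∂μ, Tendsto (fun n : ℕ => (∑ k ∈ Finset.Icc 1 n, D k ω) / n)
      atTop (𝓝 0)) :
    ∀ᵐ ω ∂μ, Tendsto (fun n : ℕ => (∑ k ∈ Finset.Icc 1 n, φ (Xp k ω)) / n)
      atTop (𝓝 (∫ x, φ x ∂π)) := by
  obtain ⟨B, hB⟩ := hφb
  have hneX : Nonempty X := nonempty_of_isProbabilityMeasure π
  have hB0 : 0 ≤ B := (abs_nonneg _).trans (hB hneX.some)
  have hP : ∀ s, Measurable (P s) := fun s =>
    (Measure.measurable_of_measurable_coe (fun p : S × X => P p.1 p.2) hPmeas).comp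
      measurable_prodMk_left
  set c : ℝ := ∫ x, φ x ∂π with hc
  have hcB : |c| ≤ B := h8_abs_integral_le π φ B hB
  let f : X → ℝ := fun x => φ x - c
  have hf : Measurable f := hφm.sub_const c
  have hfB : ∀ x, |f x| ≤ 2 * B := fun x => by
    refine (abs_sub _ _).trans ?_
    have := hB x
    linarith
  have hfint : ∫ x, f x ∂π = 0 := by
    change ∫ x, (φ x - c) ∂π = 0
    rw [integral_sub (h8_integrable π φ hφm B hB) (integrable_const c)]
    simp [hc]
  have hQdecay : ∀ j p, |h8Q P f j p| ≤ 2 * (2 * B) * (C * ρ ^ j) := by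
    rintro j ⟨s, x⟩
    have := (h8_iterK P hPprob hP s j).2 x
    rw [h8_Q_iterK P hPprob hP f hf (2 * B) hfB]
    have h1 := h8_tv_integral (iterK P s j x) π f hf (2 * B) hfB
    rw [hfint, sub_zero] at h1
    exact h1.trans (mul_le_mul_of_nonneg_left (hA2 s x j) (by positivity))
  have hmart := ae_all_iff.2 fun j => h8_mart P hPprob hPmeas μ F Sp Xp hadapted hmarkov f hf
    (2 * B) hfB j
  filter_upwards [hmart, hwaning] with ω hM hD
  have hIcc : ∀ (v : ℕ → ℝ) (n : ℕ), ∑ k ∈ Finset.Icc 1 n, v k = ∑ k ∈ range n, v (k + 1) := by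
    intro v n
    induction n with
    | zero => simp
    | succ n ih => rw [Finset.sum_Icc_succ_top (by omega), ih, Finset.sum_range_succ]
  simp_rw [hIcc (fun k => D k ω)] at hD
  rw [show (fun n : ℕ => (∑ k ∈ Finset.Icc 1 n, φ (Xp k ω)) / (n : ℝ))
    = fun n : ℕ => (∑ k ∈ range n, φ (Xp (k + 1) ω)) / (n : ℝ) from
      funext fun n => by rw [hIcc (fun k => φ (Xp k ω))]]
  let q : ℕ → ℕ → ℝ := fun j k => h8Q P f j (Sp k ω, Xp k ω)
  have hqb : ∀ j k, |q j k| ≤ 2 * B := fun j k => h8_Q_bound P hPprob f (2 * B) hfB j _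
  have hmain := h8_det (fun j n => (∑ k ∈ range n, q j (k + 1)) / (n : ℝ))
    (fun j => 2 * (2 * B) * (C * ρ ^ j)) ?_ ?_ ?_
  · have := hmain.add_const c
    rw [zero_add] at this
    refine this.congr' ?_
    filter_upwards [eventually_gt_atTop 0] with n hn
    have hn' : (0 : ℝ) < n := by exact_mod_cast hn
    simp only [q, h8Q, f, Finset.sum_sub_distrib, sum_const, card_range, nsmul_eq_mul]
    field_simp
    ring
  · have := ((tendsto_pow_atTop_nhds_zero_of_lt_one hρ.1 hρ.2).const_mul C).const_mul (2 * (2 * B))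
    simpa using this
  · intro j
    -- waning part
    have hw : Tendsto (fun n : ℕ => (∑ k ∈ range n,
        (q j (k + 1) - h8Q P f j (Sp k ω, Xp (k + 1) ω))) / (n : ℝ)) atTop (𝓝 0) := by
      have h1 := hD.const_mul (j * (2 * (2 * B)))
      rw [mul_zero] at h1
      refine squeeze_zero_norm (fun n => ?_) h1
      rw [Real.norm_eq_abs, abs_div, Nat.abs_cast, ← mul_div_assoc]
      refine div_le_div_of_nonneg_right ?_ (Nat.cast_nonneg n)
      refine (Finset.abs_sum_le_sum_abs _ _).trans ?_
      rw [Finset.mul_sum]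
      refine Finset.sum_le_sum fun k _ => ?_
      have := h8_Q_diff P hPprob hPmeas f hf (2 * B) (by positivity) hfB (Sp (k + 1) ω) (Sp k ω)
        (D (k + 1) ω) (fun x => hDbound (k + 1) (by omega) ω x) j (Xp (k + 1) ω)
      refine this.trans (le_of_eq (by ring))
    -- telescoping part
    have ht : Tendsto (fun n : ℕ => (q (j + 1) 0 - q (j + 1) n) / (n : ℝ)) atTop (𝓝 0) := by
      refine squeeze_zero_norm (fun n => ?_)
        (tendsto_const_div_atTop_nhds_zero_nat (2 * B + 2 * B))
      rw [Real.norm_eq_abs, abs_div, Nat.abs_cast]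
      refine div_le_div_of_nonneg_right ?_ (Nat.cast_nonneg n)
      exact (abs_sub _ _).trans (add_le_add (hqb _ _) (hqb _ _))
    have hs := (hw.add (hM j)).add ht
    rw [add_zero, add_zero] at hs
    refine hs.congr fun n => ?_
    rw [← add_div, ← add_div, ← sub_div]
    congr 1
    have tel := Finset.sum_range_sub' (q (j + 1)) n
    rw [← tel, ← Finset.sum_add_distrib, ← Finset.sum_add_distrib, ← Finset.sum_sub_distrib]
    refine Finset.sum_congr rfl fun k _ => ?_
    simp only [q]
    ring
  · intro j
    filter_upwards [eventually_gt_atTop 0] with n hn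
    have hn' : (0 : ℝ) < n := by exact_mod_cast hn
    rw [abs_div, Nat.abs_cast, div_le_iff₀ hn']
    refine (Finset.abs_sum_le_sum_abs _ _).trans ?_
    refine (Finset.sum_le_sum fun k _ => hQdecay j _).trans (le_of_eq ?_)
    simp only [sum_const, card_range, nsmul_eq_mul]
    ring
end

section
/- Assume (A1) and (A2), let φ: X → ℝ be bounded measurable, suppose the adaptation is weakly 1/2-waning, and assume (A4) holds with constant σ_φ² ∈ [0,∞). Then the central limit theorem holds: n^{−1/2} Σ_{k=1}^n (φ(X_k) − π(φ)) converges in distribution to N(0, σ_φ²) as n → ∞. -/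
open MeasureTheory Filter Finset ProbabilityTheory
open scoped ENNReal NNReal Topology

/-- Bounded convergence in probability, in the form needed below. -/
lemma aux_bdd_conv {Ω : Type*} [MeasurableSpace Ω] (μ : Measure Ω) [IsProbabilityMeasure μ]
    (f : ℕ → Ω → ℂ) (hf : ∀ n, Measurable (f n)) (B : ℝ) (hB : ∀ n ω, ‖f n ω‖ ≤ B)
    (a : ℕ → ℝ) (ha : Tendsto a atTop (𝓝 0)) (c : ℝ) (Y : ℕ → Ω → ℝ)
    (hY : TendstoInMeasure μ Y atTop (fun _ => 0))
    (hfY : ∀ n ω, ‖f n ω‖ ≤ a n + c * |Y n ω|) :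
    Tendsto (fun n => ∫ ω, f n ω ∂μ) atTop (𝓝 0) := by
  have hB0 : 0 ≤ B := by
    obtain ⟨ω⟩ : Nonempty Ω := by
      by_contra h
      rw [not_nonempty_iff] at h
      have := measure_univ (μ := μ)
      simp [Measure.eq_zero_of_isEmpty μ] at this
    exact (norm_nonneg _).trans (hB 0 ω)
  rw [tendstoInMeasure_iff_measureReal_norm] at hY
  rw [Metric.tendsto_atTop]
  intro ε hε
  set δ := ε / (4 * (|c| + 1)) with hδ
  have hc : 0 < |c| + 1 := by positivity
  have hδ0 : 0 < δ := by positivity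
  have h1 := hY δ hδ0
  have h2 : ∀ᶠ n in atTop, μ.real {x | δ ≤ ‖Y n x - 0‖} < ε / (4 * (B + 1)) :=
    h1.eventually (gt_mem_nhds (by positivity))
  have h3 : ∀ᶠ n in atTop, a n < ε / 4 := ha.eventually (gt_mem_nhds (by positivity))
  obtain ⟨N, hN⟩ := eventually_atTop.1 (h2.and h3)
  refine ⟨N, fun n hn => ?_⟩
  obtain ⟨h4, h5⟩ := hN n hn
  set T := {x | ε / 2 ≤ ‖f n x‖} with hT
  have hTm : MeasurableSet T := measurableSet_le measurable_const (hf n).norm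
  have hsub : T ⊆ {x | δ ≤ ‖Y n x - 0‖} := by
    intro x hx
    simp only [hT, Set.mem_ofPred_eq] at hx
    simp only [Set.mem_ofPred_eq, sub_zero, Real.norm_eq_abs]
    by_contra hlt
    push Not at hlt
    have h6 := hfY n x
    have h7 : c * |Y n x| ≤ (|c| + 1) * δ := by
      calc c * |Y n x| ≤ |c| * |Y n x| := by gcongr; exact le_abs_self c
        _ ≤ (|c| + 1) * δ := by gcongr; linarith
    have h8 : (|c| + 1) * δ = ε / 4 := by rw [hδ]; field_simp
    linarith
  have hTμ : μ.real T ≤ ε / (4 * (B + 1)) := (measureReal_mono hsub).trans h4.le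
  rw [dist_zero_right]
  have hle : ∀ ω, ‖f n ω‖ ≤ ε / 2 + T.indicator (fun _ => B) ω := by
    intro ω
    by_cases h : ω ∈ T
    · rw [Set.indicator_of_mem h]; linarith [hB n ω]
    · rw [Set.indicator_of_notMem h]
      simp only [hT, Set.mem_ofPred_eq, not_le] at h
      linarith
  have hindi : Integrable (T.indicator (fun _ => B)) μ :=
    (integrable_const B).indicator hTm
  calc ‖∫ ω, f n ω ∂μ‖ ≤ ∫ ω, (ε / 2 + T.indicator (fun _ => B) ω) ∂μ :=
        norm_integral_le_of_norm_le ((integrable_const _).add hindi) (ae_of_all _ hle)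
    _ = ε / 2 + μ.real T * B := by
        rw [integral_add (integrable_const _) hindi, integral_indicator hTm]
        simp
    _ ≤ ε / 2 + ε / (4 * (B + 1)) * B := by gcongr
    _ < ε := by
        have : ε / (4 * (B + 1)) * B ≤ ε / 4 := by
          rw [div_mul_eq_mul_div, div_le_div_iff₀ (by positivity) (by positivity)]
          nlinarith
        linarith

lemma aux_step_s9 {Ω : Type*} [MeasurableSpace Ω] (μ : Measure Ω) [IsProbabilityMeasure μ]
    (Y : Ω → ℂ) (hYm : Measurable Y) (B : ℝ) (hYB : ∀ ω, ‖Y ω‖ ≤ B)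
    (ξ W : Ω → ℝ) (hξm : Measurable ξ) (hWm : Measurable W)
    (K : ℝ) (hξ : ∀ ω, |ξ ω| ≤ K) (hW : ∀ ω, |W ω| ≤ K ^ 2)
    (h1 : ∫ ω, Y ω * (ξ ω : ℂ) ∂μ = 0)
    (h2 : ∫ ω, Y ω * ((ξ ω ^ 2 : ℝ) : ℂ) ∂μ = ∫ ω, Y ω * (W ω : ℂ) ∂μ) (τ : ℝ) :
    ‖∫ ω, Y ω * (Complex.exp (Complex.I * τ * ξ ω) - Complex.exp (-(τ ^ 2 * W ω / 2))) ∂μ‖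
      ≤ B * ((|τ| * K) ^ 3 * Real.exp (|τ| * K)
        + (τ ^ 2 * K ^ 2 / 2) ^ 2 * Real.exp (τ ^ 2 * K ^ 2 / 2)) := by
  have hbd : ∀ (g : Ω → ℂ), Measurable g → (∃ b, ∀ ω, ‖g ω‖ ≤ b) → Integrable g μ := by
    rintro g hg ⟨b, hb⟩
    exact Integrable.of_bound hg.aestronglyMeasurable b (ae_of_all _ hb)
  have hB0 : 0 ≤ B ∧ 0 ≤ K := by
    obtain ⟨ω⟩ : Nonempty Ω := by
      by_contra h
      rw [not_nonempty_iff] at h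
      have := measure_univ (μ := μ)
      simp [Measure.eq_zero_of_isEmpty μ] at this
    exact ⟨(norm_nonneg _).trans (hYB ω), (abs_nonneg _).trans (hξ ω)⟩
  obtain ⟨hB, hK⟩ := hB0
  have hξc : Measurable fun ω => (ξ ω : ℂ) := Complex.measurable_ofReal.comp hξm
  have hWc : Measurable fun ω => (W ω : ℂ) := Complex.measurable_ofReal.comp hWm
  have i1 : Integrable (fun ω => Y ω * (ξ ω : ℂ)) μ := by
    refine hbd _ (hYm.mul hξc) ⟨B * K, fun ω => ?_⟩
    rw [norm_mul]
    refine mul_le_mul (hYB ω) ?_ (norm_nonneg _) hB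
    simpa using hξ ω
  have i2 : Integrable (fun ω => Y ω * ((ξ ω ^ 2 : ℝ) : ℂ)) μ := by
    refine hbd _ (hYm.mul (Complex.measurable_ofReal.comp (hξm.pow_const 2))) 
      ⟨B * K ^ 2, fun ω => ?_⟩
    rw [norm_mul]
    refine mul_le_mul (hYB ω) ?_ (norm_nonneg _) hB
    rw [Complex.norm_real, Real.norm_eq_abs, abs_pow]
    gcongr
    exact hξ ω
  have i3 : Integrable (fun ω => Y ω * (W ω : ℂ)) μ := by
    refine hbd _ (hYm.mul hWc) ⟨B * K ^ 2, fun ω => ?_⟩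
    rw [norm_mul]
    refine mul_le_mul (hYB ω) ?_ (norm_nonneg _) hB
    simpa using hW ω
  set e1 : Ω → ℂ := fun ω => Complex.exp (Complex.I * τ * ξ ω)
    - (1 + Complex.I * τ * ξ ω - τ ^ 2 * ξ ω ^ 2 / 2) with he1
  set e2 : Ω → ℂ := fun ω => Complex.exp (-(τ ^ 2 * W ω / 2)) - (1 - τ ^ 2 * W ω / 2) with he2
  have he1m : Measurable e1 := by
    simp only [he1]; fun_prop
  have he2m : Measurable e2 := by
    simp only [he2]; fun_prop
  have he1b : ∀ ω, ‖e1 ω‖ ≤ (|τ| * K) ^ 3 * Real.exp (|τ| * K) := by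
    intro ω
    have h := Complex.norm_exp_sub_sum_le_norm_mul_exp (Complex.I * τ * ξ ω) 3
    have hn : ‖Complex.I * τ * ξ ω‖ ≤ |τ| * K := by
      simp only [norm_mul, Complex.norm_I, one_mul, Complex.norm_real, Real.norm_eq_abs]
      gcongr; exact hξ ω
    have heq : e1 ω = Complex.exp (Complex.I * τ * ξ ω)
        - ∑ m ∈ range 3, (Complex.I * τ * ξ ω) ^ m / (m.factorial : ℂ) := by
      simp only [he1, Finset.sum_range_succ, Finset.sum_range_zero, Nat.factorial]
      push_cast
      ring_nf
      rw [Complex.I_sq]; ring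
    rw [heq]
    refine h.trans ?_
    gcongr
  have he2b : ∀ ω, ‖e2 ω‖ ≤ (τ ^ 2 * K ^ 2 / 2) ^ 2 * Real.exp (τ ^ 2 * K ^ 2 / 2) := by
    intro ω
    have h := Complex.norm_exp_sub_sum_le_norm_mul_exp (-(τ ^ 2 * W ω / 2) : ℂ) 2
    have hn : ‖(-(τ ^ 2 * W ω / 2) : ℂ)‖ ≤ τ ^ 2 * K ^ 2 / 2 := by
      simp only [norm_neg, norm_div, norm_mul, norm_pow, Complex.norm_real, Real.norm_eq_abs,
        sq_abs, Complex.norm_ofNat]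
      gcongr; exact hW ω
    have heq : e2 ω = Complex.exp (-(τ ^ 2 * W ω / 2))
        - ∑ m ∈ range 2, (-(τ ^ 2 * W ω / 2) : ℂ) ^ m / (m.factorial : ℂ) := by
      simp only [he2, Finset.sum_range_succ, Finset.sum_range_zero, Nat.factorial]
      push_cast
      ring
    rw [heq]
    refine h.trans ?_
    gcongr
  have hjb : ∀ ω, ‖Y ω * (e1 ω - e2 ω)‖ ≤ B * ((|τ| * K) ^ 3 * Real.exp (|τ| * K)
        + (τ ^ 2 * K ^ 2 / 2) ^ 2 * Real.exp (τ ^ 2 * K ^ 2 / 2)) := by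
    intro ω
    rw [norm_mul]
    exact mul_le_mul (hYB ω) ((norm_sub_le _ _).trans (add_le_add (he1b ω) (he2b ω)))
      (norm_nonneg _) hB
  have j1 : Integrable (fun ω => Y ω * (e1 ω - e2 ω)) μ :=
    hbd _ (hYm.mul (he1m.sub he2m)) ⟨_, hjb⟩
  have key : ∫ ω, Y ω * (Complex.exp (Complex.I * τ * ξ ω)
      - Complex.exp (-(τ ^ 2 * W ω / 2))) ∂μ = ∫ ω, Y ω * (e1 ω - e2 ω) ∂μ := by
    have hpt : ∀ ω, Y ω * (Complex.exp (Complex.I * τ * ξ ω)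
      - Complex.exp (-(τ ^ 2 * W ω / 2))) = Y ω * (e1 ω - e2 ω)
        + (Complex.I * τ) * (Y ω * (ξ ω : ℂ))
        - (τ ^ 2 / 2 : ℂ) * (Y ω * ((ξ ω ^ 2 : ℝ) : ℂ) - Y ω * (W ω : ℂ)) := by
      intro ω
      simp only [he1, he2]
      push_cast
      ring
    simp_rw [hpt]
    have q1 : Integrable (fun ω => Y ω * (e1 ω - e2 ω)
        + (Complex.I * τ) * (Y ω * (ξ ω : ℂ))) μ := j1.add (i1.const_mul _)
    have q2 : Integrable (fun ω => (τ ^ 2 / 2 : ℂ) *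
        (Y ω * ((ξ ω ^ 2 : ℝ) : ℂ) - Y ω * (W ω : ℂ))) μ := (i2.sub i3).const_mul _
    rw [integral_sub q1 q2, integral_add j1 (i1.const_mul _), integral_const_mul,
      integral_const_mul, integral_sub i2 i3, h1, h2]
    simp
  rw [key]
  refine (norm_integral_le_of_norm_le (integrable_const _) (ae_of_all _ hjb)).trans_eq ?_
  rw [integral_const]; simp

/-- Characteristic function estimate for bounded martingale differences, compensated by the
conditional variances. -/
lemma aux_comp {Ω : Type*} [mΩ : MeasurableSpace Ω] (μ : Measure Ω) [IsProbabilityMeasure μ]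
    (F : Filtration ℕ mΩ) (ξ W : ℕ → Ω → ℝ)
    (hξm : ∀ k, Measurable[F (k + 1)] (ξ k)) (hWm : ∀ k, Measurable[F k] (W k))
    (K : ℝ) (hξ : ∀ k ω, |ξ k ω| ≤ K) (hW : ∀ k ω, |W k ω| ≤ K ^ 2)
    (h1 : ∀ k (Y : Ω → ℂ) (B : ℝ), Measurable[F k] Y → (∀ ω, ‖Y ω‖ ≤ B) →
      ∫ ω, Y ω * (ξ k ω : ℂ) ∂μ = 0)
    (h2 : ∀ k (Y : Ω → ℂ) (B : ℝ), Measurable[F k] Y → (∀ ω, ‖Y ω‖ ≤ B) →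
      ∫ ω, Y ω * ((ξ k ω ^ 2 : ℝ) : ℂ) ∂μ = ∫ ω, Y ω * (W k ω : ℂ) ∂μ) (τ : ℝ) (n : ℕ) :
    ‖∫ ω, Complex.exp (Complex.I * τ * (∑ j ∈ range n, ξ j ω : ℝ)
        + τ ^ 2 * (∑ j ∈ range n, W j ω : ℝ) / 2) ∂μ - 1‖
      ≤ n * (Real.exp (n * (τ ^ 2 * K ^ 2 / 2)) * ((|τ| * K) ^ 3 * Real.exp (|τ| * K)
        + (τ ^ 2 * K ^ 2 / 2) ^ 2 * Real.exp (τ ^ 2 * K ^ 2 / 2))) := by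
  set E := (|τ| * K) ^ 3 * Real.exp (|τ| * K)
        + (τ ^ 2 * K ^ 2 / 2) ^ 2 * Real.exp (τ ^ 2 * K ^ 2 / 2) with hE
  have hK : 0 ≤ K := by
    obtain ⟨ω⟩ : Nonempty Ω := by
      by_contra h
      rw [not_nonempty_iff] at h
      have := measure_univ (μ := μ)
      simp [Measure.eq_zero_of_isEmpty μ] at this
    exact (abs_nonneg _).trans (hξ 0 ω)
  have hE0 : 0 ≤ E := by positivity
  set Z : ℕ → Ω → ℂ := fun k ω => Complex.exp (Complex.I * τ * (∑ j ∈ range k, ξ j ω : ℝ)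
        + τ ^ 2 * (∑ j ∈ range k, W j ω : ℝ) / 2) with hZ
  set U : ℕ → Ω → ℂ := fun k ω => Complex.exp (Complex.I * τ * (∑ j ∈ range k, ξ j ω : ℝ)
        + τ ^ 2 * (∑ j ∈ range (k + 1), W j ω : ℝ) / 2) with hU
  have mξ : ∀ k l, k < l → Measurable[F l] (ξ k) := fun k l h => 
    (hξm k).mono (F.mono h) le_rfl
  have mW : ∀ k l, k ≤ l → Measurable[F l] (W k) := fun k l h => 
    (hWm k).mono (F.mono h) le_rfl
  have msum : ∀ k, Measurable[F k] fun ω => (∑ j ∈ range k, ξ j ω) := fun k =>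
    Finset.measurable_fun_sum _ fun j hj => mξ j k (Finset.mem_range.1 hj)
  have msumW : ∀ k, Measurable[F k] fun ω => (∑ j ∈ range (k + 1), W j ω) := fun k =>
    Finset.measurable_fun_sum _ fun j hj => mW j k (Nat.lt_succ_iff.1 (Finset.mem_range.1 hj))
  have msumW' : ∀ k, Measurable[F k] fun ω => (∑ j ∈ range k, W j ω) := fun k =>
    Finset.measurable_fun_sum _ fun j hj => mW j k (Finset.mem_range.1 hj).le
  have hUm : ∀ k, Measurable[F k] (U k) := by
    intro k
    refine Complex.measurable_exp.comp (Measurable.add ?_ ?_)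
    · exact (Complex.measurable_ofReal.comp (msum k)).const_mul _
    · exact ((Complex.measurable_ofReal.comp (msumW k)).const_mul _).div_const _
  have hZm : ∀ k, Measurable (Z k) := by
    intro k
    refine Measurable.mono (?_ : Measurable[F k] (Z k)) (F.le k) le_rfl
    refine Complex.measurable_exp.comp (Measurable.add ?_ ?_)
    · exact (Complex.measurable_ofReal.comp (msum k)).const_mul _
    · exact ((Complex.measurable_ofReal.comp (msumW' k)).const_mul _).div_const _
  have hnorm : ∀ a b : ℝ, ‖Complex.exp (Complex.I * τ * (a : ℝ) + τ ^ 2 * (b : ℝ) / 2)‖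
      = Real.exp (τ ^ 2 * b / 2) := by
    intro a b
    rw [Complex.norm_exp]
    congr 1
    have : (Complex.I * τ * (a : ℝ) + τ ^ 2 * (b : ℝ) / 2 : ℂ)
      = ((τ ^ 2 * b / 2 : ℝ) : ℂ) + ((τ * a : ℝ) : ℂ) * Complex.I := by push_cast; ring
    rw [this]
    simp only [Complex.add_re, Complex.ofReal_re, Complex.re_ofReal_mul, Complex.I_re]
    simp
  have hsumb : ∀ k ω, ∑ j ∈ range k, W j ω ≤ k * K ^ 2 := by
    intro k ω
    refine (Finset.sum_le_sum fun j _ => (le_abs_self _).trans (hW j ω)).trans ?_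
    simp
  have hgen : ∀ k ω, k ≤ n →
      Real.exp (τ ^ 2 * (∑ j ∈ range k, W j ω) / 2) ≤ Real.exp (n * (τ ^ 2 * K ^ 2 / 2)) := by
    intro k ω hk
    refine Real.exp_le_exp.2 ?_
    have h3 : (k : ℝ) ≤ n := by exact_mod_cast hk
    calc τ ^ 2 * (∑ j ∈ range k, W j ω) / 2 ≤ τ ^ 2 * (k * K ^ 2) / 2 := by
          gcongr; exact hsumb k ω
      _ ≤ τ ^ 2 * (n * K ^ 2) / 2 := by gcongr
      _ = _ := by ring
  have hZb : ∀ k ω, k ≤ n → ‖Z k ω‖ ≤ Real.exp (n * (τ ^ 2 * K ^ 2 / 2)) := by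
    intro k ω hk
    simp only [hZ]
    rw [hnorm]
    exact hgen k ω hk
  have hZi : ∀ k, k ≤ n → Integrable (Z k) μ := fun k hk =>
    Integrable.of_bound (hZm k).aestronglyMeasurable _ (ae_of_all _ fun ω => hZb k ω hk)
  have hUb : ∀ k ω, k < n → ‖U k ω‖ ≤ Real.exp (n * (τ ^ 2 * K ^ 2 / 2)) := by
    intro k ω hk
    simp only [hU]
    rw [hnorm]
    exact hgen (k + 1) ω hk
  have main : ∀ k, k ≤ n → ‖∫ ω, Z k ω ∂μ - 1‖
      ≤ k * (Real.exp (n * (τ ^ 2 * K ^ 2 / 2)) * E) := by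
    intro k
    induction k with
    | zero => intro _; simp [hZ]
    | succ k ih =>
      intro hk
      have ih' := ih (by omega)
      have hst : ‖∫ ω, Z (k + 1) ω ∂μ - ∫ ω, Z k ω ∂μ‖
          ≤ Real.exp (n * (τ ^ 2 * K ^ 2 / 2)) * E := by
        rw [← integral_sub (hZi _ hk) (hZi _ (by omega))]
        have hpt : ∀ ω, Z (k + 1) ω - Z k ω = U k ω * (Complex.exp (Complex.I * τ * ξ k ω)
            - Complex.exp (-(τ ^ 2 * W k ω / 2))) := by
          intro ω
          simp only [hZ, hU]
          rw [mul_sub, ← Complex.exp_add, ← Complex.exp_add]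
          congr 2
          · rw [Finset.sum_range_succ (fun j => ξ j ω)]; push_cast; ring
          · rw [Finset.sum_range_succ (fun j => W j ω)]; push_cast; ring
        simp_rw [hpt]
        exact aux_step_s9 μ (U k) ((hUm k).mono (F.le k) le_rfl) _ (fun ω => hUb k ω hk) (ξ k) (W k)
          ((hξm k).mono (F.le _) le_rfl) ((hWm k).mono (F.le _) le_rfl) K (hξ k) (hW k)
          (h1 k _ _ (hUm k) (fun ω => hUb k ω hk)) (h2 k _ _ (hUm k) (fun ω => hUb k ω hk)) τ
      have : ∫ ω, Z (k + 1) ω ∂μ - 1 = (∫ ω, Z (k + 1) ω ∂μ - ∫ ω, Z k ω ∂μ)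
        + (∫ ω, Z k ω ∂μ - 1) := by ring
      rw [this]
      refine (norm_add_le _ _).trans ?_
      push_cast
      linarith
  exact main n le_rfl

/-- Martingale central limit theorem with negligible remainder, at the level of
characteristic functions. -/
lemma aux_mclt {Ω : Type*} [mΩ : MeasurableSpace Ω] (μ : Measure Ω) [IsProbabilityMeasure μ]
    (F : Filtration ℕ mΩ) (ξ W : ℕ → Ω → ℝ)
    (hξm : ∀ k, Measurable[F (k + 1)] (ξ k)) (hWm : ∀ k, Measurable[F k] (W k))
    (K : ℝ) (hξ : ∀ k ω, |ξ k ω| ≤ K) (hW : ∀ k ω, |W k ω| ≤ K ^ 2)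
    (h1 : ∀ k (Y : Ω → ℂ) (B : ℝ), Measurable[F k] Y → (∀ ω, ‖Y ω‖ ≤ B) →
      ∫ ω, Y ω * (ξ k ω : ℂ) ∂μ = 0)
    (h2 : ∀ k (Y : Ω → ℂ) (B : ℝ), Measurable[F k] Y → (∀ ω, ‖Y ω‖ ≤ B) →
      ∫ ω, Y ω * ((ξ k ω ^ 2 : ℝ) : ℂ) ∂μ = ∫ ω, Y ω * (W k ω : ℂ) ∂μ)
    (v : ℝ≥0)
    (hV : TendstoInMeasure μ (fun n ω => (∑ k ∈ range n, W k ω) / n) atTop (fun _ => (v : ℝ)))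
    (T : ℕ → Ω → ℝ) (hTm : ∀ n, Measurable (T n))
    (a : ℕ → ℝ) (ha : Tendsto a atTop (𝓝 0)) (c : ℝ) (D : ℕ → Ω → ℝ)
    (hD : TendstoInMeasure μ D atTop (fun _ => 0))
    (hTR : ∀ n ω, |T n ω - (∑ k ∈ range n, ξ k ω) / Real.sqrt n| ≤ a n + c * |D n ω|)
    (t : ℝ) :
    Tendsto (fun n => ∫ ω, Complex.exp (Complex.I * t * T n ω) ∂μ) atTop
      (𝓝 (Complex.exp (-(t ^ 2 * v / 2)))) := by
  have hK : 0 ≤ K := by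
    obtain ⟨ω⟩ : Nonempty Ω := by
      by_contra h
      rw [not_nonempty_iff] at h
      have := measure_univ (μ := μ)
      simp [Measure.eq_zero_of_isEmpty μ] at this
    exact (abs_nonneg _).trans (hξ 0 ω)
  set M : ℕ → Ω → ℝ := fun n ω => (∑ k ∈ range n, ξ k ω) / Real.sqrt n with hM
  set V : ℕ → Ω → ℝ := fun n ω => (∑ k ∈ range n, W k ω) / n with hVdef
  have hMm : ∀ n, Measurable (M n) := fun n =>
    (Finset.measurable_fun_sum _ fun j _ => (hξm j).mono (F.le _) le_rfl).div_const _
  have hVm : ∀ n, Measurable (V n) := fun n =>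
    (Finset.measurable_fun_sum _ fun j _ => (hWm j).mono (F.le _) le_rfl).div_const _
  have hVb : ∀ n ω, |V n ω| ≤ K ^ 2 := by
    intro n ω
    simp only [hVdef]
    rw [abs_div, Nat.abs_cast]
    refine div_le_of_le_mul₀ (by positivity) (by positivity) ?_
    refine (Finset.abs_sum_le_sum_abs _ _).trans ?_
    refine (Finset.sum_le_sum fun j _ => hW j ω).trans ?_
    simp [mul_comm]
  have hexpI : ∀ x : ℝ, ‖Complex.exp (Complex.I * t * x)‖ = 1 := by
    intro x
    have : Complex.I * t * x = ((t * x : ℝ) : ℂ) * Complex.I := by push_cast; ring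
    rw [this, Complex.norm_exp_ofReal_mul_I]
  -- first term
  set f1 : ℕ → Ω → ℂ := fun n ω => Complex.exp (Complex.I * t * T n ω)
    - Complex.exp (Complex.I * t * M n ω) with hf1
  have f1m : ∀ n, Measurable (f1 n) := by
    intro n
    have := hTm n
    have := hMm n
    simp only [hf1]; fun_prop
  have t1 : Tendsto (fun n => ∫ ω, f1 n ω ∂μ) atTop (𝓝 0) := by
    refine aux_bdd_conv μ f1 f1m 2 ?_ (fun n => |t| * a n) (by simpa using ha.const_mul |t|)
      (|t| * c) D hD ?_
    · intro n ω
      refine (norm_sub_le _ _).trans ?_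
      rw [hexpI, hexpI]; norm_num
    · intro n ω
      have h3 : f1 n ω = Complex.exp (Complex.I * t * M n ω) *
          (Complex.exp (Complex.I * (t * (T n ω - M n ω) : ℝ)) - 1) := by
        simp only [hf1]
        rw [mul_sub, ← Complex.exp_add]
        congr 2
        · push_cast; ring
        · ring
      rw [h3, norm_mul, hexpI, one_mul]
      refine Real.norm_exp_I_mul_ofReal_sub_one_le.trans ?_
      rw [Real.norm_eq_abs, abs_mul]
      have := mul_le_mul_of_nonneg_left (hTR n ω) (abs_nonneg t)
      calc _ ≤ _ := this
        _ = _ := by ring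
  -- second term
  set f2 : ℕ → Ω → ℂ := fun n ω => Complex.exp (Complex.I * t * M n ω) *
    (1 - Complex.exp ((t ^ 2 * (V n ω - v) / 2 : ℝ) : ℂ)) with hf2
  have f2m : ∀ n, Measurable (f2 n) := by
    intro n
    have := hVm n
    have := hMm n
    simp only [hf2]; fun_prop
  have hyb : ∀ n ω, |t ^ 2 * (V n ω - v) / 2| ≤ t ^ 2 * (K ^ 2 + v) / 2 := by
    intro n ω
    rw [abs_div, abs_mul, abs_two, abs_of_nonneg (sq_nonneg t)]
    gcongr
    refine (abs_sub _ _).trans ?_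
    gcongr
    · exact hVb n ω
    · simp
  have hf2b : ∀ n ω, ‖f2 n ω‖ ≤ Real.exp (t ^ 2 * (K ^ 2 + v) / 2) *
      |t ^ 2 * (V n ω - v) / 2| := by
    intro n ω
    simp only [hf2]
    rw [norm_mul, hexpI, one_mul, norm_sub_rev]
    have h := Complex.norm_exp_sub_sum_le_norm_mul_exp ((t ^ 2 * (V n ω - v) / 2 : ℝ) : ℂ) 1
    simp only [Finset.sum_range_one, pow_zero, Nat.factorial, Nat.cast_one, div_one, pow_one,
      Complex.norm_real, Real.norm_eq_abs] at h
    refine h.trans ?_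
    rw [mul_comm]
    gcongr
    exact hyb n ω
  have hV0 : TendstoInMeasure μ (fun n ω => V n ω - v) atTop (fun _ => 0) := by
    rw [tendstoInMeasure_iff_norm] at hV ⊢
    simpa using hV
  have t2 : Tendsto (fun n => ∫ ω, f2 n ω ∂μ) atTop (𝓝 0) := by
    refine aux_bdd_conv μ f2 f2m (Real.exp (t ^ 2 * (K ^ 2 + v) / 2) * (t ^ 2 * (K ^ 2 + v) / 2))
      ?_ (fun n => 0) tendsto_const_nhds
      (Real.exp (t ^ 2 * (K ^ 2 + v) / 2) * (t ^ 2 / 2)) _ hV0 ?_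
    · intro n ω
      refine (hf2b n ω).trans ?_
      gcongr
      exact hyb n ω
    · intro n ω
      refine (hf2b n ω).trans_eq ?_
      rw [abs_div, abs_mul, abs_two, abs_of_nonneg (sq_nonneg t)]
      ring
  -- third term
  set f3 : ℕ → Ω → ℂ := fun n ω => Complex.exp (Complex.I * t * M n ω + t ^ 2 * V n ω / 2) with hf3
  have t3 : Tendsto (fun n => ∫ ω, f3 n ω ∂μ - 1) atTop (𝓝 0) := by
    set A := |t| * K with hA
    set Q := t ^ 2 * K ^ 2 / 2 with hQ
    have hA0 : 0 ≤ A := by positivity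
    have hQ0 : 0 ≤ Q := by positivity
    have hs : Tendsto (fun n : ℕ => (Real.sqrt n)⁻¹) atTop (𝓝 0) :=
      tendsto_inv_atTop_zero.comp (Real.tendsto_sqrt_atTop.comp tendsto_natCast_atTop_atTop)
    have hlim : Tendsto (fun n : ℕ => Real.exp Q * (A ^ 3 * Real.exp A * (Real.sqrt n)⁻¹
        + Q ^ 2 * Real.exp Q * ((Real.sqrt n)⁻¹ * (Real.sqrt n)⁻¹))) atTop (𝓝 0) := by
      have := ((hs.const_mul (A ^ 3 * Real.exp A)).add
        ((hs.mul hs).const_mul (Q ^ 2 * Real.exp Q))).const_mul (Real.exp Q)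
      simpa using this
    refine squeeze_zero_norm' ?_ hlim
    filter_upwards [eventually_ge_atTop 1] with n hn
    have hn' : (1 : ℝ) ≤ n := by exact_mod_cast hn
    have hsq : 1 ≤ Real.sqrt n := Real.one_le_sqrt.2 hn'
    have hsq0 : 0 < Real.sqrt n := by linarith
    have hss : Real.sqrt n * Real.sqrt n = n := Real.mul_self_sqrt (by linarith)
    have h := aux_comp μ F ξ W hξm hWm K hξ hW h1 h2 (t / Real.sqrt n) n
    have he : ∀ ω, Complex.exp (Complex.I * (t / Real.sqrt n : ℝ) * (∑ j ∈ range n, ξ j ω : ℝ)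
        + (t / Real.sqrt n : ℝ) ^ 2 * (∑ j ∈ range n, W j ω : ℝ) / 2) = f3 n ω := by
      intro ω
      simp only [hf3, hM, hVdef]
      congr 1
      have : ((t / Real.sqrt n : ℝ) : ℂ) ^ 2 = ((t ^ 2 / n : ℝ) : ℂ) := by
        rw [← Complex.ofReal_pow, div_pow, sq (Real.sqrt n), hss]
      rw [this]
      push_cast
      ring
    simp_rw [he] at h
    refine h.trans ?_
    have e1 : |t / Real.sqrt n| * K = A * (Real.sqrt n)⁻¹ := by
      rw [abs_div, abs_of_pos hsq0, hA]; ring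
    have e2 : (t / Real.sqrt n) ^ 2 * K ^ 2 / 2 = Q * ((Real.sqrt n)⁻¹ * (Real.sqrt n)⁻¹) := by
      rw [hQ]; ring
    have e3 : (n : ℝ) * (Q * ((Real.sqrt n)⁻¹ * (Real.sqrt n)⁻¹)) = Q := by
      rw [← mul_inv, hss]; field_simp
    rw [e1, e2, e3]
    set r := (Real.sqrt n)⁻¹ with hr
    have hr1 : r ≤ 1 := inv_le_one_of_one_le₀ hsq
    have hr0 : 0 ≤ r := by positivity
    have hnr : (n : ℝ) * (r * r) = 1 := by
      rw [hr, ← mul_inv, hss]; field_simp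
    have l1 : A * r ≤ A := mul_le_of_le_one_right hA0 hr1
    have l2 : Q * (r * r) ≤ Q := mul_le_of_le_one_right hQ0 (by nlinarith)
    calc (n : ℝ) * (Real.exp Q * ((A * r) ^ 3 * Real.exp (A * r)
          + (Q * (r * r)) ^ 2 * Real.exp (Q * (r * r))))
        ≤ n * (Real.exp Q * ((A * r) ^ 3 * Real.exp A + (Q * (r * r)) ^ 2 * Real.exp Q)) := by
          gcongr
      _ = Real.exp Q * (A ^ 3 * Real.exp A * r * (n * (r * r))
          + Q ^ 2 * Real.exp Q * (r * r) * (n * (r * r))) := by ring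
      _ = _ := by rw [hnr]; ring
  have hdec : ∀ n, ∫ ω, Complex.exp (Complex.I * t * T n ω) ∂μ
      = ∫ ω, f1 n ω ∂μ + ∫ ω, f2 n ω ∂μ
        + Complex.exp (-(t ^ 2 * v / 2)) * (∫ ω, f3 n ω ∂μ - 1)
        + Complex.exp (-(t ^ 2 * v / 2)) := by
    intro n
    have hbd : ∀ (g : Ω → ℂ), Measurable g → (∃ b, ∀ ω, ‖g ω‖ ≤ b) → Integrable g μ := by
      rintro g hg ⟨b, hb⟩
      exact Integrable.of_bound hg.aestronglyMeasurable b (ae_of_all _ hb)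
    have i1 : Integrable (f1 n) μ := hbd _ (f1m n) ⟨2, fun ω => by
      refine (norm_sub_le _ _).trans ?_
      rw [hexpI, hexpI]; norm_num⟩
    have i2 : Integrable (f2 n) μ := hbd _ (f2m n) ⟨Real.exp (t ^ 2 * (K ^ 2 + v) / 2) *
      (t ^ 2 * (K ^ 2 + v) / 2), fun ω => by
      refine (hf2b n ω).trans ?_
      gcongr
      exact hyb n ω⟩
    have f3m : Measurable (f3 n) := by
      have := hVm n
      have := hMm n
      simp only [hf3]; fun_prop
    have i3 : Integrable (f3 n) μ := hbd _ f3m ⟨Real.exp (t ^ 2 * K ^ 2 / 2), fun ω => by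
      simp only [hf3]
      rw [Complex.exp_add, norm_mul, hexpI, one_mul]
      have : (t ^ 2 * V n ω / 2 : ℂ) = ((t ^ 2 * V n ω / 2 : ℝ) : ℂ) := by push_cast; ring
      rw [this, Complex.norm_exp_ofReal]
      gcongr
      exact (le_abs_self _).trans (hVb n ω)⟩
    have hpt : ∀ ω, Complex.exp (Complex.I * t * T n ω) = f1 n ω + f2 n ω
        + Complex.exp (-(t ^ 2 * v / 2)) * f3 n ω := by
      intro ω
      simp only [hf1, hf2, hf3]
      rw [mul_sub, ← Complex.exp_add, ← Complex.exp_add]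
      have : (Complex.I * t * M n ω + ((t ^ 2 * (V n ω - v) / 2 : ℝ) : ℂ))
        = -(t ^ 2 * v / 2) + (Complex.I * t * M n ω + t ^ 2 * V n ω / 2) := by
        push_cast; ring
      rw [this]
      ring
    simp_rw [hpt]
    have i12 : Integrable (fun ω => f1 n ω + f2 n ω) μ := i1.add i2
    rw [integral_add i12 (i3.const_mul _), integral_add i1 i2, integral_const_mul]
    ring
  simp_rw [hdec]
  have := ((t1.add t2).add (t3.const_mul (Complex.exp (-(t ^ 2 * v / 2))))).add_const
    (Complex.exp (-(t ^ 2 * v / 2)))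
  simpa using this

lemma aux_tv_set {X : Type*} [MeasurableSpace X] (p q : Measure X) [IsProbabilityMeasure p]
    [IsProbabilityMeasure q] (d : ℝ) (h : tvDist p q ≤ d) (A : Set X) (hA : MeasurableSet A) :
    |p.real A - q.real A| ≤ d := by
  refine le_trans ?_ h
  have hb : BddAbove (Set.range fun A : {A : Set X // MeasurableSet A} =>
      |(p A.1).toReal - (q A.1).toReal|) := by
    refine ⟨1, ?_⟩
    rintro _ ⟨A, rfl⟩
    have h1 : p.real A.1 ≤ 1 := measureReal_le_one
    have h2 : q.real A.1 ≤ 1 := measureReal_le_one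
    have h3 : 0 ≤ p.real A.1 := measureReal_nonneg
    have h4 : 0 ≤ q.real A.1 := measureReal_nonneg
    change |p.real A.1 - q.real A.1| ≤ 1
    rw [abs_le]; constructor <;> linarith
  exact le_ciSup hb ⟨A, hA⟩

lemma aux_int {X : Type*} [MeasurableSpace X] (p : Measure X) [IsProbabilityMeasure p]
    (f : X → ℝ) (hf : Measurable f) (B : ℝ) (hB : ∀ x, |f x| ≤ B) : Integrable f p :=
  Integrable.of_bound hf.aestronglyMeasurable B (ae_of_all _ fun x => by simpa using hB x)

lemma aux_int_le {X : Type*} [MeasurableSpace X] (p : Measure X) [IsProbabilityMeasure p]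
    (f : X → ℝ) (B : ℝ) (hB : ∀ x, |f x| ≤ B) : |∫ x, f x ∂p| ≤ B := by
  have := norm_integral_le_of_norm_le_const (μ := p) (f := f) (C := B)
    (ae_of_all _ fun x => by simpa using hB x)
  simpa using this

lemma aux_tv_int {X : Type*} [MeasurableSpace X] (p q : Measure X) [IsProbabilityMeasure p]
    [IsProbabilityMeasure q] (d : ℝ) (h : tvDist p q ≤ d) (f : X → ℝ) (hf : Measurable f)
    (B : ℝ) (hB : ∀ x, |f x| ≤ B) :
    |∫ x, f x ∂p - ∫ x, f x ∂q| ≤ 2 * B * d := by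
  have hB0 : 0 ≤ B := by
    obtain ⟨x⟩ : Nonempty X := by
      by_contra h
      rw [not_nonempty_iff] at h
      have := measure_univ (μ := p)
      simp [Measure.eq_zero_of_isEmpty p] at this
    exact (abs_nonneg _).trans (hB x)
  have hd : 0 ≤ d := (abs_nonneg _).trans (aux_tv_set p q d h ∅ MeasurableSet.empty)
  have key : ∀ r : Measure X, IsProbabilityMeasure r →
      ∫ x, f x ∂r = (∫ t in Set.Ioc 0 (2 * B), r.real {a | t ≤ f a + B}) - B := by
    intro r hr
    have hi := aux_int r f hf B hB
    have hi' : Integrable (fun x => f x + B) r := hi.add (integrable_const B)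
    rw [← Integrable.integral_eq_integral_Ioc_meas_le (M := 2 * B) hi'
      (ae_of_all _ fun x => by have := (abs_le.1 (hB x)).1; simp; linarith)
      (ae_of_all _ fun x => by have := (abs_le.1 (hB x)).2; simp; linarith),
      integral_add hi (integrable_const B)]
    simp
  have hanti : ∀ r : Measure X, IsProbabilityMeasure r →
      IntegrableOn (fun t : ℝ => r.real {a | t ≤ f a + B}) (Set.Ioc 0 (2 * B)) := by
    intro r hr
    have ha : Antitone (fun t : ℝ => r.real {a | t ≤ f a + B}) := by
      intro s t hst
      exact measureReal_mono (fun a (h : t ≤ f a + B) => hst.trans h)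
    refine Integrable.of_bound ha.measurable.aestronglyMeasurable 1 (ae_of_all _ fun t => ?_)
    rw [Real.norm_eq_abs, abs_of_nonneg measureReal_nonneg]
    exact measureReal_le_one
  rw [key p inferInstance, key q inferInstance, sub_sub_sub_cancel_right,
    ← integral_sub (hanti p inferInstance) (hanti q inferInstance)]
  have := norm_setIntegral_le_of_norm_le_const (μ := volume) (s := Set.Ioc 0 (2 * B))
    (f := fun t => p.real {a | t ≤ f a + B} - q.real {a | t ≤ f a + B}) (C := d)
    measure_Ioc_lt_top (fun t _ => aux_tv_set p q d h _
      (measurableSet_le measurable_const (hf.add_const B)))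
  rw [Real.norm_eq_abs] at this
  refine this.trans_eq ?_
  rw [Real.volume_real_Ioc_of_le (by positivity)]
  ring

lemma aux_bind {X Y : Type*} [MeasurableSpace X] [MeasurableSpace Y] (p : Measure X)
    [IsProbabilityMeasure p] (κ : X → Measure Y) (hκ : Measurable κ)
    (hκp : ∀ x, IsProbabilityMeasure (κ x)) (f : Y → ℝ) (hf : Measurable f) (B : ℝ)
    (hB : ∀ x, |f x| ≤ B) :
    ∫ y, f y ∂(p.bind κ) = ∫ x, ∫ y, f y ∂(κ x) ∂p := by
  let k : Kernel X Y := ⟨κ, hκ⟩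
  have : IsMarkovKernel k := ⟨hκp⟩
  have h : p.bind κ = k ∘ₘ p := rfl
  have hpb : IsProbabilityMeasure (p.bind κ) := by rw [h]; infer_instance
  have hi : Integrable f (k ∘ₘ p) := by rw [← h]; exact aux_int _ f hf B hB
  rw [h]
  rw [Measure.comp_eq_comp_const_apply] at hi ⊢
  rw [ProbabilityTheory.Kernel.integral_comp hi]
  rfl

section Ker
variable {S X : Type*} [MeasurableSpace S] [MeasurableSpace X]

lemma aux_iter_meas (P : S → X → Measure X) 
    (hPprob : ∀ s x, IsProbabilityMeasure (P s x))
    (hPmeas : Measurable fun p : S × X => P p.1 p.2) (k : ℕ) :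
    (∀ s x, IsProbabilityMeasure (iterK P s k x)) ∧
      Measurable fun p : S × X => iterK P p.1 k p.2 := by
  let κ : Kernel (S × X) X := ⟨fun p => P p.1 p.2, hPmeas⟩
  have : IsMarkovKernel κ := ⟨fun p => hPprob p.1 p.2⟩
  induction k with
  | zero =>
    refine ⟨fun s x => ?_, ?_⟩
    · simp only [iterK]; infer_instance
    · simp only [iterK]; exact Measure.measurable_dirac.comp measurable_snd
  | succ k ih =>
    obtain ⟨ih1, ih2⟩ := ih
    have hs : ∀ s, Measurable (iterK P s k) := fun s => ih2.comp measurable_prodMk_left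
    refine ⟨fun s x => ?_, ?_⟩
    · have := hPprob s x
      refine ⟨?_⟩
      simp only [iterK]
      rw [Measure.bind_apply MeasurableSet.univ (hs s).aemeasurable]
      have := fun a => (ih1 s a).measure_univ
      simp [this]
    · refine Measure.measurable_of_measurable_coe _ fun A hA => ?_
      simp only [iterK]
      simp_rw [Measure.bind_apply hA (hs _).aemeasurable]
      have hm : Measurable (Function.uncurry fun (p : S × X) (y : X) => iterK P p.1 k y A) :=
        ((Measure.measurable_coe hA).comp ih2).comp
          (measurable_fst.fst.prodMk measurable_snd)
      exact Measurable.lintegral_kernel_prod_right (κ := κ) hm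

/-- integrating against `P s x` preserves joint measurability -/
lemma aux_int_meas (P : S → X → Measure X)
    (hPprob : ∀ s x, IsProbabilityMeasure (P s x))
    (hPmeas : Measurable fun p : S × X => P p.1 p.2) (h : (S × X) × X → ℝ) (hh : Measurable h) :
    Measurable fun p : S × X => ∫ y, h (p, y) ∂(P p.1 p.2) := by
  let κ : Kernel (S × X) X := ⟨fun p => P p.1 p.2, hPmeas⟩
  have : IsMarkovKernel κ := ⟨fun p => hPprob p.1 p.2⟩
  exact (hh.stronglyMeasurable.integral_kernel_prod_right' (κ := κ)).measurable

/-- All facts on the Poisson solution that are needed. -/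
lemma aux_poisson (P : S → X → Measure X) (π : Measure X) [IsProbabilityMeasure π]
    (hPprob : ∀ s x, IsProbabilityMeasure (P s x))
    (hPmeas : Measurable fun p : S × X => P p.1 p.2)
    (hinv : ∀ s, π.bind (P s) = π)
    (C ρ : ℝ) (hρ : ρ ∈ Set.Ico (0 : ℝ) 1)
    (hA2 : ∀ s x k, tvDist (iterK P s k x) π ≤ C * ρ ^ k)
    (φ : X → ℝ) (hφm : Measurable φ) (B : ℝ) (hB : ∀ x, |φ x| ≤ B) :
    ∃ G : ℝ, (∀ s x, |gfun P π φ s x| ≤ G) ∧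
      (Measurable fun p : S × X => gfun P π φ p.1 p.2) ∧
      (∀ s x, gfun P π φ s x = (φ x - ∫ z, φ z ∂π) + Pg P π φ s x) ∧
      (∀ s, ∫ x, gfun P π φ s x ∂π = 0) := by
  set ψ : X → ℝ := fun y => φ y - ∫ z, φ z ∂π with hψ
  set J : ℕ → S → X → ℝ := fun k s x => ∫ y, ψ y ∂(iterK P s k x) with hJ
  have hψm : Measurable ψ := hφm.sub_const _
  have hψb : ∀ x, |ψ x| ≤ 2 * B := by
    intro x
    have := aux_int_le π φ B hB
    refine (abs_sub _ _).trans ?_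
    linarith [hB x]
  have hψπ : ∫ x, ψ x ∂π = 0 := by
    simp only [hψ]
    rw [integral_sub (aux_int π φ hφm B hB) (integrable_const _)]
    simp
  have hJb : ∀ k s x, |J k s x| ≤ 4 * B * C * ρ ^ k := by
    intro k s x
    have := (aux_iter_meas P hPprob hPmeas k).1 s x
    have h := aux_tv_int _ π _ (hA2 s x k) ψ hψm (2 * B) hψb
    rw [hψπ, sub_zero] at h
    exact h.trans_eq (by ring)
  have hJm : ∀ k, Measurable fun p : S × X => J k p.1 p.2 := by
    intro k
    let κ : Kernel (S × X) X := ⟨fun p => iterK P p.1 k p.2, (aux_iter_meas P hPprob hPmeas k).2⟩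
    exact (hψm.stronglyMeasurable.integral_kernel (κ := κ)).measurable
  have hJms : ∀ k s, Measurable (J k s) := fun k s => (hJm k).comp measurable_prodMk_left
  have hJ0 : ∀ s x, J 0 s x = ψ x := by
    intro s x
    simp only [hJ, iterK]
    exact integral_dirac' ψ x hψm.stronglyMeasurable
  have hJs : ∀ k s x, J (k + 1) s x = ∫ y, J k s y ∂(P s x) := by
    intro k s x
    have := hPprob s x
    simp only [hJ, iterK]
    exact aux_bind _ _ ((aux_iter_meas P hPprob hPmeas k).2.comp measurable_prodMk_left)
      ((aux_iter_meas P hPprob hPmeas k).1 s) ψ hψm _ hψb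
  have hgeo : Summable fun k : ℕ => 4 * B * C * ρ ^ k :=
    (summable_geometric_of_lt_one hρ.1 hρ.2).mul_left _
  have hsumm : ∀ s x, Summable fun k => J k s x := fun s x =>
    Summable.of_norm_bounded hgeo fun k => by simpa using hJb k s x
  have hg : ∀ s x, gfun P π φ s x = ∑' k, J k s x := fun s x => rfl
  have hswap : ∀ (p : Measure X) (s : S), IsProbabilityMeasure p →
      HasSum (fun k => ∫ y, J k s y ∂p) (∫ y, gfun P π φ s y ∂p) := by
    intro p s hp
    simp_rw [hg]
    refine hasSum_integral_of_summable_integral_norm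
      (fun k => aux_int p _ (hJms k s) _ (hJb k s)) ?_
    refine Summable.of_nonneg_of_le (fun k => integral_nonneg fun _ => norm_nonneg _)
      (fun k => ?_) hgeo
    exact (le_abs_self _).trans (aux_int_le p _ _ fun x => by
      rw [Real.norm_eq_abs, abs_abs]; exact hJb k s x)
  refine ⟨∑' k : ℕ, 4 * B * C * ρ ^ k, fun s x => ?_, ?_, fun s x => ?_, fun s => ?_⟩
  · rw [hg, ← Real.norm_eq_abs]
    exact tsum_of_norm_bounded hgeo.hasSum fun k => by simpa using hJb k s x
  · refine measurable_of_tendsto_metrizable (f := fun n (p : S × X) => ∑ k ∈ range n, J k p.1 p.2)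
      (fun n => Finset.measurable_fun_sum _ fun k _ => hJm k) ?_
    rw [tendsto_pi_nhds]
    intro p
    exact (hsumm p.1 p.2).hasSum.tendsto_sum_nat
  · rw [hg, (hsumm s x).tsum_eq_zero_add, hJ0]
    congr 1
    simp_rw [hJs]
    exact (hswap _ s (hPprob s x)).tsum_eq
  · have hz : ∀ k, ∫ y, J k s y ∂π = 0 := by
      intro k
      induction k with
      | zero => simp_rw [hJ0]; exact hψπ
      | succ k ih =>
        simp_rw [hJs]
        rw [← aux_bind π (P s) (hPmeas.comp measurable_prodMk_left) (hPprob s) _ (hJms k s) _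
          (hJb k s), hinv, ih]
    have := hswap π s inferInstance
    simp_rw [hz] at this
    exact this.unique hasSum_zero

/-- Lipschitz continuity of the Poisson solution in the kernel. -/
lemma aux_lip (P : S → X → Measure X) (π : Measure X) [IsProbabilityMeasure π]
    (hPprob : ∀ s x, IsProbabilityMeasure (P s x))
    (hPmeas : Measurable fun p : S × X => P p.1 p.2)
    (hinv : ∀ s, π.bind (P s) = π)
    (C ρ : ℝ) (hρ : ρ ∈ Set.Ico (0 : ℝ) 1)
    (hA2 : ∀ s x k, tvDist (iterK P s k x) π ≤ C * ρ ^ k)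
    (φ : X → ℝ) (G : ℝ) (hG : ∀ s x, |gfun P π φ s x| ≤ G)
    (hgm : Measurable fun p : S × X => gfun P π φ p.1 p.2)
    (hpo : ∀ s x, gfun P π φ s x = (φ x - ∫ z, φ z ∂π) + Pg P π φ s x)
    (hg0 : ∀ s, ∫ x, gfun P π φ s x ∂π = 0)
    (s s' : S) (d : ℝ) (hd : ∀ x, tvDist (P s x) (P s' x) ≤ d) (x : X) :
    |Pg P π φ s x - Pg P π φ s' x| ≤ (4 * G * C * ∑' k : ℕ, ρ ^ k) * d := by
  have hgms : ∀ s, Measurable (gfun P π φ s) := fun s => hgm.comp measurable_prodMk_left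
  have hPs : ∀ s, Measurable (P s) := fun s => hPmeas.comp measurable_prodMk_left
  set u : X → ℝ := fun x => gfun P π φ s x - gfun P π φ s' x with hu
  set w : X → ℝ := fun x => ∫ y, gfun P π φ s' y ∂(P s x) - ∫ y, gfun P π φ s' y ∂(P s' x) with hw
  have hum : Measurable u := (hgms s).sub (hgms s')
  have hub : ∀ x, |u x| ≤ 2 * G := fun x =>
    (abs_sub _ _).trans (by linarith [hG s x, hG s' x])
  have hker : ∀ (f : X → ℝ) (t : S), Measurable f → Measurable fun x => ∫ y, f y ∂(P t x) := by
    intro f t hf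
    let κ : Kernel X X := ⟨P t, hPs t⟩
    exact (hf.stronglyMeasurable.integral_kernel (κ := κ)).measurable
  have hwm : Measurable w := (hker _ s (hgms s')).sub (hker _ s' (hgms s'))
  have hwb : ∀ x, |w x| ≤ 2 * G * d := fun x =>
    aux_tv_int _ _ d (hd x) _ (hgms s') G (hG s')
  have hPgb : ∀ t t' x, |∫ y, gfun P π φ t y ∂(P t' x)| ≤ G := fun t t' x =>
    aux_int_le _ _ G (hG t)
  have hwπ : ∫ x, w x ∂π = 0 := by
    simp only [hw]
    rw [integral_sub (aux_int π _ (hker _ s (hgms s')) G (hPgb s' s))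
      (aux_int π _ (hker _ s' (hgms s')) G (hPgb s' s')),
      ← aux_bind π (P s) (hPs s) (hPprob s) _ (hgms s') G (hG s'),
      ← aux_bind π (P s') (hPs s') (hPprob s') _ (hgms s') G (hG s'), hinv, hinv, sub_self]
  have huπ : ∫ x, u x ∂π = 0 := by
    simp only [hu]
    rw [integral_sub (aux_int π _ (hgms s) G (hG s)) (aux_int π _ (hgms s') G (hG s')),
      hg0, hg0, sub_self]
  have huPg : ∀ x, Pg P π φ s x - Pg P π φ s' x = u x := by
    intro x
    simp only [hu]
    rw [hpo s, hpo s']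
    ring
  have hueq : ∀ x, u x = w x + ∫ y, u y ∂(P s x) := by
    intro x
    rw [← huPg]
    simp only [hu, hw]
    rw [integral_sub (aux_int _ _ (hgms s) G (hG s)) (aux_int _ _ (hgms s') G (hG s'))]
    simp only [Pg]
    ring
  have hiter : ∀ (f : X → ℝ) (b : ℝ), Measurable f → (∀ x, |f x| ≤ b) → ∫ x, f x ∂π = 0 →
      (∀ k x, |∫ y, f y ∂(iterK P s k x)| ≤ 2 * b * (C * ρ ^ k)) ∧
      (∀ k, Measurable fun x => ∫ y, f y ∂(iterK P s k x)) ∧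
      (∀ k x, ∫ y, f y ∂(iterK P s (k + 1) x) = ∫ z, ∫ y, f y ∂(iterK P s k z) ∂(P s x)) ∧
      (∀ x, ∫ y, f y ∂(iterK P s 0 x) = f x) := by
    intro f b hf hb hf0
    have hmk : ∀ k, Measurable (iterK P s k) := fun k =>
      (aux_iter_meas P hPprob hPmeas k).2.comp measurable_prodMk_left
    refine ⟨fun k x => ?_, fun k => ?_, fun k x => ?_, fun x => ?_⟩
    · have := (aux_iter_meas P hPprob hPmeas k).1 s x
      have h := aux_tv_int _ π _ (hA2 s x k) f hf b hb
      rwa [hf0, sub_zero] at h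
    · let κ : Kernel X X := ⟨iterK P s k, hmk k⟩
      exact (hf.stronglyMeasurable.integral_kernel (κ := κ)).measurable
    · simp only [iterK]
      exact aux_bind _ _ (hmk k) ((aux_iter_meas P hPprob hPmeas k).1 s) f hf b hb
    · simp only [iterK]
      exact integral_dirac' f x hf.stronglyMeasurable
  obtain ⟨ub, um, us, u0⟩ := hiter u _ hum hub huπ
  obtain ⟨wb, wm, ws, w0⟩ := hiter w _ hwm hwb hwπ
  have htel : ∀ n x, u x = ∑ j ∈ range n, ∫ y, w y ∂(iterK P s j x)
      + ∫ y, u y ∂(iterK P s n x) := by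
    intro n
    induction n with
    | zero => intro x; simp [u0]
    | succ n ih =>
      intro x
      have := hPprob s x
      rw [hueq x, us, Finset.sum_range_succ', w0]
      simp_rw [ws]
      rw [← integral_finsetSum _ fun j _ => aux_int _ _ (wm j) _ (wb j)]
      have i1 : Integrable (fun a => ∑ j ∈ range n, ∫ y, w y ∂(iterK P s j a)) (P s x) :=
        integrable_finsetSum _ fun j _ => aux_int _ _ (wm j) _ (wb j)
      have : ∫ y, u y ∂(P s x) = ∫ a, (∑ j ∈ range n, ∫ y, w y ∂(iterK P s j a)
          + ∫ y, u y ∂(iterK P s n a)) ∂(P s x) :=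
        integral_congr_ae (ae_of_all _ fun a => ih a)
      rw [this, integral_add i1 (aux_int _ _ (um n) _ (ub n))]
      ring
  have hgeo := summable_geometric_of_lt_one hρ.1 hρ.2
  have hlim : Tendsto (fun n => ∫ y, u y ∂(iterK P s n x)) atTop (𝓝 0) := by
    refine squeeze_zero_norm (fun n => ub n x) ?_
    have := ((tendsto_pow_atTop_nhds_zero_of_lt_one hρ.1 hρ.2).const_mul C).const_mul (2 * (2 * G))
    simpa using this
  have hbound : ∀ n, |u x - ∫ y, u y ∂(iterK P s n x)| ≤ (4 * G * C * ∑' k : ℕ, ρ ^ k) * d := by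
    intro n
    have h : u x - ∫ y, u y ∂(iterK P s n x) = ∑ j ∈ range n, ∫ y, w y ∂(iterK P s j x) := by
      rw [htel n x]; ring
    rw [h]
    have hb : ∀ j, |∫ y, w y ∂(iterK P s j x)| ≤ (4 * G * C * d) * ρ ^ j := fun j =>
      (wb j x).trans_eq (by ring)
    refine (Finset.abs_sum_le_sum_abs _ _).trans ?_
    refine (Finset.sum_le_sum fun j _ => hb j).trans ?_
    refine (Summable.sum_le_tsum _ (fun j _ => (abs_nonneg _).trans (hb j))
      (hgeo.mul_left _)).trans_eq ?_
    rw [tsum_mul_left]; ring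
  rw [huPg]
  have h3 : Tendsto (fun n => |u x - ∫ y, u y ∂(iterK P s n x)|) atTop (𝓝 |u x - 0|) :=
    (tendsto_const_nhds.sub hlim).abs
  rw [sub_zero] at h3
  exact le_of_tendsto' h3 hbound

/-- One-step disintegration. -/
lemma aux_onestep (P : S → X → Measure X)
    (hPprob : ∀ s x, IsProbabilityMeasure (P s x))
    (hPmeas : Measurable fun p : S × X => P p.1 p.2)
    {Ω : Type*} (m : MeasurableSpace Ω) [mΩ : MeasurableSpace Ω] (μ : Measure Ω)
    [IsProbabilityMeasure μ] (hm : m ≤ mΩ) (Q : Ω → S × X) (X' : Ω → X)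
    (hQ : Measurable[m] Q) (hX' : Measurable X')
    (hmarkov : ∀ (A : Set X), MeasurableSet A →
      μ[fun ω => A.indicator (fun _ => (1 : ℝ)) (X' ω) | m]
        =ᵐ[μ] fun ω => (P (Q ω).1 (Q ω).2 A).toReal)
    (Y : Ω → ℂ) (b : ℝ) (hY : Measurable[m] Y) (hYb : ∀ ω, ‖Y ω‖ ≤ b)
    (h : (S × X) × X → ℝ) (hh : Measurable h) (c : ℝ) (hc : ∀ z, |h z| ≤ c) :
    ∫ ω, Y ω * (h (Q ω, X' ω) : ℂ) ∂μ
      = ∫ ω, Y ω * ((∫ y, h (Q ω, y) ∂(P (Q ω).1 (Q ω).2) : ℝ) : ℂ) ∂μ := by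
  let κ : Kernel (ℂ × (S × X)) X := ⟨fun p => P p.2.1 p.2.2, hPmeas.comp measurable_snd⟩
  have hκ : IsMarkovKernel κ := ⟨fun p => hPprob p.2.1 p.2.2⟩
  set Z : Ω → ℂ × (S × X) := fun ω => (Y ω, Q ω) with hZ
  have hZm : Measurable[m] Z := hY.prodMk hQ
  have hZm' : Measurable Z := hZm.mono hm le_rfl
  have : IsProbabilityMeasure (μ.map Z) := Measure.isProbabilityMeasure_map hZm'.aemeasurable
  have hlaw : μ.map (fun ω => (Z ω, X' ω)) = (μ.map Z) ⊗ₘ κ := by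
    have : IsProbabilityMeasure (μ.map (fun ω => (Z ω, X' ω))) :=
      Measure.isProbabilityMeasure_map (hZm'.prodMk hX').aemeasurable
    refine Measure.ext_prod fun {s A} hs hA => ?_
    rw [Measure.compProd_apply_prod hs hA, Measure.map_apply (hZm'.prodMk hX') (hs.prod hA),
      setLIntegral_map hs (κ.measurable_coe hA) hZm']
    have hT : MeasurableSet[m] (Z ⁻¹' s) := hZm hs
    have hind : (fun ω => A.indicator (fun _ => (1 : ℝ)) (X' ω))
        = (X' ⁻¹' A).indicator (fun _ => (1 : ℝ)) := by
      ext ω; rfl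
    have hi : Integrable (fun ω => A.indicator (fun _ => (1 : ℝ)) (X' ω)) μ := by
      rw [hind]; exact (integrable_const _).indicator (hX' hA)
    have e1 := setIntegral_condExp hm hi hT
    rw [setIntegral_congr_ae (hm _ hT) ((hmarkov A hA).mono fun ω hω _ => hω), hind,
      integral_indicator (hX' hA), Measure.restrict_restrict (hX' hA)] at e1
    simp only [integral_const, smul_eq_mul, mul_one, measureReal_restrict_apply_univ] at e1
    have e2 : ∫ ω in Z ⁻¹' s, (P (Q ω).1 (Q ω).2 A).toReal ∂μ
        = (∫⁻ ω in Z ⁻¹' s, κ (Z ω) A ∂μ).toReal := by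
      refine integral_toReal ?_ (ae_of_all _ fun ω => ?_)
      · exact ((κ.measurable_coe hA).comp hZm').aemeasurable
      · exact measure_lt_top (κ (Z ω)) A
    rw [e2] at e1
    have hfin : ∫⁻ ω in Z ⁻¹' s, κ (Z ω) A ∂μ ≠ ⊤ := by
      refine ne_top_of_le_ne_top (b := μ (Z ⁻¹' s)) (measure_ne_top _ _) ?_
      refine (lintegral_mono (fun ω => prob_le_one)).trans ?_
      simp
    have e3 : (fun ω => (Z ω, X' ω)) ⁻¹' s ×ˢ A = X' ⁻¹' A ∩ Z ⁻¹' s := by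
      ext ω; simp [and_comm]
    rw [e3, ← ENNReal.toReal_eq_toReal_iff' (measure_ne_top _ _) hfin, e1]
    rfl
  set H : (ℂ × (S × X)) × X → ℂ := fun z => z.1.1 * (h (z.1.2, z.2) : ℂ) with hH
  have hHm : Measurable H := by
    simp only [hH]; fun_prop
  have s1 : ∫ ω, Y ω * (h (Q ω, X' ω) : ℂ) ∂μ = ∫ z, H z ∂(μ.map (fun ω => (Z ω, X' ω))) := by
    rw [integral_map (hZm'.prodMk hX').aemeasurable hHm.aestronglyMeasurable]
  have hHi : Integrable H (μ.map (fun ω => (Z ω, X' ω))) := by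
    rw [integrable_map_measure hHm.aestronglyMeasurable (hZm'.prodMk hX').aemeasurable]
    refine Integrable.of_bound (hHm.comp (hZm'.prodMk hX')).aestronglyMeasurable (b * c)
      (ae_of_all _ fun ω => ?_)
    simp only [hH, hZ, Function.comp, norm_mul, Complex.norm_real, Real.norm_eq_abs]
    exact mul_le_mul (hYb ω) (hc _) (abs_nonneg _) ((norm_nonneg _).trans (hYb ω))
  rw [s1, hlaw, Measure.integral_compProd (by rwa [← hlaw])]
  rw [integral_map hZm'.aemeasurable
    (hHm.stronglyMeasurable.integral_kernel_prod_right' (κ := κ)).aestronglyMeasurable]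
  refine integral_congr_ae (ae_of_all _ fun ω => ?_)
  simp only [hH, hZ]
  rw [integral_const_mul, integral_complex_ofReal]
  rfl

end Ker
/-- Under (A1), (A2), weakly 1/2-waning adaptation (A5) and
(A4) with constant `σ_φ² = v`, the central limit theorem holds:
`n^{-1/2} Σ_{k=1}^n (φ(X_k) − π(φ)) → N(0, σ_φ²)` in distribution. -/
theorem stmt9 {S X : Type*} [MeasurableSpace S] [MeasurableSpace X]
    (P : S → X → Measure X) (π : Measure X) [IsProbabilityMeasure π]
    (hPprob : ∀ s x, IsProbabilityMeasure (P s x))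
    (hPmeas : ∀ A : Set X, MeasurableSet A → Measurable fun p : S × X => P p.1 p.2 A)
    (hinv : ∀ s, π.bind (P s) = π)
    (C ρ : ℝ) (hρ : ρ ∈ Set.Ico (0 : ℝ) 1)
    (hA2 : ∀ s x k, tvDist (iterK P s k x) π ≤ C * ρ ^ k)
    {Ω : Type*} [mΩ : MeasurableSpace Ω] (μ : Measure Ω) [IsProbabilityMeasure μ]
    (F : Filtration ℕ mΩ) (Sp : ℕ → Ω → S) (Xp : ℕ → Ω → X)
    (hadapted : ∀ k, Measurable[F k] fun ω => (Sp k ω, Xp k ω))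
    (hmarkov : ∀ (k : ℕ) (A : Set X), MeasurableSet A →
      μ[fun ω => A.indicator (fun _ => (1 : ℝ)) (Xp (k + 1) ω) | F k]
        =ᵐ[μ] fun ω => (P (Sp k ω) (Xp k ω) A).toReal)
    (φ : X → ℝ) (hφm : Measurable φ) (hφb : ∃ B, ∀ x, |φ x| ≤ B)
    (D : ℕ → Ω → ℝ) (hD01 : ∀ k ω, D k ω ∈ Set.Icc (0 : ℝ) 1)
    (hDbound : ∀ k, 1 ≤ k → ∀ ω x,
      tvDist (P (Sp k ω) x) (P (Sp (k - 1) ω) x) ≤ D k ω)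
    (hwaning : TendstoInMeasure μ
      (fun n ω => (∑ k ∈ Finset.Icc 1 n, D k ω) / Real.sqrt n) atTop (fun _ => 0))
    (v : ℝ≥0)
    (hA4 : TendstoInMeasure μ (fun n ω => (∑ k ∈ Finset.Icc 1 n,
        ((∫ y, gfun P π φ (Sp (k - 1) ω) y ^ 2 ∂(P (Sp (k - 1) ω) (Xp (k - 1) ω)))
          - Pg P π φ (Sp (k - 1) ω) (Xp (k - 1) ω) ^ 2)) / n)
      atTop (fun _ => (v : ℝ))) :
    ∀ f : BoundedContinuousFunction ℝ ℝ,
      Tendsto (fun n : ℕ => ∫ ω, f ((∑ k ∈ Finset.Icc 1 n,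
          (φ (Xp k ω) - ∫ x, φ x ∂π)) / Real.sqrt n) ∂μ)
        atTop (𝓝 (∫ x, f x ∂(gaussianReal 0 v))) := by
  obtain ⟨B, hB⟩ := hφb
  have hPm : Measurable fun p : S × X => P p.1 p.2 :=
    Measure.measurable_of_measurable_coe _ hPmeas
  obtain ⟨G, hG, hgm, hpo, hg0⟩ :=
    aux_poisson P π hPprob hPm hinv C ρ hρ hA2 φ hφm B hB
  have hlip := aux_lip P π hPprob hPm hinv C ρ hρ hA2 φ G hG hgm hpo hg0
  set c : ℝ := 4 * G * C * ∑' k : ℕ, ρ ^ k with hc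
  have hgms : ∀ s, Measurable (gfun P π φ s) := fun s => hgm.comp measurable_prodMk_left
  have hPgb : ∀ s x, |Pg P π φ s x| ≤ G := fun s x => aux_int_le _ _ G (hG s)
  have hG0 : 0 ≤ G := by
    obtain ⟨ω⟩ : Nonempty Ω := by
      by_contra h
      rw [not_nonempty_iff] at h
      have := measure_univ (μ := μ)
      simp [Measure.eq_zero_of_isEmpty μ] at this
    exact (abs_nonneg _).trans (hG (Sp 0 ω) (Xp 0 ω))
  have hgm3 : Measurable fun z : (S × X) × X => gfun P π φ z.1.1 z.2 :=
    hgm.comp (measurable_fst.fst.prodMk measurable_snd)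
  have hPgm : Measurable fun p : S × X => Pg P π φ p.1 p.2 :=
    aux_int_meas P hPprob hPm (fun z => gfun P π φ z.1.1 z.2) hgm3
  have hg2m : Measurable fun p : S × X => ∫ y, gfun P π φ p.1 y ^ 2 ∂(P p.1 p.2) :=
    aux_int_meas P hPprob hPm (fun z => gfun P π φ z.1.1 z.2 ^ 2) (hgm3.pow_const 2)
  have hg2 : ∀ s x, |gfun P π φ s x ^ 2| ≤ G ^ 2 := fun s x => by
    rw [abs_pow]; exact pow_le_pow_left₀ (abs_nonneg _) (hG s x) 2
  set ξ : ℕ → Ω → ℝ := fun k ω =>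
    gfun P π φ (Sp k ω) (Xp (k + 1) ω) - Pg P π φ (Sp k ω) (Xp k ω) with hξ
  set W : ℕ → Ω → ℝ := fun k ω =>
    (∫ y, gfun P π φ (Sp k ω) y ^ 2 ∂(P (Sp k ω) (Xp k ω))) - Pg P π φ (Sp k ω) (Xp k ω) ^ 2
    with hW
  have hreidx : ∀ (n : ℕ) (f : ℕ → ℝ), ∑ k ∈ Finset.Icc 1 n, f k = ∑ k ∈ range n, f (k + 1) := by
    intro n f
    induction n with
    | zero => simp
    | succ n ih => rw [Finset.sum_Icc_succ_top (by omega), ih, Finset.sum_range_succ]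
  have hSm : ∀ k, Measurable[F k] (Sp k) := fun k => measurable_fst.comp (hadapted k)
  have hXm : ∀ k, Measurable[F k] (Xp k) := fun k => measurable_snd.comp (hadapted k)
  have hXm' : ∀ k, Measurable (Xp k) := fun k => (hXm k).mono (F.le k) le_rfl
  have hPgF : ∀ k, Measurable[F k] fun ω => Pg P π φ (Sp k ω) (Xp k ω) := fun k =>
    hPgm.comp (hadapted k)
  have hξm : ∀ k, Measurable[F (k + 1)] (ξ k) := by
    intro k
    have hle : F k ≤ F (k + 1) := F.mono (Nat.le_succ k)
    have e1 : Measurable[F (k + 1)] fun ω => (Sp k ω, Xp (k + 1) ω) :=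
      ((hSm k).mono hle le_rfl).prodMk (hXm (k + 1))
    exact (hgm.comp e1).sub ((hPgF k).mono hle le_rfl)
  have hWm : ∀ k, Measurable[F k] (W k) := fun k =>
    (hg2m.comp (hadapted k)).sub ((hPgF k).pow_const 2)
  have hh : Measurable fun z : (S × X) × X => gfun P π φ z.1.1 z.2 - Pg P π φ z.1.1 z.1.2 :=
    hgm3.sub (hPgm.comp measurable_fst)
  have hhb : ∀ z : (S × X) × X,
      |gfun P π φ z.1.1 z.2 - Pg P π φ z.1.1 z.1.2| ≤ 2 * G := fun z =>
    (abs_sub _ _).trans (by linarith [hG z.1.1 z.2, hPgb z.1.1 z.1.2])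
  have hhb2 : ∀ z : (S × X) × X,
      |(gfun P π φ z.1.1 z.2 - Pg P π φ z.1.1 z.1.2) ^ 2| ≤ (2 * G) ^ 2 := fun z => by
    rw [abs_pow]; exact pow_le_pow_left₀ (abs_nonneg _) (hhb z) 2
  have hξb : ∀ k ω, |ξ k ω| ≤ 2 * G := fun k ω => hhb ((Sp k ω, Xp k ω), Xp (k + 1) ω)
  have hWb : ∀ k ω, |W k ω| ≤ (2 * G) ^ 2 := by
    intro k ω
    have i1 := aux_int_le (P (Sp k ω) (Xp k ω)) _ (G ^ 2) (hg2 (Sp k ω))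
    have i2 : Pg P π φ (Sp k ω) (Xp k ω) ^ 2 ≤ G ^ 2 := by
      rw [← sq_abs]; exact pow_le_pow_left₀ (abs_nonneg _) (hPgb _ _) 2
    have i3 := sq_nonneg (Pg P π φ (Sp k ω) (Xp k ω))
    have i4 := abs_le.1 i1
    simp only [hW]
    rw [abs_le]
    constructor <;> nlinarith [sq_nonneg G]
  have h1 : ∀ k (Y : Ω → ℂ) (B : ℝ), Measurable[F k] Y → (∀ ω, ‖Y ω‖ ≤ B) →
      ∫ ω, Y ω * (ξ k ω : ℂ) ∂μ = 0 := by
    intro k Y b hY hYb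
    have := aux_onestep P hPprob hPm (F k) μ (F.le k) (fun ω => (Sp k ω, Xp k ω)) (Xp (k + 1))
      (hadapted k) (hXm' (k + 1)) (hmarkov k) Y b hY hYb _ hh (2 * G) hhb
    refine this.trans ?_
    have hz : ∀ s x, ∫ y, (gfun P π φ s y - Pg P π φ s x) ∂(P s x) = 0 := by
      intro s x
      rw [integral_sub (aux_int _ _ (hgms s) G (hG s)) (integrable_const _)]
      simp [Pg]
    simp only [hz]
    simp
  have h2 : ∀ k (Y : Ω → ℂ) (B : ℝ), Measurable[F k] Y → (∀ ω, ‖Y ω‖ ≤ B) →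
      ∫ ω, Y ω * ((ξ k ω ^ 2 : ℝ) : ℂ) ∂μ = ∫ ω, Y ω * (W k ω : ℂ) ∂μ := by
    intro k Y b hY hYb
    have := aux_onestep P hPprob hPm (F k) μ (F.le k) (fun ω => (Sp k ω, Xp k ω)) (Xp (k + 1))
      (hadapted k) (hXm' (k + 1)) (hmarkov k) Y b hY hYb _ (hh.pow_const 2) ((2 * G) ^ 2) hhb2
    refine this.trans ?_
    have hz : ∀ s x, ∫ y, (gfun P π φ s y - Pg P π φ s x) ^ 2 ∂(P s x)
        = (∫ y, gfun P π φ s y ^ 2 ∂(P s x)) - Pg P π φ s x ^ 2 := by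
      intro s x
      have ig := aux_int (P s x) _ (hgms s) G (hG s)
      have ig2 := aux_int (P s x) _ ((hgms s).pow_const 2) (G ^ 2) (hg2 s)
      have e : ∀ y, (gfun P π φ s y - Pg P π φ s x) ^ 2
          = (gfun P π φ s y ^ 2 - 2 * Pg P π φ s x * gfun P π φ s y) + Pg P π φ s x ^ 2 := by
        intro y; ring
      have ig3 : Integrable (fun y => gfun P π φ s y ^ 2
          - 2 * Pg P π φ s x * gfun P π φ s y) (P s x) := ig2.sub (ig.const_mul _)
      simp_rw [e]
      rw [integral_add ig3 (integrable_const _),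
        integral_sub ig2 (ig.const_mul _), integral_const_mul]
      have e3 : ∫ y, gfun P π φ s y ∂(P s x) = Pg P π φ s x := rfl
      rw [e3]
      simp
      ring
    simp only [hz]
    rfl
  have hV : TendstoInMeasure μ (fun n ω => (∑ k ∈ range n, W k ω) / n) atTop
      (fun _ => (v : ℝ)) := by
    simp only [hreidx, Nat.add_sub_cancel] at hA4
    exact hA4
  set T : ℕ → Ω → ℝ := fun n ω => (∑ k ∈ Finset.Icc 1 n,
          (φ (Xp k ω) - ∫ x, φ x ∂π)) / Real.sqrt n with hT
  have hTm : ∀ n, Measurable (T n) := fun n =>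
    (Finset.measurable_fun_sum _ fun k _ => (hφm.comp (hXm' k)).sub_const _).div_const _
  have ha : Tendsto (fun n : ℕ => 2 * G / Real.sqrt n) atTop (𝓝 0) :=
    tendsto_const_nhds.div_atTop (Real.tendsto_sqrt_atTop.comp tendsto_natCast_atTop_atTop)
  have hTR : ∀ n ω, |T n ω - (∑ k ∈ range n, ξ k ω) / Real.sqrt n|
      ≤ 2 * G / Real.sqrt n + c * |(∑ k ∈ Finset.Icc 1 n, D k ω) / Real.sqrt n| := by
    intro n ω
    have hDn : 0 ≤ (∑ k ∈ Finset.Icc 1 n, D k ω) / Real.sqrt n :=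
      div_nonneg (Finset.sum_nonneg fun k _ => (hD01 k ω).1) (Real.sqrt_nonneg _)
    rw [abs_of_nonneg hDn]
    simp only [hT]
    rw [← sub_div, abs_div, abs_of_nonneg (Real.sqrt_nonneg _), ← mul_div_assoc, ← add_div]
    refine div_le_div_of_nonneg_right ?_ (Real.sqrt_nonneg _)
    rw [hreidx, hreidx, ← Finset.sum_sub_distrib]
    set p : ℕ → ℝ := fun k => Pg P π φ (Sp k ω) (Xp k ω) with hp
    have e : ∀ k, φ (Xp (k + 1) ω) - ∫ x, φ x ∂π - ξ k ω
        = (p k - p (k + 1)) + (Pg P π φ (Sp (k + 1) ω) (Xp (k + 1) ω)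
            - Pg P π φ (Sp k ω) (Xp (k + 1) ω)) := by
      intro k
      simp only [hξ, hp]
      rw [hpo]
      ring
    simp_rw [e]
    rw [Finset.sum_add_distrib, Finset.sum_range_sub']
    refine (abs_add_le _ _).trans (add_le_add ?_ ?_)
    · exact (abs_sub _ _).trans (by
        have := hPgb (Sp 0 ω) (Xp 0 ω)
        have := hPgb (Sp n ω) (Xp n ω)
        simp only [hp]
        linarith)
    · rw [Finset.mul_sum]
      refine (Finset.abs_sum_le_sum_abs _ _).trans (Finset.sum_le_sum fun k _ => ?_)
      exact hlip _ _ _ (fun x => hDbound (k + 1) (by omega) ω x) _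
  have hcf := aux_mclt μ F ξ W hξm hWm (2 * G) hξb hWb h1 h2 v hV T hTm _ ha c _ hwaning hTR
  let ν : ℕ → ProbabilityMeasure ℝ := fun n =>
    ⟨μ.map (T n), Measure.isProbabilityMeasure_map (hTm n).aemeasurable⟩
  let ν₀ : ProbabilityMeasure ℝ := ⟨gaussianReal 0 v, inferInstance⟩
  have hν : Tendsto ν atTop (𝓝 ν₀) := by
    refine ProbabilityMeasure.tendsto_of_tendsto_charFun fun t => ?_
    have l1 : charFun (ν₀ : Measure ℝ) t = Complex.exp (-(t ^ 2 * v / 2)) := by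
      change charFun (gaussianReal 0 v) t = _
      rw [charFun_gaussianReal]
      congr 1
      push_cast
      ring
    have l2 : ∀ n, charFun (ν n : Measure ℝ) t
        = ∫ ω, Complex.exp (Complex.I * t * T n ω) ∂μ := by
      intro n
      change charFun (μ.map (T n)) t = _
      rw [charFun_apply_real, integral_map (hTm n).aemeasurable (by fun_prop)]
      refine integral_congr_ae (ae_of_all _ fun ω => ?_)
      simp only
      congr 1
      ring
    rw [l1]
    simp_rw [l2]
    exact hcf t
  intro f
  have := (ProbabilityMeasure.tendsto_iff_forall_integral_tendsto.1 hν) f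
  refine this.congr fun n => ?_
  exact integral_map (hTm n).aemeasurable f.continuous.aestronglyMeasurable
end
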